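/- Let Φ be the root system of type B_r (r ≥ 2), C_r (r ≥ 3), or D_r (r ≥ 4), let λ ∈ X be a dominant integral weight, let w ∈ W have reduced word w = s_{i_1}⋯s_{i_k}, and let μ ∈ X satisfy λ − μ ∈ Q and μ ∈ conv{uλ : u ∈ W, u ≤ w}. Then the coefficient of e^μ in the Demazure character D_{i_1}⋯D_{i_k}(e^λ) is nonzero (in fact positive); that is, Demazure characters in types B_r, C_r, D_r are saturated. -/

import Mathlib

open scoped Classical

/-- Data of a root system with a fixed choice of simple roots: an ambient
`ℚ`-vector space `V`, a set of roots `Φ` with a distinguished subset `pos` of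
positive roots, a coroot functional `coroot β = ⟨·, β^∨⟩` for each root, and
simple roots `α 1, …, α r`. -/
structure RootData where
  r : ℕ
  V : Type
  [grp : AddCommGroup V]
  [mod : Module ℚ V]
  Φ : Set V
  pos : Set V
  coroot : V → Module.Dual ℚ V
  α : Fin r → V

attribute [instance] RootData.grp RootData.mod

namespace RootData

variable (R : RootData)

/-- The group of linear automorphisms of `V`, in which the Weyl group lives. -/
abbrev Aut : Type := R.V ≃ₗ[ℚ] R.V

/-- The linear map `v ↦ v - ⟨v, β^∨⟩ β`. -/
noncomputable def reflMap (β : R.V) : R.V →ₗ[ℚ] R.V :=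
  LinearMap.id - (R.coroot β).smulRight β

/-- The reflection `s_β` associated to a root `β`, as a linear automorphism. -/
noncomputable def s (β : R.V) : R.Aut :=
  if h : (R.reflMap β).comp (R.reflMap β) = LinearMap.id then
    LinearEquiv.ofLinear (R.reflMap β) (R.reflMap β) h h
  else LinearEquiv.refl ℚ R.V

/-- The simple reflections `s_i := s_{α_i}`. -/
noncomputable def S (i : Fin R.r) : R.Aut := R.s (R.α i)

/-- The Weyl group `W`, generated by the simple reflections. -/
noncomputable def weylGroup : Subgroup R.Aut := Subgroup.closure (Set.range R.S)

/-- The product `s_{i_1} ⋯ s_{i_k}` of a word in the simple reflections. -/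
noncomputable def wordProd (l : List (Fin R.r)) : R.Aut := (l.map R.S).prod

/-- The length function on `W`: least length of a word in the simple
reflections expressing the given element. -/
noncomputable def len (w : R.Aut) : ℕ :=
  sInf {n | ∃ l : List (Fin R.r), l.length = n ∧ R.wordProd l = w}

/-- A word is reduced if its length equals the length of its product. -/
def Reduced (l : List (Fin R.r)) : Prop := R.len (R.wordProd l) = l.length

/-- The Bruhat order on `W`: `u ≤ w` iff some reduced word for `w` has a
subword whose product is `u`. -/
def BruhatLE (u w : R.Aut) : Prop :=
  ∃ l : List (Fin R.r), R.Reduced l ∧ R.wordProd l = w ∧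
    ∃ l' : List (Fin R.r), l'.Sublist l ∧ R.wordProd l' = u

/-- Strict Bruhat order. -/
def BruhatLT (u w : R.Aut) : Prop := R.BruhatLE u w ∧ u ≠ w

/-- One step of the Demazure product: `s_i * w := max {w, s_i w}`. -/
noncomputable def dmulStep (i : Fin R.r) (x : R.Aut) : R.Aut :=
  if R.len x < R.len (R.S i * x) then R.S i * x else x

/-- Demazure product of a word in the simple reflections against `w`:
`s_{i_1} * (s_{i_2} * (⋯ * (s_{i_k} * w)))`. -/
noncomputable def dmulList (l : List (Fin R.r)) (w : R.Aut) : R.Aut :=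
  l.foldr R.dmulStep w

/-- The Demazure product `v * w` on the Weyl group, computed by choosing a
reduced word for `v` (it is independent of this choice). -/
noncomputable def dmul (v w : R.Aut) : R.Aut :=
  if h : ∃ l : List (Fin R.r), R.Reduced l ∧ R.wordProd l = v then
    R.dmulList h.choose w
  else v * w

/-- The parabolic subgroup `W_{P_i}` generated by the simple reflections
`s_j`, `j ≠ i`. -/
noncomputable def WPar (i : Fin R.r) : Subgroup R.Aut :=
  Subgroup.closure (R.S '' {j | j ≠ i})

/-- `W^{P_i}`: the set of minimal-length representatives of cosets of
`W/W_{P_i}`. -/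
def minReps (i : Fin R.r) : Set R.Aut :=
  {v | v ∈ R.weylGroup ∧ ∀ p ∈ R.WPar i, R.len v ≤ R.len (v * p)}

/-- `u` is the minimal-length representative of the coset `w W_{P_i}`. -/
def IsMinRep (i : Fin R.r) (u w : R.Aut) : Prop :=
  u ∈ R.minReps i ∧ u⁻¹ * w ∈ R.WPar i

/-- A weight is dominant if it pairs nonnegatively with every simple coroot. -/
def Dominant (lam : R.V) : Prop := ∀ i : Fin R.r, 0 ≤ R.coroot (R.α i) lam

/-- The dual action of the Weyl group on `V* `: `(u f)(v) = f(u⁻¹ v)`. -/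
noncomputable def dualAct (u : R.Aut) (f : Module.Dual ℚ R.V) : Module.Dual ℚ R.V :=
  f.comp (u.symm : R.V →ₗ[ℚ] R.V)

/-- The Demazure polytope `P_λ^w := conv {uλ : u ∈ W, u ≤ w}`. -/
noncomputable def demPolytope (lam : R.V) (w : R.Aut) : Set R.V :=
  convexHull ℚ {m | ∃ u : R.Aut, u ∈ R.weylGroup ∧ R.BruhatLE u w ∧ m = u lam}

/-- Membership in the weight lattice `X`. -/
def IsWeight (lam : R.V) : Prop := ∀ β ∈ R.Φ, ∃ m : ℤ, R.coroot β lam = (m : ℚ)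

/-- The root lattice `Q = ℤΦ`. -/
noncomputable def rootLattice : AddSubgroup R.V := AddSubgroup.closure R.Φ

/-- `w₀` is the longest element of the Weyl group. -/
def IsLongest (w₀ : R.Aut) : Prop :=
  w₀ ∈ R.weylGroup ∧ ∀ g ∈ R.weylGroup, R.len g ≤ R.len w₀

/-- The positive roots `Φ_{P_i}⁺ = Φ⁺ ∩ span {α_j : j ≠ i}` of the standard
Levi subsystem. -/
def parPos (i : Fin R.r) : Set R.V :=
  {η | η ∈ R.pos ∧ η ∈ Submodule.span ℚ (R.α '' {j | j ≠ i})}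

/-- The value `D_i (e^λ)` of the Demazure operator on a basis element of the
group ring `ℤ[X]`. -/
noncomputable def demOnBasis (i : Fin R.r) (lam : R.V) : R.V →₀ ℤ :=
  if 0 ≤ ⌊R.coroot (R.α i) lam⌋ then
    ∑ k ∈ Finset.range (⌊R.coroot (R.α i) lam⌋.toNat + 1),
      Finsupp.single (lam - (k : ℚ) • R.α i) 1
  else if ⌊R.coroot (R.α i) lam⌋ = -1 then 0
  else - ∑ k ∈ Finset.range ((-⌊R.coroot (R.α i) lam⌋).toNat - 1),
      Finsupp.single (lam + ((k : ℚ) + 1) • R.α i) 1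

/-- The Demazure operator `D_i`, as a `ℤ`-linear endomorphism of the group
ring `ℤ[X]` (realized as finitely supported functions `V →₀ ℤ`). -/
noncomputable def demOp (i : Fin R.r) : (R.V →₀ ℤ) →ₗ[ℤ] (R.V →₀ ℤ) :=
  Finsupp.lsum ℤ fun lam => LinearMap.toSpanSingleton ℤ (R.V →₀ ℤ) (R.demOnBasis i lam)

/-- The Demazure character `D_{i_1} ⋯ D_{i_k} (e^λ)`. -/
noncomputable def demChar (l : List (Fin R.r)) (lam : R.V) : R.V →₀ ℤ :=
  l.foldr (fun i p => R.demOp i p) (Finsupp.single lam 1)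

/-- The axioms of a finite crystallographic root system spanning `V`, with
simple roots `α_i` and positive roots `pos`. -/
structure IsRootSystem (R : RootData) : Prop where
  finite : R.Φ.Finite
  span_top : Submodule.span ℚ R.Φ = ⊤
  ne_zero : ∀ β ∈ R.Φ, β ≠ 0
  coroot_self : ∀ β ∈ R.Φ, R.coroot β β = 2
  crystallographic : ∀ β ∈ R.Φ, ∀ γ ∈ R.Φ, ∃ m : ℤ, R.coroot β γ = (m : ℚ)
  reflection_stable : ∀ β ∈ R.Φ, ∀ γ ∈ R.Φ, γ - R.coroot β γ • β ∈ R.Φ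
  simple_mem : ∀ i, R.α i ∈ R.Φ
  indep : LinearIndependent ℚ R.α
  pos_subset : R.pos ⊆ R.Φ
  pos_or_neg : ∀ β ∈ R.Φ, (β ∈ R.pos ∧ -β ∉ R.pos) ∨ (β ∉ R.pos ∧ -β ∈ R.pos)
  simple_pos : ∀ i, R.α i ∈ R.pos
  pos_nonneg_comb : ∀ β ∈ R.pos, ∃ c : Fin R.r → ℚ, (∀ i, 0 ≤ c i) ∧ β = ∑ i, c i • R.α i

end RootData

/-- The "dot product with `β`" linear functional on `ℚ^n`. -/
noncomputable def dotL {n : ℕ} (β : Fin n → ℚ) : Module.Dual ℚ (Fin n → ℚ) :=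
  ∑ a, β a • LinearMap.proj a

/-- The coroot functional `⟨·, β^∨⟩ = 2(β,·)/(β,β)` for the standard inner
product on `ℚ^n`. -/
noncomputable def stdCoroot {n : ℕ} (β : Fin n → ℚ) : Module.Dual ℚ (Fin n → ℚ) :=
  (2 / dotL β β) • dotL β

/-- The root system of type `A_r` inside `ℚ^{r+1}`:
roots `e_a - e_b` (`a ≠ b`), simple roots `α_i = e_i - e_{i+1}`. -/
noncomputable def typeA (r : ℕ) : RootData where
  r := r
  V := Fin (r + 1) → ℚ
  Φ := {v | ∃ a b : Fin (r + 1), a ≠ b ∧ v = Pi.single a 1 - Pi.single b 1}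
  pos := {v | ∃ a b : Fin (r + 1), a < b ∧ v = Pi.single a 1 - Pi.single b 1}
  coroot := stdCoroot
  α := fun i => Pi.single i.castSucc 1 - Pi.single i.succ 1

/-- The root system of type `B_r` inside `ℚ^r`: roots `±e_a`, `±e_a ± e_b`. -/
noncomputable def typeB (r : ℕ) : RootData where
  r := r
  V := Fin r → ℚ
  Φ := {v | (∃ a : Fin r, v = Pi.single a 1 ∨ v = -Pi.single a 1) ∨
      ∃ a b : Fin r, a < b ∧ (v = Pi.single a 1 - Pi.single b 1 ∨
        v = Pi.single a 1 + Pi.single b 1 ∨ v = -(Pi.single a 1 - Pi.single b 1) ∨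
        v = -(Pi.single a 1 + Pi.single b 1))}
  pos := {v | (∃ a : Fin r, v = Pi.single a 1) ∨
      ∃ a b : Fin r, a < b ∧ (v = Pi.single a 1 - Pi.single b 1 ∨
        v = Pi.single a 1 + Pi.single b 1)}
  coroot := stdCoroot
  α := fun i => if h : (i : ℕ) + 1 < r then
      Pi.single i 1 - Pi.single (⟨(i : ℕ) + 1, h⟩ : Fin r) 1
    else Pi.single i (1 : ℚ)

/-- The root system of type `C_r` inside `ℚ^r`: roots `±2e_a`, `±e_a ± e_b`. -/
noncomputable def typeC (r : ℕ) : RootData where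
  r := r
  V := Fin r → ℚ
  Φ := {v | (∃ a : Fin r, v = Pi.single a (2 : ℚ) ∨ v = -(Pi.single a (2 : ℚ))) ∨
      ∃ a b : Fin r, a < b ∧ (v = Pi.single a 1 - Pi.single b 1 ∨
        v = Pi.single a 1 + Pi.single b 1 ∨ v = -(Pi.single a 1 - Pi.single b 1) ∨
        v = -(Pi.single a 1 + Pi.single b 1))}
  pos := {v | (∃ a : Fin r, v = Pi.single a (2 : ℚ)) ∨
      ∃ a b : Fin r, a < b ∧ (v = Pi.single a 1 - Pi.single b 1 ∨
        v = Pi.single a 1 + Pi.single b 1)}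
  coroot := stdCoroot
  α := fun i => if h : (i : ℕ) + 1 < r then
      Pi.single i 1 - Pi.single (⟨(i : ℕ) + 1, h⟩ : Fin r) 1
    else Pi.single i (2 : ℚ)

/-- The root system of type `D_r` inside `ℚ^r`: roots `±e_a ± e_b` (`a < b`). -/
noncomputable def typeD (r : ℕ) : RootData where
  r := r
  V := Fin r → ℚ
  Φ := {v | ∃ a b : Fin r, a < b ∧ (v = Pi.single a 1 - Pi.single b 1 ∨
        v = Pi.single a 1 + Pi.single b 1 ∨ v = -(Pi.single a 1 - Pi.single b 1) ∨
        v = -(Pi.single a 1 + Pi.single b 1))}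
  pos := {v | ∃ a b : Fin r, a < b ∧ (v = Pi.single a 1 - Pi.single b 1 ∨
        v = Pi.single a 1 + Pi.single b 1)}
  coroot := stdCoroot
  α := fun i => if h : (i : ℕ) + 1 < r then
      Pi.single i 1 - Pi.single (⟨(i : ℕ) + 1, h⟩ : Fin r) 1
    else if h2 : 1 < r then
      Pi.single (⟨r - 2, by omega⟩ : Fin r) 1 + Pi.single (⟨r - 1, by omega⟩ : Fin r) 1
    else 0

open scoped Matrix

namespace RootData

variable {R : RootData}

/-- The reflection in `β`, as a plain function. -/
noncomputable def refl (R : RootData) (β v : R.V) : R.V := v - R.coroot β v • β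

/-- The properties of a finite crystallographic root system with an invariant bilinear form on
which the path model for Demazure characters rests. -/
structure IsCrystallographic (R : RootData) (B : R.V →ₗ[ℚ] R.V →ₗ[ℚ] ℚ) : Prop where
  symm : ∀ x y, B x y = B y x
  form_pos : ∀ β ∈ R.Φ, 0 < B β β
  coroot_eq : ∀ β ∈ R.Φ, ∀ v, R.coroot β v = 2 * B β v / B β β
  refl_mem : ∀ β ∈ R.Φ, ∀ γ ∈ R.Φ, R.refl β γ ∈ R.Φ
  integral : ∀ β ∈ R.Φ, ∀ γ ∈ R.Φ, ∃ m : ℤ, R.coroot β γ = m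
  finite_pos : R.pos.Finite
  pos_subset : R.pos ⊆ R.Φ
  pos_or : ∀ β ∈ R.Φ, β ∈ R.pos ∨ -β ∈ R.pos
  exists_height : ∃ ht : Module.Dual ℚ R.V, ∀ β ∈ R.pos, 0 < ht β
  simple_pos : ∀ i, R.α i ∈ R.pos
  simple_refl : ∀ i, ∀ β ∈ R.pos, β ≠ R.α i → R.refl (R.α i) β ∈ R.pos
  dominant_pos : ∀ v, R.Dominant v → ∀ β ∈ R.pos, 0 ≤ R.coroot β v

namespace IsCrystallographic

variable {B : R.V →ₗ[ℚ] R.V →ₗ[ℚ] ℚ}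

theorem simple_mem (h : R.IsCrystallographic B) (i : Fin R.r) : R.α i ∈ R.Φ :=
  h.pos_subset (h.simple_pos i)

theorem neg_notMem (h : R.IsCrystallographic B) {β : R.V} (hβ : β ∈ R.pos) : -β ∉ R.pos := by
  intro hn
  obtain ⟨ht, hpos⟩ := h.exists_height
  have h1 := hpos _ hβ
  have h2 := hpos _ hn
  rw [map_neg] at h2
  linarith

theorem coroot_self (h : R.IsCrystallographic B) {β : R.V} (hβ : β ∈ R.Φ) : R.coroot β β = 2 := by
  rw [h.coroot_eq β hβ]
  field_simp [(h.form_pos β hβ).ne']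

theorem coroot_refl_self (h : R.IsCrystallographic B) {β : R.V} (hβ : β ∈ R.Φ) (v : R.V) :
    R.coroot β (R.refl β v) = -R.coroot β v := by
  simp only [refl, map_sub, map_smul, h.coroot_self hβ, smul_eq_mul]
  ring

theorem refl_refl (h : R.IsCrystallographic B) {β : R.V} (hβ : β ∈ R.Φ) (v : R.V) :
    R.refl β (R.refl β v) = v := by
  rw [refl, h.coroot_refl_self hβ, refl]
  module

theorem refl_self (h : R.IsCrystallographic B) {β : R.V} (hβ : β ∈ R.Φ) : R.refl β β = -β := by
  rw [refl, h.coroot_self hβ]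
  module

theorem neg_root_mem (h : R.IsCrystallographic B) {β : R.V} (hβ : β ∈ R.Φ) : -β ∈ R.Φ := by
  rw [← h.refl_self hβ]
  exact h.refl_mem β hβ β hβ

theorem form_coroot (h : R.IsCrystallographic B) {β : R.V} (hβ : β ∈ R.Φ) (v : R.V) :
    R.coroot β v * B β β = 2 * B β v := by
  rw [h.coroot_eq β hβ]
  field_simp [(h.form_pos β hβ).ne']

theorem form_refl (h : R.IsCrystallographic B) {β : R.V} (hβ : β ∈ R.Φ) (x y : R.V) :
    B (R.refl β x) (R.refl β y) = B x y := by
  have hx := h.form_coroot hβ x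
  have hy := h.form_coroot hβ y
  simp only [refl, map_sub, map_smul, LinearMap.sub_apply, LinearMap.smul_apply, smul_eq_mul]
  rw [h.symm x β]
  linear_combination (R.coroot β x * hy + R.coroot β y * hx) / 2

theorem coroot_refl (h : R.IsCrystallographic B) {β γ : R.V} (hβ : β ∈ R.Φ) (hγ : γ ∈ R.Φ)
    (v : R.V) :
    R.coroot (R.refl β γ) (R.refl β v) = R.coroot γ v := by
  rw [h.coroot_eq _ (h.refl_mem β hβ γ hγ), h.coroot_eq γ hγ, h.form_refl hβ, h.form_refl hβ]

theorem refl_conj (h : R.IsCrystallographic B) {β γ : R.V} (hβ : β ∈ R.Φ) (hγ : γ ∈ R.Φ) (v : R.V) :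
    R.refl (R.refl β γ) (R.refl β v) = R.refl β (R.refl γ v) := by
  have : R.refl (R.refl β γ) (R.refl β v) = R.refl β v - R.coroot γ v • R.refl β γ := by
    rw [refl, h.coroot_refl hβ hγ]
  rw [this]
  simp only [refl, map_sub, map_smul, smul_eq_mul]
  module

theorem coroot_neg_iff (h : R.IsCrystallographic B) {β : R.V} (hβ : β ∈ R.Φ) (v : R.V) :
    R.coroot β v < 0 ↔ B β v < 0 := by
  have := h.form_coroot hβ v
  have hp := h.form_pos β hβ
  constructor <;> intro h' <;> nlinarith

theorem coroot_neg_root (h : R.IsCrystallographic B) {β : R.V} (hβ : β ∈ R.Φ) (v : R.V) :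
    R.coroot (-β) v = -R.coroot β v := by
  rw [h.coroot_eq _ (h.neg_root_mem hβ), h.coroot_eq β hβ]
  simp
  ring

theorem s_apply (h : R.IsCrystallographic B) {β : R.V} (hβ : β ∈ R.Φ) (v : R.V) :
    R.s β v = R.refl β v := by
  have hc : (R.reflMap β).comp (R.reflMap β) = LinearMap.id := by
    ext v
    exact h.refl_refl hβ v
  rw [s, dif_pos hc]
  rfl

theorem S_apply (h : R.IsCrystallographic B) (i : Fin R.r) (v : R.V) : R.S i v = R.refl (R.α i) v :=
  h.s_apply (h.simple_mem i) v

theorem wordProd_cons (h : R.IsCrystallographic B) (i : Fin R.r) (l : List (Fin R.r)) (v : R.V) :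
    R.wordProd (i :: l) v = R.refl (R.α i) (R.wordProd l v) := by
  rw [wordProd, List.map_cons, List.prod_cons, LinearEquiv.mul_apply, h.S_apply]
  rfl

/-- A positive root sent to a negative one by `(s_{i_1} ⋯ s_{i_k})⁻¹` allows to delete a letter. -/
theorem exists_exchange (h : R.IsCrystallographic B) (n : List (Fin R.r)) : ∀ γ ∈ R.pos,
    (R.wordProd n).symm γ ∉ R.pos →
    ∃ n' : List (Fin R.r), n'.length + 1 = n.length ∧
      ∀ v, R.refl γ (R.wordProd n v) = R.wordProd n' v := by
  induction n with
  | nil => exact fun γ hγ hn => absurd hγ hn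
  | cons j m ih =>
    intro γ hγ hn
    by_cases hj : γ = R.α j
    · refine ⟨m, rfl, fun v => ?_⟩
      rw [h.wordProd_cons, hj, h.refl_refl (h.simple_mem j)]
    · have hinv : (R.wordProd (j :: m)).symm γ = (R.wordProd m).symm (R.refl (R.α j) γ) := by
        rw [LinearEquiv.symm_apply_eq, h.wordProd_cons, LinearEquiv.apply_symm_apply,
          h.refl_refl (h.simple_mem j)]
      rw [hinv] at hn
      obtain ⟨m', hm, hv⟩ := ih _ (h.simple_refl j γ hγ hj) hn
      refine ⟨j :: m', by simp [hm], fun v => ?_⟩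
      have hγ' := h.pos_subset hγ
      rw [h.wordProd_cons, h.wordProd_cons, ← hv v, ← h.refl_conj (h.simple_mem j)
        (h.refl_mem _ (h.simple_mem j) _ hγ'), h.refl_refl (h.simple_mem j)]

theorem len_wordProd_le (l : List (Fin R.r)) : R.len (R.wordProd l) ≤ l.length :=
  Nat.sInf_le ⟨l, rfl, rfl⟩

theorem exists_word (l : List (Fin R.r)) :
    ∃ m : List (Fin R.r), m.length = R.len (R.wordProd l) ∧ R.wordProd m = R.wordProd l :=
  Nat.sInf_mem (s := {n | ∃ m : List (Fin R.r), m.length = n ∧ R.wordProd m = R.wordProd l})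
    ⟨_, l, rfl, rfl⟩

theorem Reduced.tail {i : Fin R.r} {n : List (Fin R.r)} (hr : R.Reduced (i :: n)) :
    R.Reduced n := by
  obtain ⟨m, hm, hp⟩ := exists_word n
  have h1 : R.wordProd (i :: n) = R.wordProd (i :: m) := by
    simp only [wordProd, List.map_cons, List.prod_cons] at hp ⊢
    rw [hp]
  have h2 := len_wordProd_le (i :: m)
  have h3 := len_wordProd_le n
  rw [← h1, hr] at h2
  simp only [List.length_cons] at h2
  unfold Reduced
  omega

theorem Reduced.inv_simple_mem (h : R.IsCrystallographic B) {i : Fin R.r} {n : List (Fin R.r)}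
    (hr : R.Reduced (i :: n)) :
    (R.wordProd n).symm (R.α i) ∈ R.pos := by
  by_contra hn
  obtain ⟨n', hl, hv⟩ := h.exists_exchange n _ (h.simple_pos i) hn
  have h1 : R.wordProd (i :: n) = R.wordProd n' := by
    ext v
    rw [h.wordProd_cons, hv]
  have h2 := len_wordProd_le n'
  rw [← h1, hr] at h2
  simp only [List.length_cons] at h2
  omega

theorem form_wordProd (h : R.IsCrystallographic B) (l : List (Fin R.r)) (x y : R.V) :
    B (R.wordProd l x) (R.wordProd l y) = B x y := by
  induction l with
  | nil => simp [wordProd]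
  | cons i l ih => rw [h.wordProd_cons, h.wordProd_cons, h.form_refl (h.simple_mem i), ih]

/-- For a reduced word `s_i s_{i_1} ⋯ s_{i_k}` the root `α_i` is nonnegative on
`s_{i_1} ⋯ s_{i_k} λ`, for dominant `λ`. -/
theorem Reduced.coroot_nonneg (h : R.IsCrystallographic B) {i : Fin R.r} {n : List (Fin R.r)}
    (hr : R.Reduced (i :: n))
    {v : R.V} (hv : R.Dominant v) : 0 ≤ R.coroot (R.α i) (R.wordProd n v) := by
  have hp := Reduced.inv_simple_mem h hr
  have h0 := h.dominant_pos v hv _ hp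
  by_contra! hlt
  rw [h.coroot_neg_iff (h.simple_mem i)] at hlt
  have : B ((R.wordProd n).symm (R.α i)) v < 0 := by
    rw [← h.form_wordProd n, LinearEquiv.apply_symm_apply]
    exact hlt
  rw [← h.coroot_neg_iff (h.pos_subset hp)] at this
  linarith

end IsCrystallographic

/-- The points `uλ` for `u` the product of a subword of `l`. -/
noncomputable def subwordOrbit (R : RootData) (v : R.V) : List (Fin R.r) → Set R.V
  | [] => {v}
  | i :: l => subwordOrbit R v l ∪ R.refl (R.α i) '' subwordOrbit R v l

/-- A set of vectors is closed under the reflections which move a vector towards the dominant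
chamber. -/
def IsLower (R : RootData) (A : Set R.V) : Prop :=
  ∀ p ∈ A, ∀ β ∈ R.pos, R.coroot β p < 0 → R.refl β p ∈ A

/-- The vectors obtained from `v` by reflections towards the dominant chamber. -/
inductive Below (R : RootData) (v : R.V) : R.V → Prop
  | base : Below R v v
  | step {p : R.V} (hp : Below R v p) (β : R.V) (hβ : β ∈ R.pos) (hn : R.coroot β p < 0) :
      Below R v (R.refl β p)

namespace IsCrystallographic

variable {B : R.V →ₗ[ℚ] R.V →ₗ[ℚ] ℚ}

theorem wordProd_mem_subwordOrbit (h : R.IsCrystallographic B) (v : R.V) {l' l : List (Fin R.r)}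
    (hs : l'.Sublist l) :
    R.wordProd l' v ∈ R.subwordOrbit v l := by
  induction hs with
  | slnil => simp [wordProd, subwordOrbit]
  | cons i _ ih => exact Or.inl ih
  | cons_cons i _ ih =>
    rw [h.wordProd_cons]
    exact Or.inr ⟨_, ih, rfl⟩

theorem isLower_union (h : R.IsCrystallographic B) {A : Set R.V} (hA : R.IsLower A) (i : Fin R.r) :
    R.IsLower (A ∪ R.refl (R.α i) '' A) := by
  rintro p (hp | ⟨q, hq, rfl⟩) β hβ hn
  · exact Or.inl (hA p hp β hβ hn)
  · by_cases hi : β = R.α i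
    · subst hi
      rw [h.refl_refl (h.simple_mem i)]
      exact Or.inl hq
    · have hi' := h.simple_mem i
      have hβ' := h.pos_subset hβ
      have hc : R.coroot (R.refl (R.α i) β) q = R.coroot β (R.refl (R.α i) q) := by
        rw [← h.coroot_refl hi' hβ', h.refl_refl hi']
      refine Or.inr ⟨_, hA q hq _ (h.simple_refl i β hβ hi) (hc ▸ hn), ?_⟩
      rw [← h.refl_conj hi' (h.refl_mem _ hi' _ hβ'), h.refl_refl hi']

theorem isLower_subwordOrbit (h : R.IsCrystallographic B) {v : R.V} (hv : R.Dominant v)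
    (l : List (Fin R.r)) :
    R.IsLower (R.subwordOrbit v l) := by
  induction l with
  | nil =>
    rintro p rfl β hβ hn
    exact absurd (h.dominant_pos _ hv β hβ) (not_le.2 hn)
  | cons i l ih => exact h.isLower_union ih i

theorem Below.mem {A : Set R.V} (hA : R.IsLower A) {p q : R.V} (hp : p ∈ A) (hq : R.Below p q) :
    q ∈ A := by
  induction hq with
  | base => exact hp
  | step _ β hβ hn ih => exact hA _ ih β hβ hn

theorem Below.refl_simple (h : R.IsCrystallographic B) {i : Fin R.r} {p q : R.V}
    (hp : 0 ≤ R.coroot (R.α i) p)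
    (hq : R.Below p q) :
    R.Below (R.refl (R.α i) p) q ∧ R.Below (R.refl (R.α i) p) (R.refl (R.α i) q) := by
  have hi := h.simple_mem i
  have hpp : R.Below (R.refl (R.α i) p) p := by
    rcases hp.eq_or_lt with h0 | h0
    · have : R.refl (R.α i) p = p := by rw [refl, ← h0]; simp
      rw [this]
      exact .base
    · have := (Below.base (R := R) (v := R.refl (R.α i) p)).step (R.α i) (h.simple_pos i)
        (by rw [h.coroot_refl_self hi]; linarith)
      rwa [h.refl_refl hi] at this
  induction hq with
  | base => exact ⟨hpp, .base⟩
  | @step q hq β hβ hn ih =>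
    refine ⟨ih.1.step β hβ hn, ?_⟩
    by_cases hb : β = R.α i
    · rw [hb, h.refl_refl hi]
      exact ih.1
    · have hβ' := h.pos_subset hβ
      rw [← h.refl_conj hi hβ']
      exact ih.2.step _ (h.simple_refl i β hβ hb) (by rwa [h.coroot_refl hi hβ'])

theorem below_of_mem_subwordOrbit (h : R.IsCrystallographic B) {v : R.V} (hv : R.Dominant v)
    {l : List (Fin R.r)}
    (hl : R.Reduced l) {q : R.V} (hq : q ∈ R.subwordOrbit v l) : R.Below (R.wordProd l v) q := by
  induction l generalizing q with
  | nil =>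
    obtain rfl : q = v := hq
    exact .base
  | cons i l ih =>
    have hn := Reduced.coroot_nonneg h hl hv
    rw [h.wordProd_cons]
    rcases hq with hq | ⟨q, hq, rfl⟩
    · exact (Below.refl_simple h hn (ih (Reduced.tail hl) hq)).1
    · exact (Below.refl_simple h hn (ih (Reduced.tail hl) hq)).2

/-- The Demazure polytope only involves points attached to subwords of any given word. -/
theorem demPolytope_subset (h : R.IsCrystallographic B) {v : R.V} (hv : R.Dominant v)
    (l : List (Fin R.r)) :
    R.demPolytope v (R.wordProd l) ⊆ convexHull ℚ (R.subwordOrbit v l) := by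
  refine convexHull_mono ?_
  rintro m ⟨u, -, ⟨l₂, hr, hp, l', hs, rfl⟩, rfl⟩
  have := h.below_of_mem_subwordOrbit hv hr (h.wordProd_mem_subwordOrbit v hs)
  rw [hp] at this
  exact Below.mem (h.isLower_subwordOrbit hv l)
    (h.wordProd_mem_subwordOrbit v (List.Sublist.refl l)) this

end IsCrystallographic

end RootData

namespace RootData

variable {R : RootData}

/-- The orbit of `v` under all reflections. -/
inductive Orbit (R : RootData) (v : R.V) : R.V → Prop
  | base : Orbit R v v
  | step {p : R.V} (hp : Orbit R v p) (β : R.V) (hβ : β ∈ R.Φ) : Orbit R v (R.refl β p)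

/-- The number of positive roots on which `v` is negative. -/
noncomputable def depth (R : RootData) (v : R.V) : ℕ :=
  {γ | γ ∈ R.pos ∧ R.coroot γ v < 0}.ncard

/-- One step of an `a`-chain, for `a = k / N`: a reflection towards the dominant chamber which
lowers the depth by one and satisfies the integrality condition. -/
def ChainStep (R : RootData) (N k : ℕ) (p q : R.V) : Prop :=
  ∃ β ∈ R.pos, R.coroot β p < 0 ∧ q = R.refl β p ∧
    (k : ℚ) * R.coroot β p ∈ AddSubgroup.zmultiples (N : ℚ) ∧ R.depth p = R.depth q + 1

/-- The existence of an `a`-chain from `p` to `q`, for `a = k / N`. -/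
def Chain (R : RootData) (N k : ℕ) : R.V → R.V → Prop :=
  Relation.ReflTransGen (R.ChainStep N k)

namespace IsCrystallographic

variable {B : R.V →ₗ[ℚ] R.V →ₗ[ℚ] ℚ}

theorem isWeight_orbit (h : R.IsCrystallographic B) {v p : R.V} (hv : R.IsWeight v)
    (hp : R.Orbit v p) : R.IsWeight p := by
  induction hp with
  | base => exact hv
  | @step p _ β hβ ih =>
    intro γ hγ
    obtain ⟨m, hm⟩ := ih _ (h.refl_mem β hβ γ hγ)
    refine ⟨m, ?_⟩
    rw [← hm, ← h.coroot_refl hβ hγ, h.refl_refl hβ]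

theorem finite_depth_set (h : R.IsCrystallographic B) (v : R.V) :
    {γ | γ ∈ R.pos ∧ R.coroot γ v < 0}.Finite :=
  h.finite_pos.subset fun _ hγ => hγ.1

theorem coroot_refl_swap (h : R.IsCrystallographic B) {β γ : R.V} (hβ : β ∈ R.Φ) (hγ : γ ∈ R.Φ)
    (v : R.V) : R.coroot γ (R.refl β v) = R.coroot (R.refl β γ) v := by
  rw [← h.coroot_refl hβ hγ, h.refl_refl hβ]

theorem depth_refl_lt (h : R.IsCrystallographic B) {β v : R.V} (hβ : β ∈ R.pos)
    (hn : R.coroot β v < 0) : R.depth (R.refl β v) < R.depth v := by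
  have hb := h.pos_subset hβ
  set g : R.V → R.V := fun γ => if R.refl β γ ∈ R.pos then R.refl β γ else γ with hg
  have hmaps : ∀ γ, γ ∈ R.pos → R.coroot γ (R.refl β v) < 0 →
      g γ ∈ R.pos ∧ R.coroot (g γ) v < 0 ∧ g γ ≠ β := by
    intro γ hγ hc
    have hγ' := h.pos_subset hγ
    have hγβ : γ ≠ β := by
      rintro rfl
      rw [h.coroot_refl_self hb] at hc
      linarith
    rw [h.coroot_refl_swap hb hγ'] at hc
    by_cases hr : R.refl β γ ∈ R.pos
    · simp only [hg, if_pos hr]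
      refine ⟨hr, hc, fun he => ?_⟩
      have : γ = -β := by rw [← h.refl_refl hb γ, he, h.refl_self hb]
      exact h.neg_notMem hβ (this ▸ hγ)
    · simp only [hg, if_neg hr]
      refine ⟨hγ, ?_, hγβ⟩
      have hneg := (h.pos_or _ (h.refl_mem β hb γ hγ')).resolve_left hr
      have hcp : 0 < R.coroot β γ := by
        by_contra! hle
        obtain ⟨ht, hpos⟩ := h.exists_height
        have h1 := hpos _ hneg
        have h2 := hpos _ hβ
        have h3 := hpos _ hγ
        simp only [refl, map_neg, map_sub, map_smul, smul_eq_mul] at h1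
        nlinarith
      rw [h.coroot_neg_iff (h.refl_mem β hb γ hγ')] at hc
      rw [h.coroot_neg_iff hb] at hn
      rw [h.coroot_neg_iff hγ']
      simp only [refl, map_sub, map_smul, smul_eq_mul, LinearMap.sub_apply,
        LinearMap.smul_apply] at hc
      nlinarith
  have hinj : Set.InjOn g {γ | γ ∈ R.pos ∧ R.coroot γ (R.refl β v) < 0} := by
    rintro x ⟨hx, -⟩ y ⟨hy, -⟩ hxy
    simp only [hg] at hxy
    split_ifs at hxy with h1 h2 h2
    · rw [← h.refl_refl hb x, hxy, h.refl_refl hb]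
    · rw [← hxy, h.refl_refl hb] at h2
      exact absurd hx h2
    · rw [hxy, h.refl_refl hb] at h1
      exact absurd hy h1
    · exact hxy
  unfold depth
  rw [← Set.InjOn.ncard_image hinj]
  refine Set.ncard_lt_ncard ⟨?_, fun hsub => ?_⟩ (h.finite_depth_set v)
  · rintro _ ⟨γ, hγ, rfl⟩
    exact ⟨(hmaps γ hγ.1 hγ.2).1, (hmaps γ hγ.1 hγ.2).2.1⟩
  · obtain ⟨γ, hγ, he⟩ := hsub (show β ∈ _ from ⟨hβ, hn⟩)
    exact (hmaps γ hγ.1 hγ.2).2.2 he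

theorem depth_refl_simple (h : R.IsCrystallographic B) (i : Fin R.r) {v : R.V}
    (hn : R.coroot (R.α i) v < 0) : R.depth v = R.depth (R.refl (R.α i) v) + 1 := by
  have hi := h.simple_mem i
  refine le_antisymm ?_ (h.depth_refl_lt (h.simple_pos i) hn)
  have hsub : R.refl (R.α i) '' ({γ | γ ∈ R.pos ∧ R.coroot γ v < 0} \ {R.α i}) ⊆
      {γ | γ ∈ R.pos ∧ R.coroot γ (R.refl (R.α i) v) < 0} := by
    rintro _ ⟨γ, ⟨⟨hγ, hc⟩, hne⟩, rfl⟩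
    exact ⟨h.simple_refl i γ hγ hne, by rwa [h.coroot_refl hi (h.pos_subset hγ)]⟩
  have h1 := Set.ncard_le_ncard hsub (h.finite_depth_set _)
  rw [Set.ncard_image_of_injective _ (Function.LeftInverse.injective (h.refl_refl hi))] at h1
  have h2 := Set.ncard_sdiff_singleton_add_one
    (show R.α i ∈ {γ | γ ∈ R.pos ∧ R.coroot γ v < 0} from ⟨h.simple_pos i, hn⟩)
    (h.finite_depth_set v)
  unfold depth
  omega

theorem depth_refl_simple_of_pos (h : R.IsCrystallographic B) (i : Fin R.r) {v : R.V}
    (hn : 0 < R.coroot (R.α i) v) : R.depth (R.refl (R.α i) v) = R.depth v + 1 := by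
  have hi := h.simple_mem i
  have := h.depth_refl_simple i (v := R.refl (R.α i) v)
    (by rw [h.coroot_refl_self hi]; linarith)
  rwa [h.refl_refl hi] at this

theorem refl_eq_self {β v : R.V} (h0 : R.coroot β v = 0) : R.refl β v = v := by
  simp [refl, h0]

/-- A cover which changes the sign on a simple root is the simple reflection. -/
theorem eq_simple_of_cover (h : R.IsCrystallographic B) (i : Fin R.r) {β p : R.V}
    (hβ : β ∈ R.pos) (hn : R.coroot β p < 0) (hd : R.depth p = R.depth (R.refl β p) + 1)
    (hs : R.coroot (R.α i) p < 0 ∧ 0 ≤ R.coroot (R.α i) (R.refl β p) ∨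
      R.coroot (R.α i) p ≤ 0 ∧ 0 < R.coroot (R.α i) (R.refl β p)) : β = R.α i := by
  by_contra hne
  have hi := h.simple_mem i
  have hb := h.pos_subset hβ
  have hlt := h.depth_refl_lt (h.simple_refl i β hβ hne) (v := R.refl (R.α i) p)
    (by rwa [h.coroot_refl hi hb])
  rw [h.refl_conj hi hb] at hlt
  have hup : R.depth (R.refl β p) ≤ R.depth (R.refl (R.α i) (R.refl β p)) := by
    rcases (show 0 ≤ R.coroot (R.α i) (R.refl β p) by
      rcases hs with hs | hs <;> linarith [hs.1, hs.2]).eq_or_lt with h0 | h0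
    · rw [refl_eq_self h0.symm]
    · rw [h.depth_refl_simple_of_pos i h0]
      omega
  rcases hs with ⟨h1, h2⟩ | ⟨h1, h2⟩
  · have := h.depth_refl_simple i h1
    omega
  · have := h.depth_refl_simple_of_pos i h2
    rcases h1.eq_or_lt with h0 | h0
    · rw [refl_eq_self h0] at hlt
      omega
    · have := h.depth_refl_simple i h0
      omega

variable {N k : ℕ} {p q : R.V}

theorem Chain.coroot_sub (h : R.IsCrystallographic B) (i : Fin R.r) (hc : R.Chain N k p q) :
    (k : ℚ) * R.coroot (R.α i) p - k * R.coroot (R.α i) q ∈ AddSubgroup.zmultiples (N : ℚ) := by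
  induction hc with
  | refl => simp
  | @tail q u _ hs ih =>
    obtain ⟨β, hβ, -, rfl, hm, -⟩ := hs
    obtain ⟨m, hm'⟩ := h.integral _ (h.simple_mem i) β (h.pos_subset hβ)
    have := add_mem ih (zsmul_mem hm m)
    convert this using 1
    simp only [refl, map_sub, map_smul, smul_eq_mul, zsmul_eq_mul, hm']
    ring

theorem ChainStep.refl_simple (h : R.IsCrystallographic B) (i : Fin R.r)
    (hs : R.ChainStep N k p q)
    (hsign : R.coroot (R.α i) p < 0 ∧ R.coroot (R.α i) q < 0 ∨
      0 < R.coroot (R.α i) p ∧ 0 < R.coroot (R.α i) q) :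
    R.ChainStep N k (R.refl (R.α i) p) (R.refl (R.α i) q) := by
  obtain ⟨β, hβ, hn, rfl, hm, hd⟩ := hs
  have hi := h.simple_mem i
  have hb := h.pos_subset hβ
  have hne : β ≠ R.α i := by
    rintro rfl
    rw [h.coroot_refl_self hi] at hsign
    rcases hsign with h1 | h1 <;> linarith [h1.1, h1.2]
  refine ⟨_, h.simple_refl i β hβ hne, ?_, (h.refl_conj hi hb p).symm, ?_, ?_⟩
  · rwa [h.coroot_refl hi hb]
  · rwa [h.coroot_refl hi hb]
  · rcases hsign with ⟨h1, h2⟩ | ⟨h1, h2⟩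
    · have := h.depth_refl_simple i h1
      have := h.depth_refl_simple i h2
      omega
    · have := h.depth_refl_simple_of_pos i h1
      have := h.depth_refl_simple_of_pos i h2
      omega

theorem Chain.simple (h : R.IsCrystallographic B) (i : Fin R.r) (hn : R.coroot (R.α i) p < 0)
    (hm : (k : ℚ) * R.coroot (R.α i) p ∈ AddSubgroup.zmultiples (N : ℚ)) :
    R.Chain N k p (R.refl (R.α i) p) :=
  .single ⟨_, h.simple_pos i, hn, rfl, hm, h.depth_refl_simple i hn⟩

theorem Chain.refl_left (h : R.IsCrystallographic B) (i : Fin R.r) (hc : R.Chain N k p q)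
    (hp : R.coroot (R.α i) p < 0) (hq : 0 ≤ R.coroot (R.α i) q) :
    (k : ℚ) * R.coroot (R.α i) p ∈ AddSubgroup.zmultiples (N : ℚ) ∧
      R.Chain N k (R.refl (R.α i) p) q := by
  induction hc using Relation.ReflTransGen.head_induction_on with
  | refl => linarith
  | @head p u hs hc ih =>
    rcases lt_or_ge (R.coroot (R.α i) u) 0 with hu | hu
    · obtain ⟨h1, h2⟩ := ih hu
      refine ⟨?_, h2.head (ChainStep.refl_simple h i hs (Or.inl ⟨hp, hu⟩))⟩
      have := Chain.coroot_sub h i (Relation.ReflTransGen.single hs)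
      simpa using add_mem this h1
    · obtain ⟨β, hβ, hn, rfl, hm, hd⟩ := hs
      obtain rfl := h.eq_simple_of_cover i hβ hn hd (Or.inl ⟨hp, hu⟩)
      exact ⟨hm, hc⟩

theorem Chain.refl_right (h : R.IsCrystallographic B) (i : Fin R.r) (hc : R.Chain N k p q)
    (hp : R.coroot (R.α i) p ≤ 0) (hq : 0 < R.coroot (R.α i) q) :
    (k : ℚ) * R.coroot (R.α i) q ∈ AddSubgroup.zmultiples (N : ℚ) ∧
      R.Chain N k p (R.refl (R.α i) q) := by
  induction hc with
  | refl => linarith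
  | @tail u q hc hs ih =>
    rcases lt_or_ge 0 (R.coroot (R.α i) u) with hu | hu
    · obtain ⟨h1, h2⟩ := ih hu
      refine ⟨?_, h2.tail (ChainStep.refl_simple h i hs (Or.inr ⟨hu, hq⟩))⟩
      have := Chain.coroot_sub h i (Relation.ReflTransGen.single hs)
      simpa using sub_mem h1 this
    · obtain ⟨β, hβ, hn, rfl, hm, hd⟩ := hs
      obtain rfl := h.eq_simple_of_cover i hβ hn hd (Or.inr ⟨hu, hq⟩)
      rw [h.refl_refl (h.simple_mem i), h.coroot_refl_self (h.simple_mem i), mul_neg]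
      exact ⟨neg_mem hm, hc⟩

theorem Chain.refl_neg (h : R.IsCrystallographic B) (i : Fin R.r) (hc : R.Chain N k p q)
    (hp : R.coroot (R.α i) p < 0) (hq : R.coroot (R.α i) q < 0) :
    R.Chain N k (R.refl (R.α i) p) (R.refl (R.α i) q) := by
  induction hc with
  | refl => exact .refl
  | @tail u q hc hs ih =>
    rcases lt_or_ge (R.coroot (R.α i) u) 0 with hu | hu
    · exact (ih hu).tail (ChainStep.refl_simple h i hs (Or.inl ⟨hu, hq⟩))
    · obtain ⟨h1, h2⟩ := Chain.refl_left h i hc hp hu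
      refine (h2.tail hs).trans (Chain.simple h i hq ?_)
      have := Chain.coroot_sub h i (hc.tail hs)
      simpa using sub_mem h1 this

theorem Chain.refl_pos (h : R.IsCrystallographic B) (i : Fin R.r) (hc : R.Chain N k p q)
    (hp : 0 < R.coroot (R.α i) p) (hq : 0 < R.coroot (R.α i) q) :
    R.Chain N k (R.refl (R.α i) p) (R.refl (R.α i) q) := by
  induction hc using Relation.ReflTransGen.head_induction_on with
  | refl => exact .refl
  | @head p u hs hc ih =>
    rcases lt_or_ge 0 (R.coroot (R.α i) u) with hu | hu
    · exact (ih hu).head (ChainStep.refl_simple h i hs (Or.inr ⟨hp, hu⟩))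
    · obtain ⟨h1, h2⟩ := Chain.refl_right h i hc hu hq
      have hi := h.simple_mem i
      have h3 : R.Chain N k (R.refl (R.α i) p) p := by
        have := Chain.simple h i (N := N) (k := k) (p := R.refl (R.α i) p)
          (by rw [h.coroot_refl_self hi]; linarith)
          (by
            rw [h.coroot_refl_self hi, mul_neg]
            have := Chain.coroot_sub h i (hc.head hs)
            exact neg_mem (by simpa using add_mem this h1))
        rwa [h.refl_refl hi] at this
      exact (h3.tail hs).trans h2

theorem Chain.eq_of_dominant (h : R.IsCrystallographic B) (hv : R.Dominant p)
    (hc : R.Chain N k p q) : q = p := by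
  induction hc with
  | refl => rfl
  | tail _ hs ih =>
    subst ih
    obtain ⟨β, hβ, hn, -⟩ := hs
    exact absurd (h.dominant_pos _ hv β hβ) (not_le.2 hn)

end IsCrystallographic
end RootData

/-- The integrality properties of the height function of a path along a simple root. -/
structure IsHeight (N : ℕ) (H : ℕ → ℤ) : Prop where
  pos : 0 < N
  dvd_zero : (N : ℤ) ∣ H 0
  dvd_last : (N : ℤ) ∣ H N
  dvd_min : ∀ k, k + 1 < N → H (k + 1) < H k ∧ H (k + 1) ≤ H (k + 2) ∨
    H (k + 1) ≤ H k ∧ H (k + 1) < H (k + 2) → (N : ℤ) ∣ H (k + 1)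
  dvd_step : ∀ k, k < N → H (k + 1) ≠ H k →
    (H (k + 1) - H k) ∣ (N : ℤ) ∧ (H (k + 1) - H k) ∣ H k

/-- The interval on which a lowering operator acts: `p` is the last position of the minimum and
`x` the position where the height has last grown by `N`. -/
structure LowerData (N : ℕ) (H : ℕ → ℤ) (p x : ℕ) : Prop where
  lt : p < x
  le : x ≤ N
  min : ∀ k, k ≤ p → H p ≤ H k
  lt_of_gt : ∀ k, p < k → k ≤ N → H p < H k
  mono : ∀ k, p ≤ k → k < x → H k < H (k + 1)
  eq : H x = H p + N
  le_of_ge : ∀ k, x ≤ k → k ≤ N → H x ≤ H k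
  dvd : (N : ℤ) ∣ H p

/-- The interval on which a raising operator acts. -/
structure RaiseData (N : ℕ) (H : ℕ → ℤ) (p x : ℕ) : Prop where
  lt : p < x
  le : x ≤ N
  min : ∀ k, x ≤ k → k ≤ N → H x ≤ H k
  lt_of_lt : ∀ k, k < x → H x < H k
  anti : ∀ k, p ≤ k → k < x → H (k + 1) < H k
  eq : H p = H x + N
  le_of_le : ∀ k, k ≤ p → H p ≤ H k
  dvd : (N : ℤ) ∣ H x

theorem exists_last_min (H : ℕ → ℤ) (a b : ℕ) (hab : a ≤ b) :
    ∃ p, a ≤ p ∧ p ≤ b ∧ (∀ k, a ≤ k → k ≤ b → H p ≤ H k) ∧ ∀ k, p < k → k ≤ b → H p < H k := by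
  induction b, hab using Nat.le_induction with
  | base => exact ⟨a, le_rfl, le_rfl, fun k h1 h2 => by rw [le_antisymm h1 h2],
      fun k h1 h2 => by omega⟩
  | succ b hab ih =>
    obtain ⟨p, h1, h2, h3, h4⟩ := ih
    rcases lt_or_ge (H p) (H (b + 1)) with hl | hl
    · refine ⟨p, h1, by omega, fun k hk hk' => ?_, fun k hk hk' => ?_⟩
      · rcases hk'.eq_or_lt with rfl | hk'
        · exact hl.le
        · exact h3 k hk (by omega)
      · rcases hk'.eq_or_lt with rfl | hk'
        · exact hl
        · exact h4 k hk (by omega)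
    · refine ⟨b + 1, by omega, le_rfl, fun k hk hk' => ?_, fun k hk hk' => by omega⟩
      rcases hk'.eq_or_lt with rfl | hk'
      · exact le_rfl
      · exact hl.trans (h3 k hk (by omega))

namespace IsHeight

variable {N : ℕ} {H : ℕ → ℤ}

theorem dvd_last_min (hH : IsHeight N H) {p : ℕ} (hp : p ≤ N) (h1 : 0 < p → H p ≤ H (p - 1))
    (h2 : ∀ k, p < k → k ≤ N → H p < H k) : (N : ℤ) ∣ H p := by
  rcases Nat.eq_zero_or_pos p with rfl | h0
  · exact hH.dvd_zero
  rcases hp.eq_or_lt with rfl | hlt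
  · exact hH.dvd_last
  obtain ⟨q, rfl⟩ : ∃ q, p = q + 1 := ⟨p - 1, by omega⟩
  exact hH.dvd_min q hlt (Or.inr ⟨h1 h0, h2 _ (by omega) (by omega)⟩)

theorem exists_lowerData (hH : IsHeight N H) {a : ℕ} (ha : a ≤ N) (hlt : H a < H N) :
    ∃ p x, LowerData N H p x := by
  obtain ⟨p, -, hpN, hmin, hlast⟩ := exists_last_min H 0 N (Nat.zero_le N)
  have hdvd : (N : ℤ) ∣ H p := hH.dvd_last_min hpN (fun _ => hmin _ (by omega) (by omega)) hlast
  have hpN' : p < N := by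
    rcases hpN.eq_or_lt with rfl | h'
    · have := hmin a (by omega) ha
      omega
    · exact h'
  have hNpos := hH.pos
  have gap : ∀ q, H p < q → (N : ℤ) ∣ q → H p + N ≤ q := by
    intro q hq hd
    have := Int.le_of_dvd (by omega) (dvd_sub hd hdvd)
    omega
  have hNge : H p + N ≤ H N := gap _ (hlast N hpN' le_rfl) hH.dvd_last
  have incr : ∀ q, p < q → q ≤ N → H q < H p + N → H (q - 1) < H q := by
    intro q hq hqN hlt
    by_contra! hle
    obtain ⟨u, hu1, hu2, hu3, hu4⟩ := exists_last_min H q N hqN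
    have hu : (N : ℤ) ∣ H u := by
      refine hH.dvd_last_min hu2 (fun _ => ?_) hu4
      rcases hu1.eq_or_lt with rfl | h'
      · exact hle
      · exact hu3 _ (by omega) (by omega)
    have := gap _ (hlast u (by omega) hu2) hu
    have := hu3 q le_rfl hqN
    omega
  have hex : ∃ x, p < x ∧ H p + N ≤ H x := ⟨N, hpN', hNge⟩
  obtain ⟨hx1, hx2⟩ := Nat.find_spec hex
  have hx3 : ∀ k, p < k → k < Nat.find hex → H k < H p + N := by
    intro k hk hk'
    have := Nat.find_min hex hk'
    push Not at this
    exact this hk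
  have hx4 : Nat.find hex ≤ N := Nat.find_min' hex ⟨hpN', hNge⟩
  generalize Nat.find hex = x at hx1 hx2 hx3 hx4
  have hmono : ∀ k, p ≤ k → k < x → H k < H (k + 1) := by
    intro k hk hk'
    rcases Nat.lt_or_ge (k + 1) x with h' | h'
    · exact incr (k + 1) (by omega) (by omega) (hx3 _ (by omega) h')
    · obtain rfl : x = k + 1 := by omega
      rcases hk.eq_or_lt with rfl | hk
      · exact hlast _ (by omega) (by omega)
      · exact (hx3 k hk hk').trans_le hx2
  have heq : H x = H p + N := by
    obtain ⟨y, rfl⟩ : ∃ y, x = y + 1 := ⟨x - 1, by omega⟩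
    have hy := hmono y (by omega) (by omega)
    have hy2 : H y < H p + N := by
      rcases (show p ≤ y by omega).eq_or_lt with rfl | h'
      · omega
      · exact hx3 y h' (by omega)
    obtain ⟨h1, h2⟩ := hH.dvd_step y (by omega) hy.ne'
    have h3 := Int.le_of_dvd (show 0 < H p + N - H y by omega)
      (dvd_sub (dvd_add (h1.trans hdvd) h1) h2)
    omega
  refine ⟨p, x, hx1, hx4, fun k hk => hmin k (by omega) (by omega), hlast, hmono, heq,
    fun k hk hkN => ?_, hdvd⟩
  induction k, hk using Nat.le_induction with
  | base => exact le_rfl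
  | succ k hk ih =>
    have := ih (by omega)
    by_contra! hc
    have := incr (k + 1) (by omega) hkN (by omega)
    simp only [Nat.add_sub_cancel] at this
    omega

theorem reverse (hH : IsHeight N H) : IsHeight N fun k => H (N - k) where
  pos := hH.pos
  dvd_zero := hH.dvd_last
  dvd_last := by simpa using hH.dvd_zero
  dvd_min k hk hc := by
    obtain ⟨u, rfl⟩ : ∃ u, N = k + 2 + u := ⟨N - (k + 2), by omega⟩
    simp only [show k + 2 + u - (k + 1) = u + 1 by omega, show k + 2 + u - k = u + 2 by omega,
      show k + 2 + u - (k + 2) = u by omega] at hc ⊢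
    exact hH.dvd_min u (by omega) (by omega)
  dvd_step k hk hc := by
    obtain ⟨u, rfl⟩ : ∃ u, N = k + 1 + u := ⟨N - (k + 1), by omega⟩
    simp only [show k + 1 + u - (k + 1) = u by omega, show k + 1 + u - k = u + 1 by omega]
      at hc ⊢
    obtain ⟨h1, h2⟩ := hH.dvd_step u (by omega) hc.symm
    rw [← neg_sub, neg_dvd, neg_dvd]
    refine ⟨h1, ?_⟩
    have := dvd_add h2 (dvd_refl (H (u + 1) - H u))
    simpa using this

theorem exists_raiseData (hH : IsHeight N H) {a : ℕ} (ha : a ≤ N) (hlt : H a < H 0) :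
    ∃ p x, RaiseData N H p x := by
  obtain ⟨p, x, h⟩ := hH.reverse.exists_lowerData (a := N - a) (by omega)
    (by simpa [show N - (N - a) = a by omega] using hlt)
  have hx := h.le
  have hp := h.lt
  refine ⟨N - x, N - p, by omega, by omega, fun k h1 h2 => ?_, fun k h1 => ?_, fun k h1 h2 => ?_,
    h.eq, fun k hk => ?_, h.dvd⟩
  · simpa [show N - (N - k) = k by omega] using h.min (N - k) (by omega)
  · simpa [show N - (N - k) = k by omega] using h.lt_of_gt (N - k) (by omega) (by omega)
  · simpa [show N - (N - (k + 1)) = k + 1 by omega, show N - (N - k - 1) = k + 1 by omega,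
      show N - (N - (k + 1) + 1) = k by omega] using h.mono (N - (k + 1)) (by omega) (by omega)
  · simpa [show N - (N - k) = k by omega] using h.le_of_ge (N - k) (by omega) (by omega)

end IsHeight

theorem LowerData.unique {N : ℕ} {H : ℕ → ℤ} {p x q y : ℕ} (h : LowerData N H p x)
    (h' : LowerData N H q y) : p = q ∧ x = y := by
  have hp := h.lt
  have hx := h.le
  have hq := h'.lt
  have hy := h'.le
  have hpq : p = q := by
    rcases lt_trichotomy p q with hl | hl | hl
    · have := h.lt_of_gt q hl (by omega)
      have := h'.min p hl.le
      omega
    · exact hl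
    · have := h'.lt_of_gt p hl (by omega)
      have := h.min q hl.le
      omega
  subst hpq
  have key : ∀ {x y : ℕ}, LowerData N H p x → LowerData N H p y → ¬ x < y := by
    intro x y h h' hl
    have h1 := h.eq
    have h2 := h'.eq
    have h3 := h.le_of_ge (y - 1) (by omega) (by have := h'.le; omega)
    have h4 := h'.mono (y - 1) (by have := h.lt; omega) (by omega)
    rw [show y - 1 + 1 = y by omega] at h4
    omega
  have := key h h'
  have := key h' h
  omega

theorem RaiseData.unique {N : ℕ} {H : ℕ → ℤ} {p x q y : ℕ} (h : RaiseData N H p x)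
    (h' : RaiseData N H q y) : p = q ∧ x = y := by
  have hp := h.lt
  have hx := h.le
  have hq := h'.lt
  have hy := h'.le
  have hxy : x = y := by
    rcases lt_trichotomy x y with hl | hl | hl
    · have := h'.lt_of_lt x hl
      have := h.min y hl.le (by omega)
      omega
    · exact hl
    · have := h.lt_of_lt y hl
      have := h'.min x hl.le (by omega)
      omega
  subst hxy
  have key : ∀ {p q : ℕ}, RaiseData N H p x → RaiseData N H q x → ¬ p < q := by
    intro p q h h' hl
    have h1 := h.eq
    have h2 := h'.eq
    have h3 := h'.le_of_le (p + 1) (by omega)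
    have h4 := h.anti p (by omega) (by have := h'.lt; omega)
    omega
  have := key h h'
  have := key h' h
  omega

/-- `H'` is obtained from `H` by reflecting the steps in `[p, x)`. -/
structure IsReflected (N : ℕ) (H H' : ℕ → ℤ) (p x : ℕ) : Prop where
  left : ∀ k, k ≤ p → H' k = H k
  mid : ∀ k, p ≤ k → k ≤ x → H' k = 2 * H p - H k
  right : ∀ k, x ≤ k → H' k = H k - 2 * (H x - H p)

theorem LowerData.raiseData {N : ℕ} {H H' : ℕ → ℤ} {p x : ℕ} (h : LowerData N H p x)
    (hr : IsReflected N H H' p x) : RaiseData N H' p x := by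
  have hpx := h.lt
  have hx := h.le
  have heq := h.eq
  have h0 := hr.left p le_rfl
  have h1 := hr.mid x hpx.le le_rfl
  refine ⟨hpx, hx, fun k hk hk' => ?_, fun k hk => ?_, fun k hk hk' => ?_, by omega,
    fun k hk => ?_, ?_⟩
  · rw [hr.right k hk]
    have := h.le_of_ge k hk hk'
    omega
  · rcases le_total k p with hkp | hkp
    · rw [hr.left k hkp]
      have := h.min k hkp
      omega
    · rw [hr.mid k hkp hk.le]
      have hlt : ∀ j, k ≤ j → j < x → H k < H (j + 1) := by
        intro j hj
        induction j, hj using Nat.le_induction with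
        | base => exact h.mono k hkp
        | succ j hj ih => exact fun hjx => (ih (by omega)).trans (h.mono _ (by omega) hjx)
      have := hlt (x - 1) (by omega) (by omega)
      rw [show x - 1 + 1 = x by omega] at this
      omega
  · rw [hr.mid k hk hk'.le, hr.mid (k + 1) (by omega) hk']
    have := h.mono k hk hk'
    omega
  · rw [h0, hr.left k hk]
    exact h.min k hk
  · rw [h1, show 2 * H p - H x = H p - N by omega]
    exact dvd_sub h.dvd (dvd_refl _)

theorem RaiseData.lowerData {N : ℕ} {H H' : ℕ → ℤ} {p x : ℕ} (h : RaiseData N H p x)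
    (hr : IsReflected N H H' p x) : LowerData N H' p x := by
  have hpx := h.lt
  have hx := h.le
  have heq := h.eq
  have h0 := hr.left p le_rfl
  have h1 := hr.mid x hpx.le le_rfl
  refine ⟨hpx, hx, fun k hk => ?_, fun k hk hk' => ?_, fun k hk hk' => ?_, by omega,
    fun k hk hk' => ?_, ?_⟩
  · rw [h0, hr.left k hk]
    exact h.le_of_le k hk
  · rcases le_total x k with hkx | hkx
    · rw [h0, hr.right k hkx]
      have := h.min k hkx hk'
      omega
    · rw [h0, hr.mid k hk.le hkx]
      have hlt : ∀ j, p ≤ j → j < x → H (j + 1) < H p := by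
        intro j hj
        induction j, hj using Nat.le_induction with
        | base => exact h.anti p le_rfl
        | succ j hj ih => exact fun hjx => (h.anti _ (by omega) hjx).trans (ih (by omega))
      have := hlt (k - 1) (by omega) (by omega)
      rw [show k - 1 + 1 = k by omega] at this
      omega
  · rw [hr.mid k hk hk'.le, hr.mid (k + 1) (by omega) hk']
    have := h.anti k hk hk'
    omega
  · rw [hr.right k hk, h1]
    have := h.min k hk hk'
    omega
  · rw [h0, heq]
    exact dvd_add h.dvd (dvd_refl _)

theorem intCast_mem_zmultiples {N : ℕ} {a : ℤ} :
    (a : ℚ) ∈ AddSubgroup.zmultiples (N : ℚ) ↔ (N : ℤ) ∣ a := by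
  rw [AddSubgroup.mem_zmultiples_iff]
  constructor
  · rintro ⟨k, hk⟩
    refine ⟨k, ?_⟩
    rw [zsmul_eq_mul] at hk
    have : ((k * N : ℤ) : ℚ) = a := by push_cast; exact hk
    rw [← Int.cast_injective this, mul_comm]
  · rintro ⟨k, rfl⟩
    exact ⟨k, by push_cast; rw [zsmul_eq_mul, mul_comm]⟩

namespace RootData

variable {R : RootData}

/-- The integral pairing of an integral weight with the `i`-th simple coroot. -/
noncomputable def pair (R : RootData) (i : Fin R.r) (v : R.V) : ℤ := ⌊R.coroot (R.α i) v⌋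

/-- Discretized Lakshmibai–Seshadri paths of shape `lam`, as sequences of `N` directions. -/
structure IsPath (R : RootData) (lam : R.V) (N : ℕ) (d : ℕ → R.V) : Prop where
  orbit : ∀ j, R.Orbit lam (d j)
  tail : ∀ j, N ≤ j → d j = lam
  chain : ∀ k, k + 1 < N → R.Chain N (k + 1) (d k) (d (k + 1))

/-- The height function of a path along the `i`-th simple coroot. -/
noncomputable def height (R : RootData) (i : Fin R.r) (d : ℕ → R.V) (k : ℕ) : ℤ :=
  ∑ j ∈ Finset.range k, R.pair i (d j)

/-- The path obtained by reflecting the directions in `[p, x)`. -/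
noncomputable def reflPath (R : RootData) (i : Fin R.r) (p x : ℕ) (d : ℕ → R.V) (j : ℕ) : R.V :=
  if p ≤ j ∧ j < x then R.refl (R.α i) (d j) else d j

/-- The endpoint of a path. -/
noncomputable def pathWt (R : RootData) (N : ℕ) (d : ℕ → R.V) : R.V :=
  (N : ℚ)⁻¹ • ∑ j ∈ Finset.range N, d j

/-- The setting for the path model of shape `lam`. -/
structure PathModel (R : RootData) (B : R.V →ₗ[ℚ] R.V →ₗ[ℚ] ℚ) (lam : R.V) (N : ℕ) : Prop where
  crys : R.IsCrystallographic B
  isWeight : R.IsWeight lam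
  dominant : R.Dominant lam
  pos : 0 < N
  finite : {v | R.Orbit lam v}.Finite
  dvd : ∀ v, R.Orbit lam v → ∀ i, R.pair i v ≠ 0 → R.pair i v ∣ (N : ℤ)

namespace PathModel

variable {B : R.V →ₗ[ℚ] R.V →ₗ[ℚ] ℚ} {lam : R.V} {N : ℕ} {i : Fin R.r} {d : ℕ → R.V} {p x : ℕ}

theorem cast_pair (M : R.PathModel B lam N) (i : Fin R.r) {v : R.V} (hv : R.Orbit lam v) :
    (R.pair i v : ℚ) = R.coroot (R.α i) v := by
  obtain ⟨m, hm⟩ := M.crys.isWeight_orbit M.isWeight hv _ (M.crys.simple_mem i)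
  rw [pair, hm, Int.floor_intCast]

theorem orbit_refl (M : R.PathModel B lam N) (i : Fin R.r) {v : R.V} (hv : R.Orbit lam v) :
    R.Orbit lam (R.refl (R.α i) v) :=
  hv.step _ (M.crys.simple_mem i)

theorem pair_refl (M : R.PathModel B lam N) (i : Fin R.r) {v : R.V} (hv : R.Orbit lam v) :
    R.pair i (R.refl (R.α i) v) = -R.pair i v := by
  have : ((R.pair i (R.refl (R.α i) v) : ℤ) : ℚ) = ((-R.pair i v : ℤ) : ℚ) := by
    rw [M.cast_pair i (M.orbit_refl i hv), M.crys.coroot_refl_self (M.crys.simple_mem i)]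
    push_cast
    rw [M.cast_pair i hv]
  exact_mod_cast this

theorem coroot_pos_iff (M : R.PathModel B lam N) (hd : R.IsPath lam N d) (i : Fin R.r) (j : ℕ) :
    0 < R.coroot (R.α i) (d j) ↔ R.height i d j < R.height i d (j + 1) := by
  rw [← M.cast_pair i (hd.orbit j), height, height, Finset.sum_range_succ]
  simp

theorem coroot_neg_iff (M : R.PathModel B lam N) (hd : R.IsPath lam N d) (i : Fin R.r) (j : ℕ) :
    R.coroot (R.α i) (d j) < 0 ↔ R.height i d (j + 1) < R.height i d j := by
  rw [← M.cast_pair i (hd.orbit j), height, height, Finset.sum_range_succ]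
  simp

theorem dvd_height_sub (M : R.PathModel B lam N) (hd : R.IsPath lam N d) (i : Fin R.r) (k : ℕ)
    (hk : k < N) : (N : ℤ) ∣ R.height i d k - k * R.pair i (d k) := by
  induction k with
  | zero => simp [height]
  | succ k ih =>
    have h1 := ih (by omega)
    have h2 := IsCrystallographic.Chain.coroot_sub M.crys i (hd.chain k hk)
    rw [← M.cast_pair i (hd.orbit _), ← M.cast_pair i (hd.orbit _)] at h2
    have h3 : (N : ℤ) ∣ ((k + 1 : ℕ) : ℤ) * R.pair i (d k) -
        ((k + 1 : ℕ) : ℤ) * R.pair i (d (k + 1)) :=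
      intCast_mem_zmultiples.1 (by push_cast at h2 ⊢; exact h2)
    have h4 : R.height i d (k + 1) = R.height i d k + R.pair i (d k) :=
      Finset.sum_range_succ _ _
    have h5 : R.height i d (k + 1) - ((k + 1 : ℕ) : ℤ) * R.pair i (d (k + 1)) =
        (R.height i d k - k * R.pair i (d k)) + (((k + 1 : ℕ) : ℤ) * R.pair i (d k) -
        ((k + 1 : ℕ) : ℤ) * R.pair i (d (k + 1))) := by
      rw [h4]
      push_cast
      ring
    rw [h5]
    exact dvd_add h1 h3

theorem dvd_height_succ_sub (M : R.PathModel B lam N) (hd : R.IsPath lam N d) (i : Fin R.r)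
    (k : ℕ) (hk : k < N) : (N : ℤ) ∣ R.height i d (k + 1) - (k + 1) * R.pair i (d k) := by
  convert M.dvd_height_sub hd i k hk using 1
  rw [height, height, Finset.sum_range_succ]
  ring

theorem mem_zmultiples_iff (M : R.PathModel B lam N) (hd : R.IsPath lam N d) (i : Fin R.r)
    (k : ℕ) (hk : k < N) : (k : ℚ) * R.coroot (R.α i) (d k) ∈ AddSubgroup.zmultiples (N : ℚ) ↔
      (N : ℤ) ∣ R.height i d k := by
  rw [← M.cast_pair i (hd.orbit _),
    show (k : ℚ) * R.pair i (d k) = ((k * R.pair i (d k) : ℤ) : ℚ) by push_cast; rfl,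
    intCast_mem_zmultiples]
  exact (dvd_iff_dvd_of_dvd_sub (M.dvd_height_sub hd i k hk)).symm

theorem mem_zmultiples_succ_iff (M : R.PathModel B lam N) (hd : R.IsPath lam N d) (i : Fin R.r)
    (k : ℕ) (hk : k < N) :
    ((k + 1 : ℕ) : ℚ) * R.coroot (R.α i) (d k) ∈ AddSubgroup.zmultiples (N : ℚ) ↔
      (N : ℤ) ∣ R.height i d (k + 1) := by
  rw [← M.cast_pair i (hd.orbit _), show ((k + 1 : ℕ) : ℚ) * R.pair i (d k) =
    (((k + 1) * R.pair i (d k) : ℤ) : ℚ) by push_cast; rfl, intCast_mem_zmultiples]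
  exact (dvd_iff_dvd_of_dvd_sub (M.dvd_height_succ_sub hd i k hk)).symm

theorem isHeight (M : R.PathModel B lam N) (hd : R.IsPath lam N d) (i : Fin R.r) :
    IsHeight N (R.height i d) where
  pos := M.pos
  dvd_zero := by simp [height]
  dvd_last := by
    obtain ⟨n, rfl⟩ : ∃ n, N = n + 1 := ⟨N - 1, by have := M.pos; omega⟩
    have := M.dvd_height_succ_sub hd i n (by omega)
    rw [dvd_iff_dvd_of_dvd_sub this]
    exact Dvd.intro _ (by push_cast; rfl)
  dvd_min k hk hc := by
    rcases hc with ⟨h1, h2⟩ | ⟨h1, h2⟩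
    · have := (IsCrystallographic.Chain.refl_left M.crys i (hd.chain k hk)
        ((M.coroot_neg_iff hd i k).2 h1)
        (not_lt.1 fun h' => h2.not_gt ((M.coroot_neg_iff hd i _).1 h'))).1
      exact (M.mem_zmultiples_succ_iff hd i k (by omega)).1 this
    · have := (IsCrystallographic.Chain.refl_right M.crys i (hd.chain k hk)
        (not_lt.1 fun h' => h1.not_gt ((M.coroot_pos_iff hd i _).1 h'))
        ((M.coroot_pos_iff hd i _).2 h2)).1
      exact (M.mem_zmultiples_iff hd i (k + 1) hk).1 this
  dvd_step k hk hc := by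
    have h1 : R.height i d (k + 1) - R.height i d k = R.pair i (d k) := by
      rw [height, height, Finset.sum_range_succ]
      ring
    rw [h1]
    have h2 := M.dvd _ (hd.orbit k) i (by rw [← h1]; omega)
    refine ⟨h2, ?_⟩
    have := h2.trans (M.dvd_height_sub hd i k hk)
    simpa using dvd_add this (Dvd.intro_left (k : ℤ) (rfl : _ = (k : ℤ) * R.pair i (d k)))

theorem height_reflPath (M : R.PathModel B lam N) (hd : R.IsPath lam N d) (i : Fin R.r)
    (hpx : p ≤ x) : IsReflected N (R.height i d) (R.height i (R.reflPath i p x d)) p x := by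
  have hleft : ∀ k, k ≤ p → R.height i (R.reflPath i p x d) k = R.height i d k := by
    intro k hk
    refine Finset.sum_congr rfl fun j hj => ?_
    rw [Finset.mem_range] at hj
    rw [reflPath, if_neg (by omega)]
  have hmid : ∀ k, p ≤ k → k ≤ x →
      R.height i (R.reflPath i p x d) k = 2 * R.height i d p - R.height i d k := by
    intro k hk
    induction k, hk using Nat.le_induction with
    | base =>
      intro _
      rw [hleft p le_rfl]
      ring
    | succ k hk ih =>
      intro hkx
      have h1 := ih (by omega)
      rw [height] at h1 ⊢
      rw [Finset.sum_range_succ, h1, reflPath, if_pos (by omega), M.pair_refl i (hd.orbit k)]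
      simp only [height, Finset.sum_range_succ]
      ring
  refine ⟨hleft, hmid, fun k hk => ?_⟩
  induction k, hk using Nat.le_induction with
  | base =>
    rw [hmid x hpx le_rfl]
    ring
  | succ k hk ih =>
    rw [height] at ih ⊢
    rw [Finset.sum_range_succ, ih, reflPath, if_neg (by omega)]
    simp only [height, Finset.sum_range_succ]
    ring

theorem reflPath_reflPath (M : R.PathModel B lam N) (i : Fin R.r) (p x : ℕ) (d : ℕ → R.V) :
    R.reflPath i p x (R.reflPath i p x d) = d := by
  funext j
  simp only [reflPath]
  split_ifs
  · exact M.crys.refl_refl (M.crys.simple_mem i) _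
  · rfl

theorem sum_reflPath (M : R.PathModel B lam N) (hd : R.IsPath lam N d) (i : Fin R.r)
    (hpx : p ≤ x) (k : ℕ) (hx : x ≤ k) : ∑ j ∈ Finset.range k, R.reflPath i p x d j =
      ∑ j ∈ Finset.range k, d j - ((R.height i d x - R.height i d p : ℤ) : ℚ) • R.α i := by
  have hleft : ∑ j ∈ Finset.range p, R.reflPath i p x d j = ∑ j ∈ Finset.range p, d j := by
    refine Finset.sum_congr rfl fun j hj => ?_
    rw [Finset.mem_range] at hj
    rw [reflPath, if_neg (by omega)]
  have hmid : ∀ k, p ≤ k → k ≤ x → ∑ j ∈ Finset.range k, R.reflPath i p x d j =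
      ∑ j ∈ Finset.range k, d j - ((R.height i d k - R.height i d p : ℤ) : ℚ) • R.α i := by
    intro k hk
    induction k, hk using Nat.le_induction with
    | base =>
      intro _
      rw [hleft]
      simp
    | succ k hk ih =>
      intro hkx
      have h1 := ih (by omega)
      rw [Finset.sum_range_succ, h1, reflPath, if_pos (by omega), refl,
        ← M.cast_pair i (hd.orbit k)]
      simp only [height, Finset.sum_range_succ]
      push_cast
      module
  induction k, hx using Nat.le_induction with
  | base => exact hmid x hpx le_rfl
  | succ k hk ih =>
    rw [Finset.sum_range_succ, ih, reflPath, if_neg (by omega), Finset.sum_range_succ]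
    module

theorem orbit_reflPath (M : R.PathModel B lam N) (hd : R.IsPath lam N d) (i : Fin R.r)
    (p x j : ℕ) : R.Orbit lam (R.reflPath i p x d j) := by
  rw [reflPath]
  split_ifs
  · exact M.orbit_refl i (hd.orbit j)
  · exact hd.orbit j

theorem isPath_lower (M : R.PathModel B lam N) (hd : R.IsPath lam N d)
    (h : LowerData N (R.height i d) p x) : R.IsPath lam N (R.reflPath i p x d) where
  orbit := M.orbit_reflPath hd i p x
  tail j hj := by
    have := h.le
    rw [reflPath, if_neg (by omega), hd.tail j hj]
  chain k hk := by
    have hi := M.crys.simple_mem i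
    have hc := hd.chain k hk
    have hlt := h.lt
    have hpos : ∀ j, p ≤ j → j < x → 0 < R.coroot (R.α i) (d j) := fun j h1 h2 =>
      (M.coroot_pos_iff hd i j).2 (h.mono j h1 h2)
    by_cases h1 : p ≤ k ∧ k < x <;> by_cases h2 : p ≤ k + 1 ∧ k + 1 < x
    · rw [reflPath, reflPath, if_pos h1, if_pos h2]
      exact IsCrystallographic.Chain.refl_pos M.crys i hc (hpos _ h1.1 h1.2) (hpos _ h2.1 h2.2)
    · rw [reflPath, reflPath, if_pos h1, if_neg h2]
      have hkx : k + 1 = x := by omega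
      have hm : (N : ℤ) ∣ R.height i d (k + 1) := by
        rw [hkx, h.eq]
        exact dvd_add h.dvd (dvd_refl _)
      rw [← M.mem_zmultiples_succ_iff hd i k (by omega)] at hm
      have := IsCrystallographic.Chain.simple M.crys i (N := N) (k := k + 1)
        (p := R.refl (R.α i) (d k))
        (by rw [M.crys.coroot_refl_self hi]; have := hpos _ h1.1 h1.2; linarith)
        (by rw [M.crys.coroot_refl_self hi, mul_neg]; exact neg_mem hm)
      rw [M.crys.refl_refl hi] at this
      exact this.trans hc
    · rw [reflPath, reflPath, if_neg h1, if_pos h2]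
      obtain rfl : p = k + 1 := by omega
      refine (IsCrystallographic.Chain.refl_right M.crys i hc ?_ (hpos _ h2.1 h2.2)).2
      exact not_lt.1 fun h' => (h.min k (by omega)).not_gt ((M.coroot_pos_iff hd i _).1 h')
    · rw [reflPath, reflPath, if_neg h1, if_neg h2]
      exact hc

theorem isPath_raise (M : R.PathModel B lam N) (hd : R.IsPath lam N d)
    (h : RaiseData N (R.height i d) p x) : R.IsPath lam N (R.reflPath i p x d) where
  orbit := M.orbit_reflPath hd i p x
  tail j hj := by
    have := h.le
    rw [reflPath, if_neg (by omega), hd.tail j hj]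
  chain k hk := by
    have hi := M.crys.simple_mem i
    have hc := hd.chain k hk
    have hlt := h.lt
    have hneg : ∀ j, p ≤ j → j < x → R.coroot (R.α i) (d j) < 0 := fun j h1 h2 =>
      (M.coroot_neg_iff hd i j).2 (h.anti j h1 h2)
    by_cases h1 : p ≤ k ∧ k < x <;> by_cases h2 : p ≤ k + 1 ∧ k + 1 < x
    · rw [reflPath, reflPath, if_pos h1, if_pos h2]
      exact IsCrystallographic.Chain.refl_neg M.crys i hc (hneg _ h1.1 h1.2) (hneg _ h2.1 h2.2)
    · rw [reflPath, reflPath, if_pos h1, if_neg h2]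
      obtain rfl : x = k + 1 := by omega
      refine (IsCrystallographic.Chain.refl_left M.crys i hc (hneg _ h1.1 h1.2) ?_).2
      exact not_lt.1 fun h' => (h.min (k + 2) (by omega) (by omega)).not_gt
        ((M.coroot_neg_iff hd i _).1 h')
    · rw [reflPath, reflPath, if_neg h1, if_pos h2]
      have hkp : k + 1 = p := by omega
      have hm : (N : ℤ) ∣ R.height i d (k + 1) := by
        rw [hkp, h.eq]
        exact dvd_add h.dvd (dvd_refl _)
      rw [← M.mem_zmultiples_iff hd i (k + 1) hk] at hm
      exact hc.trans (IsCrystallographic.Chain.simple M.crys i (hneg _ h2.1 h2.2) hm)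
    · rw [reflPath, reflPath, if_neg h1, if_neg h2]
      exact hc

end PathModel

end RootData

namespace RootData

variable {R : RootData}

/-- The lowering operator on paths. -/
noncomputable def lowerOp (R : RootData) (N : ℕ) (i : Fin R.r) (d : ℕ → R.V) : ℕ → R.V :=
  if h : ∃ t : ℕ × ℕ, LowerData N (R.height i d) t.1 t.2 then
    R.reflPath i h.choose.1 h.choose.2 d
  else d

/-- The raising operator on paths. -/
noncomputable def raiseOp (R : RootData) (N : ℕ) (i : Fin R.r) (d : ℕ → R.V) : ℕ → R.V :=
  if h : ∃ t : ℕ × ℕ, RaiseData N (R.height i d) t.1 t.2 then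
    R.reflPath i h.choose.1 h.choose.2 d
  else d

/-- How often the raising operator can be applied. -/
noncomputable def eps (R : RootData) (N : ℕ) (i : Fin R.r) (d : ℕ → R.V) : ℕ :=
  sInf {n : ℕ | ∀ k ≤ N, -(n * N : ℤ) ≤ R.height i d k}

/-- How often the lowering operator can be applied. -/
noncomputable def phi (R : RootData) (N : ℕ) (i : Fin R.r) (d : ℕ → R.V) : ℕ :=
  (R.height i d N / N + R.eps N i d).toNat

theorem lowerOp_eq {N : ℕ} {i : Fin R.r} {d : ℕ → R.V} {p x : ℕ}
    (h : LowerData N (R.height i d) p x) : R.lowerOp N i d = R.reflPath i p x d := by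
  have hex : ∃ t : ℕ × ℕ, LowerData N (R.height i d) t.1 t.2 := ⟨(p, x), h⟩
  obtain ⟨h1, h2⟩ := hex.choose_spec.unique h
  rw [lowerOp, dif_pos hex, h1, h2]

theorem raiseOp_eq {N : ℕ} {i : Fin R.r} {d : ℕ → R.V} {p x : ℕ}
    (h : RaiseData N (R.height i d) p x) : R.raiseOp N i d = R.reflPath i p x d := by
  have hex : ∃ t : ℕ × ℕ, RaiseData N (R.height i d) t.1 t.2 := ⟨(p, x), h⟩
  obtain ⟨h1, h2⟩ := hex.choose_spec.unique h
  rw [raiseOp, dif_pos hex, h1, h2]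

theorem height_zero (i : Fin R.r) (d : ℕ → R.V) : R.height i d 0 = 0 := rfl

namespace PathModel

variable {B : R.V →ₗ[ℚ] R.V →ₗ[ℚ] ℚ} {lam : R.V} {N : ℕ} {i : Fin R.r} {d : ℕ → R.V} {p x : ℕ}

theorem eps_eq (M : R.PathModel B lam N) {n : ℕ} (h1 : ∀ k ≤ N, -(n * N : ℤ) ≤ R.height i d k)
    (h2 : ∃ k ≤ N, R.height i d k = -(n * N : ℤ)) : R.eps N i d = n := by
  have hN : (0 : ℤ) < N := by exact_mod_cast M.pos
  refine le_antisymm (Nat.sInf_le h1) (le_csInf ⟨n, h1⟩ fun m hm => ?_)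
  obtain ⟨k, hk, hkn⟩ := h2
  have := hm k hk
  rw [hkn] at this
  have : (n : ℤ) ≤ m := by nlinarith
  exact_mod_cast this

theorem eps_spec (M : R.PathModel B lam N) (hd : R.IsPath lam N d) (i : Fin R.r) :
    (∀ k ≤ N, -(R.eps N i d * N : ℤ) ≤ R.height i d k) ∧
      ∃ k ≤ N, R.height i d k = -(R.eps N i d * N : ℤ) := by
  have hN : (0 : ℤ) < N := by exact_mod_cast M.pos
  obtain ⟨p, -, hpN, hmin, hlast⟩ := exists_last_min (R.height i d) 0 N (Nat.zero_le N)
  obtain ⟨m, hm⟩ := (M.isHeight hd i).dvd_last_min hpN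
    (fun _ => hmin _ (by omega) (by omega)) hlast
  have h0 := hmin 0 le_rfl (by omega)
  rw [height_zero] at h0
  have hm0 : m ≤ 0 := by nlinarith
  obtain ⟨n, rfl⟩ : ∃ n : ℕ, m = -n := ⟨m.natAbs, by omega⟩
  have hn : R.eps N i d = n := M.eps_eq (fun k hk => by
    have := hmin k (Nat.zero_le k) hk
    linarith) ⟨p, hpN, by rw [hm]; ring⟩
  rw [hn]
  exact ⟨fun k hk => by
    have := hmin k (Nat.zero_le k) hk
    linarith, p, hpN, by rw [hm]; ring⟩

theorem phi_mul (M : R.PathModel B lam N) (hd : R.IsPath lam N d) (i : Fin R.r) :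
    (R.phi N i d * N : ℤ) = R.height i d N + R.eps N i d * N := by
  have hN : (0 : ℤ) < N := by exact_mod_cast M.pos
  obtain ⟨m, hm⟩ := (M.isHeight hd i).dvd_last
  have h1 := (M.eps_spec hd i).1 N le_rfl
  rw [phi, hm, Int.mul_ediv_cancel_left _ hN.ne', Int.toNat_of_nonneg]
  · ring
  · rw [hm] at h1
    nlinarith

theorem coroot_pathWt (M : R.PathModel B lam N) (hd : R.IsPath lam N d) (i : Fin R.r) :
    R.coroot (R.α i) (R.pathWt N d) = R.phi N i d - R.eps N i d := by
  have hN : (0 : ℚ) < N := by exact_mod_cast M.pos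
  have h1 : ((R.phi N i d * N : ℤ) : ℚ) = ((R.height i d N + R.eps N i d * N : ℤ) : ℚ) := by
    rw [M.phi_mul hd]
  have h2 : ((R.height i d N : ℤ) : ℚ) = ∑ j ∈ Finset.range N, R.coroot (R.α i) (d j) := by
    rw [height]
    push_cast
    exact Finset.sum_congr rfl fun j _ => M.cast_pair i (hd.orbit j)
  rw [pathWt, map_smul, map_sum, ← h2, smul_eq_mul]
  push_cast at h1
  field_simp
  linarith

theorem exists_lowerData (M : R.PathModel B lam N) (hd : R.IsPath lam N d)
    (h : 0 < R.phi N i d) : ∃ p x, LowerData N (R.height i d) p x := by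
  have hN : (0 : ℤ) < N := by exact_mod_cast M.pos
  obtain ⟨k, hk, hk'⟩ := (M.eps_spec hd i).2
  refine (M.isHeight hd i).exists_lowerData hk ?_
  have := M.phi_mul hd i
  have : (0 : ℤ) < R.phi N i d * N := by positivity
  omega

theorem exists_raiseData (M : R.PathModel B lam N) (hd : R.IsPath lam N d)
    (h : 0 < R.eps N i d) : ∃ p x, RaiseData N (R.height i d) p x := by
  have hN : (0 : ℤ) < N := by exact_mod_cast M.pos
  obtain ⟨k, hk, hk'⟩ := (M.eps_spec hd i).2
  refine (M.isHeight hd i).exists_raiseData hk ?_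
  rw [height_zero, hk']
  have : (0 : ℤ) < R.eps N i d * N := by positivity
  omega

theorem height_eq_of_lowerData (M : R.PathModel B lam N) (hd : R.IsPath lam N d)
    (h : LowerData N (R.height i d) p x) : R.height i d p = -(R.eps N i d * N : ℤ) := by
  obtain ⟨h1, k, hk, hk'⟩ := M.eps_spec hd i
  refine le_antisymm ?_ (h1 p (h.lt.le.trans h.le))
  rw [← hk']
  rcases le_or_gt k p with hkp | hkp
  · exact h.min k hkp
  · exact (h.lt_of_gt k hkp hk).le

theorem height_eq_of_raiseData (M : R.PathModel B lam N) (hd : R.IsPath lam N d)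
    (h : RaiseData N (R.height i d) p x) : R.height i d x = -(R.eps N i d * N : ℤ) := by
  obtain ⟨h1, k, hk, hk'⟩ := M.eps_spec hd i
  refine le_antisymm ?_ (h1 x h.le)
  rw [← hk']
  rcases le_or_gt x k with hkp | hkp
  · exact h.min k hkp hk
  · exact (h.lt_of_lt k hkp).le

theorem pathWt_reflPath (M : R.PathModel B lam N) (hd : R.IsPath lam N d)
    (h : LowerData N (R.height i d) p x) :
    R.pathWt N (R.reflPath i p x d) = R.pathWt N d - R.α i := by
  have hN : (N : ℚ) ≠ 0 := by exact_mod_cast M.pos.ne'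
  rw [pathWt, M.sum_reflPath hd i h.lt.le N h.le, h.eq, pathWt, smul_sub, smul_smul]
  congr 1
  push_cast
  rw [add_sub_cancel_left, inv_mul_cancel₀ hN, one_smul]

/-- The crystal relations for the lowering operator, and its effect on the initial direction. -/
theorem lowerOp_spec (M : R.PathModel B lam N) (hd : R.IsPath lam N d) (h : 0 < R.phi N i d) :
    R.IsPath lam N (R.lowerOp N i d) ∧ R.raiseOp N i (R.lowerOp N i d) = d ∧
    R.pathWt N (R.lowerOp N i d) = R.pathWt N d - R.α i ∧
    R.eps N i (R.lowerOp N i d) = R.eps N i d + 1 ∧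
    R.phi N i (R.lowerOp N i d) + 1 = R.phi N i d ∧
    (R.lowerOp N i d 0 = d 0 ∨
      R.eps N i d = 0 ∧ R.lowerOp N i d 0 = R.refl (R.α i) (d 0)) := by
  have hN : (0 : ℤ) < N := by exact_mod_cast M.pos
  obtain ⟨p, x, hl⟩ := M.exists_lowerData hd h
  rw [lowerOp_eq hl]
  have hpath := M.isPath_lower hd hl
  have hrefl := M.height_reflPath hd i hl.lt.le
  have hr := hl.raiseData hrefl
  have hp := M.height_eq_of_lowerData hd hl
  have heps : R.eps N i (R.reflPath i p x d) = R.eps N i d + 1 := by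
    have h1 := M.height_eq_of_raiseData hpath hr
    have h2 := hr.eq
    rw [hrefl.left p le_rfl, hp, h1] at h2
    have h3 : (R.eps N i (R.reflPath i p x d) : ℤ) = R.eps N i d + 1 := by
      have : (N : ℤ) * (R.eps N i (R.reflPath i p x d)) = N * (R.eps N i d + 1) := by linarith
      exact mul_left_cancel₀ hN.ne' this
    exact_mod_cast h3
  refine ⟨hpath, ?_, M.pathWt_reflPath hd hl, heps, ?_, ?_⟩
  · rw [raiseOp_eq hr, M.reflPath_reflPath]
  · have h1 := M.phi_mul hpath i
    have h2 := M.phi_mul hd i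
    rw [hrefl.right N hl.le, heps, hl.eq] at h1
    have h3 : (R.phi N i (R.reflPath i p x d) + 1 : ℤ) = R.phi N i d := by
      have : (N : ℤ) * (R.phi N i (R.reflPath i p x d) + 1) = N * R.phi N i d := by
        push_cast at h1
        linarith
      exact mul_left_cancel₀ hN.ne' this
    exact_mod_cast h3
  · rcases Nat.eq_zero_or_pos p with rfl | h0
    · right
      rw [height_zero] at hp
      refine ⟨?_, by rw [reflPath, if_pos ⟨le_rfl, hl.lt⟩]⟩
      have : (R.eps N i d * N : ℤ) = 0 := by omega
      rcases mul_eq_zero.1 this with h' | h'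
      · exact_mod_cast h'
      · omega
    · left
      rw [reflPath, if_neg (by omega)]

/-- The crystal relations for the raising operator, and its effect on the initial direction. -/
theorem raiseOp_spec (M : R.PathModel B lam N) (hd : R.IsPath lam N d) (h : 0 < R.eps N i d) :
    R.IsPath lam N (R.raiseOp N i d) ∧ R.lowerOp N i (R.raiseOp N i d) = d ∧
    R.eps N i (R.raiseOp N i d) + 1 = R.eps N i d ∧
    R.phi N i (R.raiseOp N i d) = R.phi N i d + 1 ∧
    (R.raiseOp N i d 0 = d 0 ∨
      R.eps N i d = 1 ∧ R.raiseOp N i d 0 = R.refl (R.α i) (d 0)) := by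
  have hN : (0 : ℤ) < N := by exact_mod_cast M.pos
  obtain ⟨p, x, hl⟩ := M.exists_raiseData hd h
  rw [raiseOp_eq hl]
  have hpath := M.isPath_raise hd hl
  have hrefl := M.height_reflPath hd i hl.lt.le
  have hr := hl.lowerData hrefl
  have hp := M.height_eq_of_raiseData hd hl
  have hlow : R.lowerOp N i (R.reflPath i p x d) = d := by
    rw [lowerOp_eq hr, M.reflPath_reflPath]
  have hphi : 0 < R.phi N i (R.reflPath i p x d) := by
    have h1 := M.phi_mul hpath i
    have h2 := M.height_eq_of_lowerData hpath hr
    have h3 := hr.lt_of_gt N (hr.lt.trans_le hr.le) le_rfl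
    have : (0 : ℤ) < R.phi N i (R.reflPath i p x d) * N := by omega
    have := pos_of_mul_pos_left this hN.le
    exact_mod_cast this
  obtain ⟨-, -, -, h1, h2, -⟩ := M.lowerOp_spec hpath hphi
  rw [hlow] at h1 h2
  refine ⟨hpath, hlow, h1.symm, h2.symm, ?_⟩
  rcases Nat.eq_zero_or_pos p with rfl | h0
  · right
    refine ⟨?_, by rw [reflPath, if_pos ⟨le_rfl, hl.lt⟩]⟩
    have h3 := hl.eq
    rw [height_zero, hp] at h3
    have : (N : ℤ) * R.eps N i d = N * 1 := by linarith
    exact_mod_cast mul_left_cancel₀ hN.ne' this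
  · left
    rw [reflPath, if_neg (by omega)]

end PathModel

end RootData

/-- Summation over a set which is a union of strings, each starting at level `j`. -/
theorem sum_strings {X G : Type*} [AddCommMonoid G] (S : Finset X) (e f : X → X) (eps phi : X → ℕ)
    (g : X → G) (j : ℕ) (hge : ∀ x ∈ S, j ≤ eps x)
    (hf : ∀ x ∈ S, 0 < phi x → f x ∈ S ∧ e (f x) = x ∧ eps (f x) = eps x + 1 ∧
      phi (f x) + 1 = phi x)
    (he : ∀ x ∈ S, j < eps x → e x ∈ S ∧ f (e x) = x ∧ eps (e x) + 1 = eps x ∧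
      phi (e x) = phi x + 1) :
    ∑ x ∈ S, g x = ∑ b ∈ S with eps b = j, ∑ k ∈ Finset.range (phi b + 1), g (f^[k] b) := by
  have hfk : ∀ k, ∀ x ∈ S, k ≤ phi x → f^[k] x ∈ S ∧ e^[k] (f^[k] x) = x ∧
      eps (f^[k] x) = eps x + k ∧ phi (f^[k] x) + k = phi x := by
    intro k
    induction k with
    | zero => intro x hx _; simp [hx]
    | succ k ih =>
      intro x hx hk
      obtain ⟨h1, h2, h3, h4⟩ := ih x hx (by omega)
      obtain ⟨h5, h6, h7, h8⟩ := hf _ h1 (by omega)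
      rw [Function.iterate_succ_apply', Function.iterate_succ_apply, h6]
      exact ⟨h5, h2, by omega, by omega⟩
  have hek : ∀ k, ∀ x ∈ S, j + k ≤ eps x → e^[k] x ∈ S ∧ f^[k] (e^[k] x) = x ∧
      eps (e^[k] x) + k = eps x ∧ phi (e^[k] x) = phi x + k := by
    intro k
    induction k with
    | zero => intro x hx _; simp [hx]
    | succ k ih =>
      intro x hx hk
      obtain ⟨h1, h2, h3, h4⟩ := ih x hx (by omega)
      obtain ⟨h5, h6, h7, h8⟩ := he _ h1 (by omega)
      rw [Function.iterate_succ_apply', Function.iterate_succ_apply, h6]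
      exact ⟨h5, h2, by omega, by omega⟩
  rw [Finset.sum_sigma']
  refine Finset.sum_bij' (fun x _ => ⟨e^[eps x - j] x, eps x - j⟩) (fun y _ => f^[y.2] y.1)
    ?_ ?_ ?_ ?_ ?_
  · intro x hx
    have h0 := hge x hx
    obtain ⟨h1, h2, h3, h4⟩ := hek (eps x - j) x hx (by omega)
    simp only [Finset.mem_sigma, Finset.mem_filter, Finset.mem_range]
    exact ⟨⟨h1, by omega⟩, by omega⟩
  · rintro ⟨b, k⟩ hb
    simp only [Finset.mem_sigma, Finset.mem_filter, Finset.mem_range] at hb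
    exact (hfk k b hb.1.1 (by omega)).1
  · intro x hx
    have h0 := hge x hx
    exact (hek (eps x - j) x hx (by omega)).2.1
  · rintro ⟨b, k⟩ hb
    simp only [Finset.mem_sigma, Finset.mem_filter, Finset.mem_range] at hb
    obtain ⟨h1, h2, h3, h4⟩ := hfk k b hb.1.1 (by omega)
    have h5 : eps (f^[k] b) - j = k := by omega
    simp only [h5, h2]
  · intro x hx
    have h0 := hge x hx
    rw [(hek (eps x - j) x hx (by omega)).2.1]

namespace RootData

variable {R : RootData}

theorem demOp_single (i : Fin R.r) (v : R.V) :
    R.demOp i (Finsupp.single v 1) = R.demOnBasis i v := by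
  simp [demOp]

theorem demOnBasis_of_nonneg (i : Fin R.r) {v : R.V} {n : ℕ} (hv : R.coroot (R.α i) v = n) :
    R.demOnBasis i v = ∑ k ∈ Finset.range (n + 1), Finsupp.single (v - (k : ℚ) • R.α i) 1 := by
  have hf : ⌊R.coroot (R.α i) v⌋ = n := by rw [hv]; exact Int.floor_natCast n
  rw [demOnBasis, hf, if_pos (by omega), Int.toNat_natCast]

namespace IsCrystallographic

variable {B : R.V →ₗ[ℚ] R.V →ₗ[ℚ] ℚ}

theorem demOnBasis_antisymm_of_nonneg (h : R.IsCrystallographic B) (i : Fin R.r) {v : R.V} {n : ℕ}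
    (hv : R.coroot (R.α i) v = n) :
    R.demOnBasis i (v - ((n : ℚ) + 1) • R.α i) = -R.demOnBasis i v := by
  have hf : ⌊R.coroot (R.α i) (v - ((n : ℚ) + 1) • R.α i)⌋ = -(n : ℤ) - 2 := by
    rw [map_sub, map_smul, h.coroot_self (h.simple_mem i), hv, Int.floor_eq_iff]
    push_cast
    constructor <;> rw [smul_eq_mul] <;> linarith
  rw [demOnBasis_of_nonneg i hv, demOnBasis, hf, if_neg (by omega), if_neg (by omega),
    show (-(-(n : ℤ) - 2)).toNat - 1 = n + 1 by omega]
  rw [← Finset.sum_range_reflect]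
  congr 1
  refine Finset.sum_congr rfl fun k hk => ?_
  rw [Finset.mem_range] at hk
  congr 1
  rw [show n + 1 - 1 - k = n - k by omega, Nat.cast_sub (by omega)]
  module

theorem demOnBasis_antisymm (h : R.IsCrystallographic B) (i : Fin R.r) {v : R.V} {m : ℤ}
    (hv : R.coroot (R.α i) v = m) :
    R.demOnBasis i (v - ((m : ℚ) + 1) • R.α i) = -R.demOnBasis i v := by
  rcases lt_trichotomy m (-1) with hm | rfl | hm
  · obtain ⟨n, rfl⟩ : ∃ n : ℕ, m = -n - 2 := ⟨(-m - 2).toNat, by omega⟩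
    have h1 := h.demOnBasis_antisymm_of_nonneg i (n := n)
      (v := v - (((-n - 2 : ℤ) : ℚ) + 1) • R.α i) (by
        rw [map_sub, map_smul, h.coroot_self (h.simple_mem i), hv]
        push_cast
        rw [smul_eq_mul]
        ring)
    have h2 : v - (((-n - 2 : ℤ) : ℚ) + 1) • R.α i - ((n : ℚ) + 1) • R.α i = v := by
      push_cast
      module
    rw [h2] at h1
    rw [h1, neg_neg]
  · have hz : R.demOnBasis i v = 0 := by
      have hf : ⌊R.coroot (R.α i) v⌋ = -1 := by rw [hv]; exact Int.floor_intCast _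
      rw [demOnBasis, hf, if_neg (by omega), if_pos rfl]
    simp [hz]
  · obtain ⟨n, rfl⟩ : ∃ n : ℕ, m = n := ⟨m.toNat, by omega⟩
    exact_mod_cast h.demOnBasis_antisymm_of_nonneg i (n := n) (by rw [hv]; simp)

theorem demOp_string_eq_zero (h : R.IsCrystallographic B) (i : Fin R.r) {v : R.V} {n : ℕ}
    (hv : R.coroot (R.α i) v = n - 1) :
    R.demOp i (∑ k ∈ Finset.range (n + 1), Finsupp.single (v - (k : ℚ) • R.α i) 1) = 0 := by
  rw [map_sum]
  simp only [demOp_single]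
  refine self_eq_neg.1 ?_
  rw [← Finset.sum_neg_distrib]
  conv_lhs => rw [← Finset.sum_range_reflect]
  refine Finset.sum_congr rfl fun k hk => ?_
  rw [Finset.mem_range] at hk
  have := h.demOnBasis_antisymm i (v := v - (k : ℚ) • R.α i) (m := n - 1 - 2 * k) (by
    rw [map_sub, map_smul, h.coroot_self (h.simple_mem i), hv]
    push_cast
    rw [smul_eq_mul]
    ring)
  rw [← this]
  congr 1
  rw [show n + 1 - 1 - k = n - k by omega, Nat.cast_sub (by omega)]
  push_cast
  module

end IsCrystallographic

namespace PathModel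

variable {B : R.V →ₗ[ℚ] R.V →ₗ[ℚ] ℚ} {lam : R.V} {N : ℕ} {i : Fin R.r} {d : ℕ → R.V} {p x : ℕ}

theorem finite_paths (M : R.PathModel B lam N) : {d | R.IsPath lam N d}.Finite := by
  have hfin : (Set.pi Set.univ fun _ : Fin N => {v | R.Orbit lam v}).Finite :=
    Set.Finite.pi fun _ => M.finite
  refine Set.Finite.of_finite_image (f := fun d (j : Fin N) => d j)
    (hfin.subset ?_) ?_
  · rintro _ ⟨d, hd, rfl⟩ j -
    exact hd.orbit j
  · intro d hd d' hd' he
    funext j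
    rcases lt_or_ge j N with hj | hj
    · exact congrFun he ⟨j, hj⟩
    · rw [hd.tail j hj, hd'.tail j hj]

/-- The paths whose initial direction lies in `A`. -/
noncomputable def pathsFrom (M : R.PathModel B lam N) (A : Set R.V) : Finset (ℕ → R.V) :=
  {d ∈ M.finite_paths.toFinset | d 0 ∈ A}

theorem mem_pathsFrom (M : R.PathModel B lam N) {A : Set R.V} :
    d ∈ M.pathsFrom A ↔ R.IsPath lam N d ∧ d 0 ∈ A := by
  simp [pathsFrom]

theorem pathWt_iterate_lowerOp (M : R.PathModel B lam N) (hd : R.IsPath lam N d) (i : Fin R.r)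
    (k : ℕ) (hk : k ≤ R.phi N i d) : R.IsPath lam N ((R.lowerOp N i)^[k] d) ∧
      R.pathWt N ((R.lowerOp N i)^[k] d) = R.pathWt N d - (k : ℚ) • R.α i ∧
      R.phi N i ((R.lowerOp N i)^[k] d) + k = R.phi N i d ∧
      ((R.lowerOp N i)^[k] d 0 = d 0 ∨ (R.lowerOp N i)^[k] d 0 = R.refl (R.α i) (d 0)) := by
  induction k with
  | zero => simp [hd]
  | succ k ih =>
    obtain ⟨h1, h2, h3, h4⟩ := ih (by omega)
    obtain ⟨h5, -, h6, h7, h8, h9⟩ := M.lowerOp_spec h1 (i := i) (by omega)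
    rw [Function.iterate_succ_apply']
    refine ⟨h5, ?_, by omega, ?_⟩
    · rw [h6, h2]
      push_cast
      module
    · rcases h9 with h9 | ⟨-, h9⟩
      · rwa [h9]
      · rw [h9]
        rcases h4 with h4 | h4
        · exact Or.inr (by rw [h4])
        · exact Or.inl (by rw [h4, M.crys.refl_refl (M.crys.simple_mem i)])

theorem refl_mem_union (M : R.PathModel B lam N) {A : Set R.V} (i : Fin R.r) {v : R.V}
    (hv : v ∈ A ∪ R.refl (R.α i) '' A) : R.refl (R.α i) v ∈ A ∪ R.refl (R.α i) '' A := by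
  rcases hv with hv | ⟨u, hu, rfl⟩
  · exact Or.inr ⟨v, hv, rfl⟩
  · exact Or.inl (by rwa [M.crys.refl_refl (M.crys.simple_mem i)])

theorem mem_of_eps_eq_zero (M : R.PathModel B lam N) {A : Set R.V} (hA : R.IsLower A)
    (hd : R.IsPath lam N d) (h0 : R.eps N i d = 0) (hm : d 0 ∈ A ∪ R.refl (R.α i) '' A) :
    d 0 ∈ A := by
  have hi := M.crys.simple_mem i
  rcases hm with hm | ⟨u, hu, he⟩
  · exact hm
  have hc : ¬ R.coroot (R.α i) (d 0) < 0 := by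
    rw [M.coroot_neg_iff hd i 0, height_zero]
    have := (M.eps_spec hd i).1 1 M.pos
    rw [h0] at this
    simpa using this
  rw [← he, M.crys.coroot_refl_self hi, not_lt] at hc
  rcases hc.eq_or_lt with h' | h'
  · rw [← he, IsCrystallographic.refl_eq_self (by linarith)]
    exact hu
  · rw [← he]
    exact hA u hu _ (M.crys.simple_pos i) (by linarith)

/-- The character of the paths with initial direction in `A ∪ s_i A`, as a sum over heads of
strings. -/
theorem sum_union (M : R.PathModel B lam N) (A : Set R.V) (i : Fin R.r) :
    ∑ d ∈ M.pathsFrom (A ∪ R.refl (R.α i) '' A), Finsupp.single (R.pathWt N d) (1 : ℤ) =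
      ∑ d ∈ M.pathsFrom (A ∪ R.refl (R.α i) '' A) with R.eps N i d = 0,
        ∑ k ∈ Finset.range (R.phi N i d + 1),
          Finsupp.single (R.pathWt N d - (k : ℚ) • R.α i) 1 := by
  rw [sum_strings _ (R.raiseOp N i) (R.lowerOp N i) (R.eps N i) (R.phi N i) _ 0
    (fun _ _ => Nat.zero_le _)]
  · refine Finset.sum_congr rfl fun d hd => Finset.sum_congr rfl fun k hk => ?_
    rw [Finset.mem_filter, M.mem_pathsFrom] at hd
    rw [Finset.mem_range] at hk
    rw [(M.pathWt_iterate_lowerOp hd.1.1 i k (by omega)).2.1]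
  · intro d hd hphi
    rw [M.mem_pathsFrom] at hd
    obtain ⟨h1, h2, -, h4, h5, h6⟩ := M.lowerOp_spec hd.1 hphi
    refine ⟨M.mem_pathsFrom.2 ⟨h1, ?_⟩, h2, h4, h5⟩
    rcases h6 with h6 | ⟨-, h6⟩
    · rw [h6]
      exact hd.2
    · rw [h6]
      exact M.refl_mem_union i hd.2
  · intro d hd heps
    rw [M.mem_pathsFrom] at hd
    obtain ⟨h1, h2, h4, h5, h6⟩ := M.raiseOp_spec hd.1 heps
    refine ⟨M.mem_pathsFrom.2 ⟨h1, ?_⟩, h2, h4, h5⟩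
    rcases h6 with h6 | ⟨-, h6⟩
    · rw [h6]
      exact hd.2
    · rw [h6]
      exact M.refl_mem_union i hd.2

theorem demOp_sum_nonheads (M : R.PathModel B lam N) (A : Set R.V) (i : Fin R.r) :
    R.demOp i (∑ d ∈ M.pathsFrom A with ¬ R.eps N i d = 0,
      Finsupp.single (R.pathWt N d) (1 : ℤ)) = 0 := by
  rw [sum_strings _ (R.raiseOp N i) (R.lowerOp N i) (R.eps N i) (R.phi N i) _ 1]
  · rw [map_sum]
    refine Finset.sum_eq_zero fun d hd => ?_
    rw [Finset.mem_filter, Finset.mem_filter, M.mem_pathsFrom] at hd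
    have hw := M.coroot_pathWt hd.1.1.1 i
    rw [hd.2] at hw
    rw [← M.crys.demOp_string_eq_zero i (v := R.pathWt N d) (n := R.phi N i d)
      (by rw [hw]; simp)]
    congr 1
    refine Finset.sum_congr rfl fun k hk => ?_
    rw [Finset.mem_range] at hk
    rw [(M.pathWt_iterate_lowerOp hd.1.1.1 i k (by omega)).2.1]
  · intro d hd
    rw [Finset.mem_filter] at hd
    omega
  · intro d hd hphi
    rw [Finset.mem_filter, M.mem_pathsFrom] at hd
    obtain ⟨h1, h2, -, h4, h5, h6⟩ := M.lowerOp_spec hd.1.1 hphi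
    refine ⟨Finset.mem_filter.2 ⟨M.mem_pathsFrom.2 ⟨h1, ?_⟩, by omega⟩, h2, h4, h5⟩
    rcases h6 with h6 | ⟨h6, -⟩
    · rw [h6]
      exact hd.1.2
    · exact absurd h6 hd.2
  · intro d hd heps
    rw [Finset.mem_filter, M.mem_pathsFrom] at hd
    obtain ⟨h1, h2, h4, h5, h6⟩ := M.raiseOp_spec hd.1.1 (show 0 < R.eps N i d by omega)
    refine ⟨Finset.mem_filter.2 ⟨M.mem_pathsFrom.2 ⟨h1, ?_⟩, by omega⟩, h2, h4, h5⟩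
    rcases h6 with h6 | ⟨h6, -⟩
    · rw [h6]
      exact hd.1.2
    · omega

theorem demOp_sum_pathsFrom (M : R.PathModel B lam N) {A : Set R.V} (hA : R.IsLower A)
    (i : Fin R.r) :
    R.demOp i (∑ d ∈ M.pathsFrom A, Finsupp.single (R.pathWt N d) (1 : ℤ)) =
      ∑ d ∈ M.pathsFrom (A ∪ R.refl (R.α i) '' A), Finsupp.single (R.pathWt N d) (1 : ℤ) := by
  rw [M.sum_union, ← Finset.sum_filter_add_sum_filter_not _ (fun d => R.eps N i d = 0), map_add,
    M.demOp_sum_nonheads, add_zero, map_sum]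
  refine Finset.sum_congr ?_ fun d hd => ?_
  · ext d
    rw [Finset.mem_filter, Finset.mem_filter, M.mem_pathsFrom, M.mem_pathsFrom]
    exact ⟨fun h => ⟨⟨h.1.1, Or.inl h.1.2⟩, h.2⟩,
      fun h => ⟨⟨h.1.1, M.mem_of_eps_eq_zero hA h.1.1 h.2 h.1.2⟩, h.2⟩⟩
  · rw [Finset.mem_filter, M.mem_pathsFrom] at hd
    have hw := M.coroot_pathWt hd.1.1 i
    rw [hd.2] at hw
    rw [demOp_single, demOnBasis_of_nonneg i (n := R.phi N i d) (by rw [hw]; simp)]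

theorem isPath_const (lam : R.V) (N : ℕ) : R.IsPath lam N fun _ => lam :=
  ⟨fun _ => .base, fun _ _ => rfl, fun _ _ => .refl⟩

theorem pathsFrom_singleton (M : R.PathModel B lam N) : M.pathsFrom {lam} = {fun _ => lam} := by
  ext d
  rw [M.mem_pathsFrom, Finset.mem_singleton]
  constructor
  · rintro ⟨hd, h0⟩
    funext j
    induction j with
    | zero => exact h0
    | succ j ih =>
      rcases lt_or_ge (j + 1) N with hj | hj
      · have := hd.chain j hj
        rw [ih] at this
        exact IsCrystallographic.Chain.eq_of_dominant M.crys M.dominant this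
      · exact hd.tail _ hj
  · rintro rfl
    exact ⟨isPath_const lam N, rfl⟩

theorem pathWt_const (M : R.PathModel B lam N) : R.pathWt N (fun _ => lam) = lam := by
  have hN : (N : ℚ) ≠ 0 := by exact_mod_cast M.pos.ne'
  rw [pathWt, Finset.sum_const, Finset.card_range, ← Nat.cast_smul_eq_nsmul ℚ, smul_smul,
    inv_mul_cancel₀ hN, one_smul]

/-- The path model for Demazure characters. -/
theorem demChar_eq (M : R.PathModel B lam N) (l : List (Fin R.r)) : R.demChar l lam =
    ∑ d ∈ M.pathsFrom (R.subwordOrbit lam l), Finsupp.single (R.pathWt N d) (1 : ℤ) := by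
  induction l with
  | nil => rw [subwordOrbit, M.pathsFrom_singleton, Finset.sum_singleton, M.pathWt_const]; rfl
  | cons i l ih =>
    rw [subwordOrbit, ← M.demOp_sum_pathsFrom (M.crys.isLower_subwordOrbit M.dominant l), ← ih]
    rfl

theorem demChar_pos (M : R.PathModel B lam N) (l : List (Fin R.r)) (hd : R.IsPath lam N d)
    (h0 : d 0 ∈ R.subwordOrbit lam l) : 0 < R.demChar l lam (R.pathWt N d) := by
  rw [M.demChar_eq l, Finsupp.finsetSum_apply]
  refine Finset.sum_pos' (fun d' _ => ?_) ⟨d, M.mem_pathsFrom.2 ⟨hd, h0⟩, by simp⟩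
  rw [Finsupp.single_apply]
  split_ifs <;> simp

end PathModel

end RootData

section Separation

variable {V : Type*} [AddCommGroup V] [Module ℚ V]

/-- The lemma of Farkas over `ℚ`. -/
theorem exists_nonneg_comb_or_separating {ι : Type*} (s : Finset ι) : ∀ (a : ι → V) (y : V),
    (∃ c : ι → ℚ, (∀ i, 0 ≤ c i) ∧ y = ∑ i ∈ s, c i • a i) ∨
      ∃ w : Module.Dual ℚ V, (∀ i ∈ s, 0 ≤ w (a i)) ∧ w y < 0 := by
  induction s using Finset.induction_on with
  | empty =>
    intro a y
    by_cases hy : y = 0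
    · exact Or.inl ⟨0, by simp, by simp [hy]⟩
    · have : ¬ ∀ w : Module.Dual ℚ V, w y = 0 := fun h =>
        hy ((Module.forall_dual_apply_eq_zero_iff ℚ y).1 h)
      push Not at this
      obtain ⟨w, hw⟩ := this
      rcases lt_or_gt_of_ne hw with hw | hw
      · exact Or.inr ⟨w, by simp, hw⟩
      · exact Or.inr ⟨-w, by simp, by simpa using hw⟩
  | insert j s hj ih =>
    intro a y
    rcases ih a y with ⟨c, hc, hy⟩ | ⟨w, hw, hy⟩
    · refine Or.inl ⟨Function.update c j 0, fun i => ?_, ?_⟩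
      · by_cases hi : i = j
        · simp [hi]
        · simp [hi, hc i]
      · rw [Finset.sum_insert hj, hy]
        simp only [Function.update_self, zero_smul, zero_add]
        refine Finset.sum_congr rfl fun i hi => ?_
        rw [Function.update_of_ne (ne_of_mem_of_not_mem hi hj)]
    · by_cases hwj : 0 ≤ w (a j)
      · exact Or.inr ⟨w, by simpa [hwj] using hw, hy⟩
      push Not at hwj
      set P : V →ₗ[ℚ] V := LinearMap.id - ((w (a j))⁻¹ • w).smulRight (a j) with hP
      have hPv : ∀ v, P v = v - ((w (a j))⁻¹ * w v) • a j := fun v => by simp [hP]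
      have hPj : P (a j) = 0 := by rw [hPv, inv_mul_cancel₀ hwj.ne]; simp
      rcases ih (fun i => P (a i)) (P y) with ⟨c, hc, hy'⟩ | ⟨w', hw', hy'⟩
      · set t : ℚ := (w (a j))⁻¹ * (w y - ∑ i ∈ s, c i * w (a i)) with ht
        have ht0 : 0 ≤ t := by
          refine mul_nonneg_of_nonpos_of_nonpos (inv_nonpos.2 hwj.le) ?_
          have := Finset.sum_nonneg fun i hi => mul_nonneg (hc i) (hw i hi)
          linarith
        refine Or.inl ⟨Function.update c j t, fun i => ?_, ?_⟩
        · by_cases hi : i = j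
          · simp [hi, ht0]
          · simp [hi, hc i]
        · rw [Finset.sum_insert hj, Function.update_self, Finset.sum_congr rfl
            (fun i hi => by rw [Function.update_of_ne (ne_of_mem_of_not_mem hi hj)] :
              ∀ i ∈ s, Function.update c j t i • a i = c i • a i)]
          have h1 : ∑ i ∈ s, c i • P (a i) =
              ∑ i ∈ s, c i • a i - ((w (a j))⁻¹ * ∑ i ∈ s, c i * w (a i)) • a j := by
            rw [Finset.mul_sum, Finset.sum_smul, ← Finset.sum_sub_distrib]
            refine Finset.sum_congr rfl fun i _ => ?_
            rw [hPv]
            module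
          rw [h1, hPv, sub_eq_iff_eq_add] at hy'
          rw [hy', ht]
          module
      · refine Or.inr ⟨w'.comp P, fun i hi => ?_, hy'⟩
        rcases Finset.mem_insert.1 hi with rfl | hi
        · simp [hPj]
        · exact hw' i hi

/-- A point outside the convex hull of a finite set is strictly separated from it. -/
theorem exists_separating_of_notMem_convexHull {A : Set V} (hA : A.Finite) {y : V}
    (hy : y ∉ convexHull ℚ A) : ∃ w : Module.Dual ℚ V, ∀ p ∈ A, w y < w p := by
  rcases exists_nonneg_comb_or_separating hA.toFinset (fun p => ((p, 1) : V × ℚ)) (y, 1) with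
    ⟨c, hc, h⟩ | ⟨w, hw, hwy⟩
  · refine absurd ?_ hy
    have h1 : y = ∑ p ∈ hA.toFinset, c p • p := by
      simpa [Prod.fst_sum] using congrArg Prod.fst h
    have h2 : 1 = ∑ p ∈ hA.toFinset, c p := by
      simpa [Prod.snd_sum] using congrArg Prod.snd h
    rw [h1]
    exact (convex_convexHull ℚ A).sum_mem (fun p _ => hc p) h2.symm
      fun p hp => subset_convexHull ℚ A (hA.mem_toFinset.1 hp)
  · refine ⟨w.comp (LinearMap.inl ℚ V ℚ), fun p hp => ?_⟩
    have h1 := hw p (hA.mem_toFinset.2 hp)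
    have h2 : ∀ v : V, w (v, 1) = w (v, 0) + w (0, 1) := fun v => by
      rw [← map_add]; simp
    rw [h2] at h1 hwy
    simp only [LinearMap.comp_apply, LinearMap.inl_apply]
    linarith

end Separation

/-- The set of points from which a convex set is hit by the ray in direction `a` is convex. -/
theorem Convex.setOf_exists_add_smul_mem {V : Type*} [AddCommGroup V] [Module ℚ V] {C : Set V}
    (hC : Convex ℚ C) (a : V) : Convex ℚ {v | ∃ t : ℚ, 0 ≤ t ∧ v + t • a ∈ C} := by
  rintro x ⟨t, ht, hx⟩ y ⟨u, hu, hy⟩ b c hb hc hbc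
  refine ⟨b * t + c * u, by positivity, ?_⟩
  have := hC hx hy hb hc hbc
  convert this using 1
  module

namespace RootData

variable {R : RootData} {B : R.V →ₗ[ℚ] R.V →ₗ[ℚ] ℚ} {lam : R.V}

theorem refl_add (β v w : R.V) : R.refl β (v + w) = R.refl β v + R.refl β w := by
  simp only [refl, map_add]
  module

theorem refl_sub (β v w : R.V) : R.refl β (v - w) = R.refl β v - R.refl β w := by
  simp only [refl, map_sub]
  module

theorem refl_smul (β : R.V) (c : ℚ) (v : R.V) : R.refl β (c • v) = c • R.refl β v := by
  simp only [refl, map_smul, smul_eq_mul]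
  module

theorem finite_subwordOrbit (lam : R.V) (l : List (Fin R.r)) :
    (R.subwordOrbit lam l).Finite := by
  induction l with
  | nil => exact Set.finite_singleton lam
  | cons i l ih => exact ih.union (ih.image _)

theorem subwordOrbit_nonempty (lam : R.V) (l : List (Fin R.r)) :
    (R.subwordOrbit lam l).Nonempty := by
  induction l with
  | nil => exact Set.singleton_nonempty lam
  | cons i l ih => exact ih.mono Set.subset_union_left

/-- The cone spanned by the roots along which `p` is reflected, with negative pairing, to another
point of `A`. -/
def edgeCone (R : RootData) (A : Set R.V) (p : R.V) : AddSubmonoid R.V :=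
  AddSubmonoid.closure {v | ∃ c : ℚ, 0 ≤ c ∧ ∃ β ∈ R.Φ, R.refl β p ∈ A ∧ R.coroot β p < 0 ∧
    v = c • β}

theorem edgeCone_mono {A A' : Set R.V} (hA : A ⊆ A') (p : R.V) :
    R.edgeCone A p ≤ R.edgeCone A' p := by
  refine AddSubmonoid.closure_mono ?_
  rintro v ⟨c, hc, β, hβ, h1, h2, h3⟩
  exact ⟨c, hc, β, hβ, hA h1, h2, h3⟩

namespace IsCrystallographic

theorem refl_mem_edgeCone (h : R.IsCrystallographic B) {A A' : Set R.V} {γ : R.V} (hγ : γ ∈ R.Φ)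
    (hA : ∀ v ∈ A, R.refl γ v ∈ A') {p v : R.V} (hv : v ∈ R.edgeCone A p) :
    R.refl γ v ∈ R.edgeCone A' (R.refl γ p) := by
  induction hv using AddSubmonoid.closure_induction with
  | mem x hx =>
    obtain ⟨c, hc, β, hβ, h1, h2, rfl⟩ := hx
    refine AddSubmonoid.subset_closure ⟨c, hc, R.refl γ β, h.refl_mem γ hγ β hβ, ?_, ?_, ?_⟩
    · rw [h.refl_conj hγ hβ]
      exact hA _ h1
    · rwa [h.coroot_refl hγ hβ]
    · rw [refl_smul]
  | zero =>
    have : R.refl γ 0 = 0 := by simp [refl]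
    rw [this]
    exact zero_mem _
  | add x y _ _ hx hy =>
    rw [refl_add]
    exact add_mem hx hy

theorem coroot_pos_of_notMem {A : Set R.V} (hA : R.IsLower A) {β p : R.V} (hβ : β ∈ R.pos)
    (hp : p ∈ A) (hn : R.refl β p ∉ A) : 0 < R.coroot β p := by
  by_contra! hle
  rcases hle.lt_or_eq with h1 | h1
  · exact hn (hA p hp β hβ h1)
  · rw [refl_eq_self h1] at hn
    exact hn hp

theorem sub_mem_edgeCone_union (h : R.IsCrystallographic B) {A : Set R.V} (hA : R.IsLower A)
    (he : ∀ p ∈ A, ∀ q ∈ A, q - p ∈ R.edgeCone A p) (i : Fin R.r) :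
    ∀ p ∈ A ∪ R.refl (R.α i) '' A, ∀ q ∈ A ∪ R.refl (R.α i) '' A,
      q - p ∈ R.edgeCone (A ∪ R.refl (R.α i) '' A) p := by
  have hα := h.simple_mem i
  set A' := A ∪ R.refl (R.α i) '' A with hA'
  have hin : ∀ p ∈ A, ∀ q ∈ A, q - p ∈ R.edgeCone A' p := fun p hp q hq =>
    edgeCone_mono Set.subset_union_left p (he p hp q hq)
  have hmap : ∀ p ∈ A, ∀ q ∈ A,
      R.refl (R.α i) (q - p) ∈ R.edgeCone A' (R.refl (R.α i) p) := fun p hp q hq =>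
    h.refl_mem_edgeCone hα (fun v hv => Or.inr ⟨v, hv, rfl⟩) (he p hp q hq)
  rintro p (hp | ⟨p', hp', rfl⟩) q (hq | ⟨q', hq', rfl⟩)
  · exact hin p hp q hq
  · by_cases hs : R.refl (R.α i) p ∈ A
    · have := hmap _ hs _ hq'
      rwa [refl_sub, h.refl_refl hα] at this
    · have hpos := coroot_pos_of_notMem hA (h.simple_pos i) hp hs
      by_cases hs' : R.refl (R.α i) q' ∈ A
      · exact hin p hp _ hs'
      · have hc := coroot_pos_of_notMem hA (h.simple_pos i) hq' hs'
        have heq : R.refl (R.α i) q' - p = (q' - p) + R.coroot (R.α i) q' • (-R.α i) := by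
          rw [refl]
          module
        rw [heq]
        refine add_mem (hin p hp q' hq') (AddSubmonoid.subset_closure
          ⟨_, hc.le, -R.α i, h.neg_root_mem hα, Or.inr ⟨p, hp, ?_⟩, ?_, rfl⟩)
        · rw [refl, refl, h.coroot_neg_root hα]
          module
        · rw [h.coroot_neg_root hα]
          linarith
  · by_cases hs : R.refl (R.α i) q ∈ A
    · have := hmap _ hp' _ hs
      rwa [refl_sub, h.refl_refl hα] at this
    · by_cases hs' : R.refl (R.α i) p' ∈ A
      · exact hin _ hs' q hq
      · have hc := coroot_pos_of_notMem hA (h.simple_pos i) hq hs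
        have hpos := coroot_pos_of_notMem hA (h.simple_pos i) hp' hs'
        have heq : q - R.refl (R.α i) p' =
            R.refl (R.α i) (q - p') + R.coroot (R.α i) q • R.α i := by
          rw [refl_sub, refl, refl]
          module
        rw [heq]
        refine add_mem (hmap p' hp' q hq) (AddSubmonoid.subset_closure
          ⟨_, hc.le, R.α i, hα, Or.inl ?_, ?_, rfl⟩)
        · rwa [h.refl_refl hα]
        · rw [h.coroot_refl_self hα]
          linarith
  · rw [← refl_sub]
    exact hmap p' hp' q' hq'

/-- The convex hull of the points `uλ`, for `u` ranging over the subwords of a word, is generated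
at each of these points by the edges in the direction of roots. -/
theorem sub_mem_edgeCone (h : R.IsCrystallographic B) (hlam : R.Dominant lam)
    (l : List (Fin R.r)) : ∀ p ∈ R.subwordOrbit lam l, ∀ q ∈ R.subwordOrbit lam l,
      q - p ∈ R.edgeCone (R.subwordOrbit lam l) p := by
  induction l with
  | nil =>
    rintro p rfl q rfl
    rw [sub_self]
    exact zero_mem _
  | cons i l ih => exact h.sub_mem_edgeCone_union (h.isLower_subwordOrbit hlam l) ih i

theorem exists_pathModel (h : R.IsCrystallographic B) (hwt : R.IsWeight lam)
    (hlam : R.Dominant lam) (hfin : {v | R.Orbit lam v}.Finite) :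
    ∃ N, R.PathModel B lam N := by
  set g : R.V × Fin R.r → ℕ := fun x =>
    if R.pair x.2 x.1 = 0 then 1 else (R.pair x.2 x.1).natAbs with hg
  refine ⟨∏ x ∈ hfin.toFinset ×ˢ Finset.univ, g x, h, hwt, hlam, ?_, hfin, ?_⟩
  · refine Finset.prod_pos fun x _ => ?_
    by_cases hx : R.pair x.2 x.1 = 0
    · simp [hg, hx]
    · simp [hg, hx]
  · intro v hv i hi
    have h1 : g (v, i) ∣ ∏ x ∈ hfin.toFinset ×ˢ Finset.univ, g x :=
      Finset.dvd_prod_of_mem g (by simpa using hv)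
    have h2 : g (v, i) = (R.pair i v).natAbs := by simp [hg, hi]
    rw [h2] at h1
    rwa [← Int.natAbs_dvd, Int.natCast_dvd_natCast]

theorem isWeight_of_sub_mem (h : R.IsCrystallographic B) (hwt : R.IsWeight lam) {mu : R.V}
    (hmu : mu - lam ∈ R.rootLattice) : R.IsWeight mu := by
  intro β hβ
  have h1 : ∀ v ∈ R.rootLattice, ∃ m : ℤ, R.coroot β v = m := by
    intro v hv
    induction hv using AddSubgroup.closure_induction with
    | mem x hx => exact h.integral β hβ x hx
    | zero => exact ⟨0, by simp⟩
    | add x y _ _ hx hy =>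
      obtain ⟨a, ha⟩ := hx
      obtain ⟨b, hb⟩ := hy
      exact ⟨a + b, by rw [map_add, ha, hb]; push_cast; rfl⟩
    | neg x _ hx =>
      obtain ⟨a, ha⟩ := hx
      exact ⟨-a, by rw [map_neg, ha]; push_cast; rfl⟩
  obtain ⟨a, ha⟩ := h1 _ hmu
  obtain ⟨b, hb⟩ := hwt β hβ
  refine ⟨a + b, ?_⟩
  rw [map_sub, hb] at ha
  push_cast
  linarith

theorem refl_mem_convexHull_union (h : R.IsCrystallographic B) (A : Set R.V) (i : Fin R.r)
    {v : R.V} (hv : v ∈ convexHull ℚ (A ∪ R.refl (R.α i) '' A)) :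
    R.refl (R.α i) v ∈ convexHull ℚ (A ∪ R.refl (R.α i) '' A) := by
  have h1 : R.reflMap (R.α i) v ∈
      convexHull ℚ (R.reflMap (R.α i) '' (A ∪ R.refl (R.α i) '' A)) := by
    rw [← LinearMap.image_convexHull]
    exact ⟨v, hv, rfl⟩
  refine convexHull_mono ?_ h1
  rintro _ ⟨p, hp | ⟨q, hq, rfl⟩, rfl⟩
  · exact Or.inr ⟨p, hp, rfl⟩
  · refine Or.inl ?_
    have : R.reflMap (R.α i) (R.refl (R.α i) q) = q := h.refl_refl (h.simple_mem i) q
    rwa [this]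

theorem exists_add_smul_mem_convexHull (h : R.IsCrystallographic B) {A : Set R.V}
    (hA : R.IsLower A) (i : Fin R.r) {v : R.V}
    (hv : v ∈ convexHull ℚ (A ∪ R.refl (R.α i) '' A)) :
    ∃ t : ℚ, 0 ≤ t ∧ v + t • R.α i ∈ convexHull ℚ A := by
  refine convexHull_min ?_ ((convex_convexHull ℚ A).setOf_exists_add_smul_mem (R.α i)) hv
  have hmem : ∀ p ∈ A, ∃ t : ℚ, 0 ≤ t ∧ p + t • R.α i ∈ convexHull ℚ A := fun p hp =>
    ⟨0, le_rfl, by simpa using subset_convexHull ℚ A hp⟩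
  rintro p (hp | ⟨q, hq, rfl⟩)
  · exact hmem p hp
  · by_cases hs : R.refl (R.α i) q ∈ A
    · exact hmem _ hs
    · refine ⟨_, (coroot_pos_of_notMem hA (h.simple_pos i) hq hs).le, ?_⟩
      rw [refl, sub_add_cancel]
      exact subset_convexHull ℚ A hq

end IsCrystallographic

/-- The polytopes of subword orbits have the integer decomposition property along strings of
simple roots. -/
def HasIntegralStrings (R : RootData) (lam : R.V) : Prop :=
  ∀ (l : List (Fin R.r)) (i : Fin R.r) (mu : R.V) (t : ℚ), 0 ≤ t → mu - lam ∈ R.rootLattice →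
    mu + t • R.α i ∈ convexHull ℚ (R.subwordOrbit lam l) →
    ∃ n : ℕ, mu + (n : ℚ) • R.α i ∈ convexHull ℚ (R.subwordOrbit lam l)

theorem PathModel.exists_path {N : ℕ} (M : R.PathModel B lam N) (hstr : R.HasIntegralStrings lam)
    (l : List (Fin R.r)) : ∀ mu : R.V, mu - lam ∈ R.rootLattice →
      mu ∈ convexHull ℚ (R.subwordOrbit lam l) →
      ∃ d, R.IsPath lam N d ∧ d 0 ∈ R.subwordOrbit lam l ∧ R.pathWt N d = mu := by
  induction l with
  | nil =>
    intro mu _ hmu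
    rw [subwordOrbit, convexHull_singleton] at hmu
    rw [Set.mem_singleton_iff.1 hmu]
    exact ⟨fun _ => lam, isPath_const lam N, rfl, M.pathWt_const⟩
  | cons i l ih =>
    intro mu hQ hmu
    have hα := M.crys.simple_mem i
    have hαQ : ∀ n : ℕ, (n : ℚ) • R.α i ∈ R.rootLattice := fun n => by
      rw [Nat.cast_smul_eq_nsmul]
      exact nsmul_mem (AddSubgroup.subset_closure hα) n
    obtain ⟨a, hνmem, hνc⟩ : ∃ a : ℕ,
        mu + (a : ℚ) • R.α i ∈ convexHull ℚ (R.subwordOrbit lam (i :: l)) ∧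
        (a : ℚ) ≤ R.coroot (R.α i) (mu + (a : ℚ) • R.α i) := by
      obtain ⟨m, hm⟩ := M.crys.isWeight_of_sub_mem M.isWeight hQ _ hα
      rcases le_total 0 m with h0 | h0
      · refine ⟨0, by simpa using hmu, ?_⟩
        simp only [Nat.cast_zero, zero_smul, add_zero, hm]
        exact_mod_cast h0
      · obtain ⟨a, ha⟩ := Int.exists_eq_neg_ofNat h0
        have ham : R.coroot (R.α i) mu = -(a : ℚ) := by rw [hm, ha]; simp
        refine ⟨a, ?_, ?_⟩
        · have := M.crys.refl_mem_convexHull_union _ i hmu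
          rwa [refl, ham, neg_smul, sub_neg_eq_add] at this
        · rw [map_add, map_smul, M.crys.coroot_self hα, ham, smul_eq_mul]
          linarith
    obtain ⟨t, ht, htmem⟩ := M.crys.exists_add_smul_mem_convexHull
      (M.crys.isLower_subwordOrbit M.dominant l) i hνmem
    have hνQ : mu + (a : ℚ) • R.α i - lam ∈ R.rootLattice := by
      rw [add_sub_right_comm]
      exact add_mem hQ (hαQ a)
    obtain ⟨n, hn⟩ := hstr l i _ t ht hνQ htmem
    obtain ⟨d, hd, hd0, hdw⟩ := ih _ (by
      rw [add_sub_right_comm]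
      exact add_mem hνQ (hαQ n)) hn
    have hphi : n + a ≤ R.phi N i d := by
      have h1 := M.coroot_pathWt hd i
      rw [hdw, map_add, map_smul, M.crys.coroot_self hα, smul_eq_mul] at h1
      have h2 : (0 : ℚ) ≤ R.eps N i d := Nat.cast_nonneg _
      have h3 : (0 : ℚ) ≤ n := Nat.cast_nonneg _
      have : ((n + a : ℕ) : ℚ) ≤ R.phi N i d := by
        push_cast
        linarith
      exact_mod_cast this
    obtain ⟨h1, h2, -, h4⟩ := M.pathWt_iterate_lowerOp hd i (n + a) hphi
    refine ⟨_, h1, ?_, ?_⟩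
    · rcases h4 with h4 | h4
      · rw [h4]
        exact Or.inl hd0
      · rw [h4]
        exact Or.inr ⟨_, hd0, rfl⟩
    · rw [h2, hdw]
      push_cast
      module

/-- Demazure characters are saturated as soon as strings of simple roots meet the polytopes of
subword orbits in lattice points. -/
theorem IsCrystallographic.demChar_pos (h : R.IsCrystallographic B) (hwt : R.IsWeight lam)
    (hlam : R.Dominant lam) (hfin : {v | R.Orbit lam v}.Finite) (hstr : R.HasIntegralStrings lam)
    (l : List (Fin R.r)) {mu : R.V} (hQ : lam - mu ∈ R.rootLattice)
    (hmu : mu ∈ R.demPolytope lam (R.wordProd l)) : 0 < R.demChar l lam mu := by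
  obtain ⟨N, M⟩ := h.exists_pathModel hwt hlam hfin
  have hQ' : mu - lam ∈ R.rootLattice := by
    rw [← neg_sub]
    exact neg_mem hQ
  obtain ⟨d, hd, hd0, rfl⟩ := M.exists_path hstr l mu hQ' (h.demPolytope_subset hlam l hmu)
  exact M.demChar_pos l hd hd0

end RootData

section Threshold

variable {ι : Type*} [Fintype ι]

/-- A nondecreasing odd function `ℚ → ℚ`. -/
structure IsOddMono (φ : ℚ → ℚ) : Prop where
  odd : ∀ x, φ (-x) = -φ x
  mono : Monotone φ

theorem IsOddMono.zero {φ : ℚ → ℚ} (h : IsOddMono φ) : φ 0 = 0 := by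
  have := h.odd 0
  rw [neg_zero] at this
  linarith

theorem IsOddMono.comp {φ ψ : ℚ → ℚ} (h : IsOddMono φ) (h' : IsOddMono ψ) :
    IsOddMono (φ ∘ ψ) :=
  ⟨fun x => by simp only [Function.comp_apply, h'.odd, h.odd], h.mono.comp h'.mono⟩

theorem isOddMono_sign : IsOddMono fun x => ((SignType.sign x : SignType) : ℚ) := by
  refine ⟨fun x => by rw [Left.sign_neg]; simp, fun x y hxy => ?_⟩
  have h1 : SignType.sign x ≤ SignType.sign y := OrderHom.monotone SignType.sign hxy
  revert h1
  generalize SignType.sign x = a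
  generalize SignType.sign y = b
  intro h1
  cases a <;> cases b <;> simp at *

/-- Soft thresholding at `θ`. -/
def softThreshold (θ x : ℚ) : ℚ := max (x - θ) 0 + min (x + θ) 0

theorem isOddMono_softThreshold (θ : ℚ) : IsOddMono (softThreshold θ) := by
  refine ⟨fun x => ?_, fun x y hxy => ?_⟩
  · have h1 : max (-x - θ) 0 = -min (x + θ) 0 := by
      rw [← max_neg_neg]
      congr 1
      ring
    have h2 : min (-x + θ) 0 = -max (x - θ) 0 := by
      rw [← min_neg_neg]
      congr 1
      ring
    rw [softThreshold, softThreshold, h1, h2]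
    ring
  · exact add_le_add (max_le_max (by linarith) le_rfl) (min_le_min (by linarith) le_rfl)

theorem sign_add_softThreshold {θ x : ℚ} (hθ : 0 < θ) (hx : x = 0 ∨ θ ≤ |x|) :
    θ * ((SignType.sign x : SignType) : ℚ) + softThreshold θ x = x := by
  rcases hx with rfl | hx
  · simp [softThreshold, hθ.le]
  · rcases lt_trichotomy x 0 with h0 | rfl | h0
    · rw [abs_of_neg h0] at hx
      rw [sign_neg h0, softThreshold, max_eq_right (by linarith), min_eq_left (by linarith)]
      simp
    · simp at hx
      linarith
    · rw [abs_of_pos h0] at hx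
      rw [sign_pos h0, softThreshold, max_eq_left (by linarith), min_eq_right (by linarith)]
      simp

/-- A vector is a nonnegative combination of the sign vectors obtained from it by odd monotone
functions. -/
theorem dotProduct_nonneg_of_isOddMono (u : ι → ℚ) (n : ℕ) : ∀ w : ι → ℚ,
    (Finset.univ.filter fun a => w a ≠ 0).card ≤ n →
    (∀ φ : ℚ → ℚ, IsOddMono φ → (∀ x, φ x = 0 ∨ φ x = 1 ∨ φ x = -1) → 0 ≤ (φ ∘ w) ⬝ᵥ u) →
    0 ≤ w ⬝ᵥ u := by
  have hzero : ∀ w : ι → ℚ, (Finset.univ.filter fun a => w a ≠ 0) = ∅ → 0 ≤ w ⬝ᵥ u := by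
    intro w hw
    have : w = 0 := by
      funext a
      by_contra ha
      have : a ∈ (Finset.univ.filter fun a => w a ≠ 0) := by simpa using ha
      rw [hw] at this
      simp at this
    simp [this]
  induction n with
  | zero => exact fun w hw _ => hzero w (Finset.card_eq_zero.1 (Nat.le_zero.1 hw))
  | succ n ih =>
    intro w hw hφ
    rcases (Finset.univ.filter fun a => w a ≠ 0).eq_empty_or_nonempty with he | hne
    · exact hzero w he
    obtain ⟨a₀, ha₀, hmin⟩ := Finset.exists_min_image _ (fun a => |w a|) hne
    simp only [Finset.mem_filter, Finset.mem_univ, true_and] at ha₀ hmin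
    set θ := |w a₀| with hθ
    have hθ0 : 0 < θ := abs_pos.2 ha₀
    have hdec : w = θ • ((fun x => ((SignType.sign x : SignType) : ℚ)) ∘ w) +
        softThreshold θ ∘ w := by
      funext a
      have : w a = 0 ∨ θ ≤ |w a| := by
        by_cases ha : w a = 0
        · exact Or.inl ha
        · exact Or.inr (hmin a ha)
      exact (sign_add_softThreshold hθ0 this).symm
    have hsign : 0 ≤ ((fun x => ((SignType.sign x : SignType) : ℚ)) ∘ w) ⬝ᵥ u := by
      refine hφ _ isOddMono_sign fun x => ?_
      generalize SignType.sign x = b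
      cases b <;> simp
    have hsoft : 0 ≤ (softThreshold θ ∘ w) ⬝ᵥ u := by
      refine ih _ ?_ fun φ h1 h2 => hφ (φ ∘ softThreshold θ)
        (h1.comp (isOddMono_softThreshold θ)) fun x => h2 _
      refine Nat.le_of_lt_succ (lt_of_lt_of_le (Finset.card_lt_card ?_) hw)
      refine Finset.ssubset_iff_subset_ne.2 ⟨fun a ha => ?_, fun heq => ?_⟩
      · simp only [Finset.mem_filter, Finset.mem_univ, true_and, Function.comp_apply] at ha ⊢
        intro h0
        rw [h0, (isOddMono_softThreshold θ).zero] at ha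
        exact ha rfl
      · have : a₀ ∈ Finset.univ.filter fun a => w a ≠ 0 := by simpa using ha₀
        rw [← heq] at this
        simp only [Finset.mem_filter, Finset.mem_univ, true_and, Function.comp_apply] at this
        refine this ?_
        have h1 := sign_add_softThreshold hθ0 (Or.inr (le_refl θ) : w a₀ = 0 ∨ θ ≤ |w a₀|)
        rcases lt_or_gt_of_ne ha₀ with h0 | h0
        · rw [sign_neg h0, hθ, abs_of_neg h0] at h1
          simp at h1
          rw [hθ, abs_of_neg h0]
          linarith
        · rw [sign_pos h0, hθ, abs_of_pos h0] at h1
          simp at h1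
          rw [hθ, abs_of_pos h0]
          linarith
    rw [hdec, add_dotProduct, smul_dotProduct, smul_eq_mul]
    positivity

end Threshold

section ClassicalPolytope

variable {r : ℕ}

/-- The edge directions of a point `p` of `A`. -/
def IsEdge (Φ A : Set (Fin r → ℚ)) (p β : Fin r → ℚ) : Prop :=
  β ∈ Φ ∧ β ⬝ᵥ p < 0 ∧ p - (2 * (β ⬝ᵥ p) / (β ⬝ᵥ β)) • β ∈ A

/-- The properties of the vertex set `A` of a Demazure polytope of classical type. -/
structure IsClassicalVertexSet (Φ pos A : Set (Fin r → ℚ)) : Prop where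
  finite : A.Finite
  nonempty : A.Nonempty
  shape : ∀ β ∈ Φ, (∃ a k, k ≠ 0 ∧ β = Pi.single a k) ∨ ∃ a b, ∃ σ τ : ℚ, a ≠ b ∧
    (σ = 1 ∨ σ = -1) ∧ (τ = 1 ∨ τ = -1) ∧ β = Pi.single a σ + Pi.single b τ
  pos_subset : pos ⊆ Φ
  sub_mem_pos : ∀ a b : Fin r, a < b → Pi.single a 1 - Pi.single b 1 ∈ pos
  add_mem_pos : ∀ a b : Fin r, a < b → Pi.single a 1 + Pi.single b 1 ∈ pos
  edge : ∀ p ∈ A, ∀ q ∈ A, q - p ∈ AddSubmonoid.closure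
    {v | ∃ c : ℚ, 0 ≤ c ∧ ∃ β, IsEdge Φ A p β ∧ v = c • β}
  lower : ∀ p ∈ A, ∀ β ∈ pos, β ⬝ᵥ p < 0 → p - (2 * (β ⬝ᵥ p) / (β ⬝ᵥ β)) • β ∈ A

/-- A vector with entries in `{0, 1, -1}`. -/
def IsSignVector (v : Fin r → ℚ) : Prop := ∀ a, v a = 0 ∨ v a = 1 ∨ v a = -1

namespace IsClassicalVertexSet

variable {Φ pos A : Set (Fin r → ℚ)}

theorem root_ne_zero (E : IsClassicalVertexSet Φ pos A) {β : Fin r → ℚ} (hβ : β ∈ Φ) :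
    0 < β ⬝ᵥ β := by
  refine lt_of_le_of_ne (Finset.sum_nonneg fun a _ => mul_self_nonneg (β a)) fun h0 => ?_
  have h1 := dotProduct_self_eq_zero.1 h0.symm
  rcases E.shape β hβ with ⟨a, k, hk, rfl⟩ | ⟨a, b, σ, τ, hab, hσ, hτ, rfl⟩
  · exact hk (by simpa using congrFun h1 a)
  · have := congrFun h1 a
    rw [Pi.add_apply, Pi.single_eq_same, Pi.single_eq_of_ne hab] at this
    rcases hσ with rfl | rfl <;> simp at this

theorem dotProduct_edge_nonneg (E : IsClassicalVertexSet Φ pos A) {w p β : Fin r → ℚ}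
    (hmin : ∀ q ∈ A, w ⬝ᵥ p ≤ w ⬝ᵥ q) (hβ : IsEdge Φ A p β) : 0 ≤ w ⬝ᵥ β := by
  have h1 := hmin _ hβ.2.2
  have h2 := E.root_ne_zero hβ.1
  have h3 : 2 * (β ⬝ᵥ p) / (β ⬝ᵥ β) < 0 := div_neg_of_neg_of_pos (by linarith [hβ.2.1]) h2
  rw [dotProduct_sub, dotProduct_smul, smul_eq_mul] at h1
  by_contra! h4
  nlinarith

theorem root_nonneg_of_isOddMono (E : IsClassicalVertexSet Φ pos A) {φ : ℚ → ℚ}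
    (hφ : IsOddMono φ) {w β : Fin r → ℚ} (hβ : β ∈ Φ) (h0 : 0 ≤ w ⬝ᵥ β) :
    0 ≤ (φ ∘ w) ⬝ᵥ β := by
  rcases E.shape β hβ with ⟨a, k, hk, rfl⟩ | ⟨a, b, σ, τ, -, hσ, hτ, rfl⟩
  · simp only [dotProduct_single, Function.comp_apply] at h0 ⊢
    rcases lt_or_gt_of_ne hk with hk | hk
    · have := hφ.mono (show w a ≤ 0 by nlinarith)
      rw [hφ.zero] at this
      nlinarith
    · have := hφ.mono (show 0 ≤ w a by nlinarith)
      rw [hφ.zero] at this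
      nlinarith
  · simp only [dotProduct_add, dotProduct_single, Function.comp_apply] at h0 ⊢
    have hs : ∀ x y : ℚ, (y = 1 ∨ y = -1) → φ x * y = φ (x * y) := by
      rintro x y (rfl | rfl)
      · simp
      · simp [hφ.odd]
    rw [hs _ _ hσ, hs _ _ hτ]
    have := hφ.mono (show -(w a * σ) ≤ w b * τ by linarith)
    rw [hφ.odd] at this
    linarith

/-- The facets of a classical Demazure polytope have normal vectors with entries in
`{0, 1, -1}`. -/
theorem exists_isSignVector (E : IsClassicalVertexSet Φ pos A) {y : Fin r → ℚ}
    (hy : y ∉ convexHull ℚ A) :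
    ∃ v, IsSignVector v ∧ ∀ p ∈ A, v ⬝ᵥ y < v ⬝ᵥ p := by
  obtain ⟨f, hf⟩ := exists_separating_of_notMem_convexHull E.finite hy
  set w : Fin r → ℚ := fun a => f (Pi.single a 1) with hw
  have hfw : ∀ x, f x = w ⬝ᵥ x := by
    intro x
    conv_lhs => rw [pi_eq_sum_univ' x, map_sum]
    refine Finset.sum_congr rfl fun a _ => ?_
    rw [map_smul, smul_eq_mul, mul_comm]
  obtain ⟨p₀, hp₀, hmin⟩ := Set.exists_min_image A (fun p => w ⬝ᵥ p) E.finite E.nonempty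
  by_contra! hcon
  have hnn : 0 ≤ w ⬝ᵥ (y - p₀) := by
    refine dotProduct_nonneg_of_isOddMono _ _ w le_rfl fun φ hφ hφ' => ?_
    obtain ⟨q, hq, hqy⟩ := hcon (φ ∘ w) fun a => hφ' (w a)
    have hc : 0 ≤ (φ ∘ w) ⬝ᵥ (q - p₀) := by
      have hmem := E.edge p₀ hp₀ q hq
      generalize q - p₀ = z at hmem
      induction hmem using AddSubmonoid.closure_induction with
      | mem x hx =>
        obtain ⟨c, hc, β, hβ, rfl⟩ := hx
        rw [dotProduct_smul, smul_eq_mul]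
        exact mul_nonneg hc (E.root_nonneg_of_isOddMono hφ hβ.1
          (E.dotProduct_edge_nonneg hmin hβ))
      | zero => simp
      | add x y _ _ hx hy =>
        rw [dotProduct_add]
        exact add_nonneg hx hy
    rw [dotProduct_sub] at hc ⊢
    linarith
  have := hf p₀ hp₀
  rw [hfw, hfw] at this
  rw [dotProduct_sub] at hnn
  linarith

end IsClassicalVertexSet

/-- The configuration of two opposite facets meeting the string `mu + ℚ α` in a single half
integral point. -/
structure IsTightPair (A : Set (Fin r → ℚ)) (mu α : Fin r → ℚ) (n : ℕ) (v w : Fin r → ℚ) :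
    Prop where
  left_sign : IsSignVector v
  right_sign : IsSignVector w
  left_eq : v ⬝ᵥ α = 2
  right_eq : w ⬝ᵥ α = -2
  mem : mu + (n + 1 / 2 : ℚ) • α ∈ convexHull ℚ A
  left_le : ∀ p ∈ A, v ⬝ᵥ (mu + (n + 1 / 2 : ℚ) • α) ≤ v ⬝ᵥ p
  right_le : ∀ p ∈ A, w ⬝ᵥ (mu + (n + 1 / 2 : ℚ) • α) ≤ w ⬝ᵥ p

theorem exists_le_of_mem_convexHull {A : Set (Fin r → ℚ)} {x : Fin r → ℚ}
    (hx : x ∈ convexHull ℚ A) (v : Fin r → ℚ) : ∃ p ∈ A, v ⬝ᵥ p ≤ v ⬝ᵥ x := by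
  by_contra! h
  have hconv : Convex ℚ {z | v ⬝ᵥ x < v ⬝ᵥ z} := by
    refine convex_halfSpace_gt ⟨fun y z => dotProduct_add v y z, fun c z => ?_⟩ _
    rw [dotProduct_smul]
  have hx' : x ∈ {z | v ⬝ᵥ x < v ⬝ᵥ z} := convexHull_min (fun p hp => h p hp) hconv hx
  exact lt_irrefl (v ⬝ᵥ x) hx'

theorem IsSignVector.exists_int_dotProduct {v d : Fin r → ℚ} (hv : IsSignVector v)
    (hd : ∀ a, ∃ m : ℤ, d a = m) : ∃ m : ℤ, v ⬝ᵥ d = m := by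
  choose δ hδ using hd
  have hv' : ∀ a, ∃ m : ℤ, v a = m := fun a => by
    rcases hv a with h | h | h
    · exact ⟨0, by simp [h]⟩
    · exact ⟨1, by simp [h]⟩
    · exact ⟨-1, by simp [h]⟩
  choose ν hν using hv'
  exact ⟨∑ a, ν a * δ a, by simp [dotProduct, hν, hδ]⟩

theorem IsClassicalVertexSet.exists_isTightPair {Φ pos A : Set (Fin r → ℚ)}
    (E : IsClassicalVertexSet Φ pos A) {mu α : Fin r → ℚ} (hα : ∀ a, ∃ m : ℤ, α a = m)
    (hα2 : ∀ v, IsSignVector v → |v ⬝ᵥ α| ≤ 2)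
    (hA : ∀ p ∈ A, ∀ a, ∃ m : ℤ, (p - mu) a = m) {t : ℚ} (ht : 0 ≤ t)
    (hmem : mu + t • α ∈ convexHull ℚ A) (hn : ∀ n : ℕ, mu + (n : ℚ) • α ∉ convexHull ℚ A) :
    ∃ n v w, IsTightPair A mu α n v w := by
  obtain ⟨v, hv, hv'⟩ := E.exists_isSignVector (hn ⌊t⌋₊)
  obtain ⟨w, hw, hw'⟩ := E.exists_isSignVector (hn (⌊t⌋₊ + 1))
  set n := ⌊t⌋₊
  have hnt : (n : ℚ) ≤ t := Nat.floor_le ht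
  have htn : t < n + 1 := Nat.lt_floor_add_one t
  have key : ∀ u : Fin r → ℚ, IsSignVector u → ∀ k : ℕ,
      (∀ p ∈ A, u ⬝ᵥ (mu + (k : ℚ) • α) < u ⬝ᵥ p) →
      ∀ p ∈ A, u ⬝ᵥ mu + k * (u ⬝ᵥ α) + 1 ≤ u ⬝ᵥ p := by
    intro u hu k hk p hp
    obtain ⟨x, hx⟩ := hu.exists_int_dotProduct (hA p hp)
    obtain ⟨y, hy⟩ := hu.exists_int_dotProduct hα
    have h1 := hk p hp
    rw [dotProduct_sub] at hx
    rw [dotProduct_add, dotProduct_smul, smul_eq_mul, hy] at h1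
    have h2 : ((k * y : ℤ) : ℚ) < x := by push_cast; linarith
    have h3 : k * y + 1 ≤ x := by exact_mod_cast h2
    have h4 : ((k * y + 1 : ℤ) : ℚ) ≤ x := by exact_mod_cast h3
    push_cast at h4
    rw [hy]
    linarith
  have hv1 := key v hv n hv'
  have hw1 := key w hw (n + 1) hw'
  push_cast at hw1
  obtain ⟨p, hp, hpv⟩ := exists_le_of_mem_convexHull hmem v
  obtain ⟨q, hq, hqw⟩ := exists_le_of_mem_convexHull hmem w
  have hv2 := hv1 p hp
  have hw2 := hw1 q hq
  rw [dotProduct_add, dotProduct_smul, smul_eq_mul] at hpv hqw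
  have hva := abs_le.1 (hα2 v hv)
  have hwa := abs_le.1 (hα2 w hw)
  obtain ⟨y, hy⟩ := hv.exists_int_dotProduct hα
  obtain ⟨z, hz⟩ := hw.exists_int_dotProduct hα
  have hy2 : v ⬝ᵥ α = 2 := by
    have h1 : 1 < v ⬝ᵥ α := by nlinarith
    rw [hy] at h1 hva ⊢
    have h2 : 1 < y := by exact_mod_cast h1
    have h3 : y ≤ 2 := by exact_mod_cast hva.2
    have : y = 2 := by omega
    rw [this]; norm_num
  rw [hy2] at hv1 hv2 hpv
  have hz2 : w ⬝ᵥ α = -2 := by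
    have h1 : w ⬝ᵥ α ≤ -2 := by
      by_contra! h
      nlinarith
    linarith [hwa.1]
  rw [hz2] at hw1 hw2 hqw
  have htt : t = n + 1 / 2 := by linarith
  refine ⟨n, v, w, hv, hw, hy2, hz2, htt ▸ hmem, fun p hp => ?_, fun p hp => ?_⟩
  · have := hv1 p hp
    rw [dotProduct_add, dotProduct_smul, smul_eq_mul, hy2]
    linarith
  · have := hw1 p hp
    rw [dotProduct_add, dotProduct_smul, smul_eq_mul, hz2]
    linarith

end ClassicalPolytope

section TightPair

variable {r : ℕ} {Φ pos A : Set (Fin r → ℚ)} {mu α v w : Fin r → ℚ} {n : ℕ}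

namespace IsTightPair

/-- The points of `A` on both facets. -/
def IsTight (A : Set (Fin r → ℚ)) (v w x p : Fin r → ℚ) : Prop :=
  p ∈ A ∧ v ⬝ᵥ p = v ⬝ᵥ x ∧ w ⬝ᵥ p = w ⬝ᵥ x

theorem exists_isTight (T : IsTightPair A mu α n v w) :
    ∃ p, IsTight A v w (mu + (n + 1 / 2 : ℚ) • α) p := by
  obtain ⟨p, hp, h⟩ := exists_le_of_mem_convexHull T.mem (v + w)
  have h1 := T.left_le p hp
  have h2 := T.right_le p hp
  rw [add_dotProduct, add_dotProduct] at h
  exact ⟨p, hp, by linarith, by linarith⟩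

/-- The reflection along an edge orthogonal to both facet normals preserves tightness. -/
theorem isTight_edge {x p β : Fin r → ℚ} (hp : IsTight A v w x p) (hβ : IsEdge Φ A p β)
    (hv : v ⬝ᵥ β = 0) (hw : w ⬝ᵥ β = 0) :
    IsTight A v w x (p - (2 * (β ⬝ᵥ p) / (β ⬝ᵥ β)) • β) := by
  refine ⟨hβ.2.2, ?_, ?_⟩
  · rw [dotProduct_sub, dotProduct_smul, hv, hp.2.1]
    simp
  · rw [dotProduct_sub, dotProduct_smul, hw, hp.2.2]
    simp

theorem root_nonneg (E : IsClassicalVertexSet Φ pos A) (T : IsTightPair A mu α n v w)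
    {p β : Fin r → ℚ} (hp : IsTight A v w (mu + (n + 1 / 2 : ℚ) • α) p) (hβ : β ∈ pos)
    (hneg : v ⬝ᵥ β < 0 ∨ w ⬝ᵥ β < 0) : 0 ≤ β ⬝ᵥ p := by
  by_contra! h
  have h1 := E.lower p hp.1 β hβ h
  have he : IsEdge Φ A p β := ⟨E.pos_subset hβ, h, h1⟩
  have h2 := E.dotProduct_edge_nonneg (w := v) (fun q hq => hp.2.1.trans_le (T.left_le q hq)) he
  have h3 := E.dotProduct_edge_nonneg (w := w) (fun q hq => hp.2.2.trans_le (T.right_le q hq)) he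
  rcases hneg with hneg | hneg <;> linarith

/-- A functional vanishing on the edges orthogonal to both facet normals is constant on the common
face. -/
theorem dotProduct_eq (E : IsClassicalVertexSet Φ pos A) (T : IsTightPair A mu α n v w)
    {p L : Fin r → ℚ} (hp : IsTight A v w (mu + (n + 1 / 2 : ℚ) • α) p)
    (hL : ∀ β, IsEdge Φ A p β → v ⬝ᵥ β = 0 → w ⬝ᵥ β = 0 → L ⬝ᵥ β = 0) :
    L ⬝ᵥ (p - mu) = (n + 1 / 2) * (L ⬝ᵥ α) := by
  have hcone : ∀ z ∈ AddSubmonoid.closure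
      {v | ∃ c : ℚ, 0 ≤ c ∧ ∃ β, IsEdge Φ A p β ∧ v = c • β},
      0 ≤ v ⬝ᵥ z ∧ 0 ≤ w ⬝ᵥ z ∧ (v ⬝ᵥ z = 0 → w ⬝ᵥ z = 0 → L ⬝ᵥ z = 0) := by
    intro z hz
    induction hz using AddSubmonoid.closure_induction with
    | mem x hx =>
      obtain ⟨c, hc, β, hβ, rfl⟩ := hx
      have h2 := E.dotProduct_edge_nonneg (w := v)
        (fun q hq => hp.2.1.trans_le (T.left_le q hq)) hβ
      have h3 := E.dotProduct_edge_nonneg (w := w)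
        (fun q hq => hp.2.2.trans_le (T.right_le q hq)) hβ
      simp only [dotProduct_smul, smul_eq_mul]
      refine ⟨mul_nonneg hc h2, mul_nonneg hc h3, fun h4 h5 => ?_⟩
      rcases hc.eq_or_lt with rfl | hc
      · simp
      · rw [hL β hβ ((mul_eq_zero.1 h4).resolve_left hc.ne')
          ((mul_eq_zero.1 h5).resolve_left hc.ne'), mul_zero]
    | zero => simp
    | add x y _ _ hx hy =>
      simp only [dotProduct_add]
      refine ⟨add_nonneg hx.1 hy.1, add_nonneg hx.2.1 hy.2.1, fun h1 h2 => ?_⟩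
      rw [hx.2.2 (by linarith [hx.1, hy.1]) (by linarith [hx.2.1, hy.2.1]),
        hy.2.2 (by linarith [hx.1, hy.1]) (by linarith [hx.2.1, hy.2.1]), add_zero]
  set C : Set (Fin r → ℚ) := {x | 0 ≤ v ⬝ᵥ (x - p) ∧ 0 ≤ w ⬝ᵥ (x - p) ∧
    (v ⬝ᵥ (x - p) = 0 → w ⬝ᵥ (x - p) = 0 → L ⬝ᵥ (x - p) = 0)} with hC
  have hconv : Convex ℚ C := by
    intro x hx y hy b c hb hc hbc
    have heq : b • x + c • y - p = b • (x - p) + c • (y - p) := by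
      rw [eq_sub_of_add_eq' hbc]
      module
    change 0 ≤ v ⬝ᵥ _ ∧ 0 ≤ w ⬝ᵥ _ ∧ (v ⬝ᵥ _ = 0 → w ⬝ᵥ _ = 0 → L ⬝ᵥ _ = 0)
    simp only [heq, dotProduct_add, dotProduct_smul, smul_eq_mul]
    have h1 := mul_nonneg hb hx.1
    have h2 := mul_nonneg hc hy.1
    have h3 := mul_nonneg hb hx.2.1
    have h4 := mul_nonneg hc hy.2.1
    refine ⟨by linarith, by linarith, fun h5 h6 => ?_⟩
    have hterm : ∀ d : ℚ, ∀ z, (d * (v ⬝ᵥ (z - p)) = 0) → (d * (w ⬝ᵥ (z - p)) = 0) →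
        (v ⬝ᵥ (z - p) = 0 → w ⬝ᵥ (z - p) = 0 → L ⬝ᵥ (z - p) = 0) → d * (L ⬝ᵥ (z - p)) = 0 := by
      intro d z h7 h8 h9
      rcases eq_or_ne d 0 with rfl | hd
      · simp
      · rw [h9 ((mul_eq_zero.1 h7).resolve_left hd) ((mul_eq_zero.1 h8).resolve_left hd), mul_zero]
    rw [hterm b x (by linarith) (by linarith) hx.2.2, hterm c y (by linarith) (by linarith) hy.2.2,
      add_zero]
  have hmem : mu + (n + 1 / 2 : ℚ) • α ∈ C :=
    convexHull_min (fun q hq => hcone _ (E.edge p hp.1 q hq)) hconv T.mem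
  have h := hmem.2.2 (by rw [dotProduct_sub, hp.2.1, sub_self])
    (by rw [dotProduct_sub, hp.2.2, sub_self])
  rw [dotProduct_sub, dotProduct_add, dotProduct_smul, smul_eq_mul] at h
  rw [dotProduct_sub]
  linarith

/-- An edge `±(e_a + e_b)` orthogonal to both facet normals is impossible when the coordinates
`a` and `b` are nonnegative on the common face, and likewise for a multiple of `e_a`. -/
theorem false_of_edge_add {x p : Fin r → ℚ} {a b : Fin r} {σ : ℚ} (hσ : σ = 1 ∨ σ = -1)
    (hab : a ≠ b) (hp : IsTight A v w x p)
    (hβ : IsEdge Φ A p (Pi.single a σ + Pi.single b σ))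
    (hv : v ⬝ᵥ (Pi.single a σ + Pi.single b σ) = 0)
    (hw : w ⬝ᵥ (Pi.single a σ + Pi.single b σ) = 0)
    (ha : ∀ q, IsTight A v w x q → 0 ≤ q a) (hb : ∀ q, IsTight A v w x q → 0 ≤ q b) : False := by
  have hq := isTight_edge hp hβ hv hw
  have h1 := ha _ hq
  have h2 := hb _ hq
  have h3 := ha _ hp
  have h4 := hb _ hp
  have h5 := hβ.2.1
  have hσ2 : σ * σ = 1 := by rcases hσ with rfl | rfl <;> norm_num
  have hd : (Pi.single a σ + Pi.single b σ : Fin r → ℚ) ⬝ᵥ (Pi.single a σ + Pi.single b σ) = 2 := by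
    simp [dotProduct_add, hab, hab.symm]
    linarith
  have he : (Pi.single a σ + Pi.single b σ : Fin r → ℚ) ⬝ᵥ p = σ * (p a + p b) := by
    simp [add_dotProduct]
    ring
  rw [hd, he] at h1 h2
  rw [he] at h5
  simp [hab, hab.symm] at h1 h2
  rcases hσ with rfl | rfl <;> linarith

theorem false_of_edge_single {x p : Fin r → ℚ} {a : Fin r} {k : ℚ} (hk : k ≠ 0)
    (hp : IsTight A v w x p) (hβ : IsEdge Φ A p (Pi.single a k))
    (hv : v ⬝ᵥ (Pi.single a k) = 0) (hw : w ⬝ᵥ (Pi.single a k) = 0)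
    (ha : ∀ q, IsTight A v w x q → 0 ≤ q a) : False := by
  have h1 := ha _ (isTight_edge hp hβ hv hw)
  have h3 := ha _ hp
  have h5 := hβ.2.1
  simp at h1 h5
  have h6 : 2 * (k * p a) / (k * k) * k = 2 * p a := by field_simp
  rw [h6] at h1
  have : p a = 0 := by linarith
  simp [this] at h5

/-- The index sets on which the two facet normals are opposite, respectively both zero, match up
along roots orthogonal to both normals. -/
theorem mul_eq_of_dotProduct_eq_zero {u : Fin r → ℚ} {a b : Fin r} {σ τ : ℚ}
    (hσ : σ = 1 ∨ σ = -1) (hτ : τ = 1 ∨ τ = -1)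
    (hu : u ⬝ᵥ (Pi.single a σ + Pi.single b τ) = 0) : u b = -(σ * τ) * u a := by
  simp only [dotProduct_add, dotProduct_single] at hu
  rcases hσ with rfl | rfl <;> rcases hτ with rfl | rfl <;> linarith

/-- If the coordinates on which the facet normals are opposite are nonnegative on the common face,
then the half integral point cannot occur on a string in direction `e_i - e_j`. -/
theorem false_of_opposite_nonneg (E : IsClassicalVertexSet Φ pos A)
    (T : IsTightPair A mu α n v w) (hA : ∀ p ∈ A, ∀ a, ∃ m : ℤ, (p - mu) a = m) {i j : Fin r}
    (hα : α = Pi.single i 1 - Pi.single j 1)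
    (hK : ∀ p, IsTight A v w (mu + (n + 1 / 2 : ℚ) • α) p → ∀ a, v a ≠ 0 → w a = -v a →
      0 ≤ p a) : False := by
  obtain ⟨p, hp⟩ := T.exists_isTight
  have hv := T.left_eq
  have hw := T.right_eq
  simp only [hα, dotProduct_sub, dotProduct_single, mul_one] at hv hw
  have hvi : v i = 1 ∧ v j = -1 := by
    rcases T.left_sign i with h | h | h <;> rcases T.left_sign j with h' | h' | h' <;>
      rw [h, h'] at hv <;> norm_num at hv
    exact ⟨h, h'⟩
  have hwi : w i = -1 ∧ w j = 1 := by
    rcases T.right_sign i with h | h | h <;> rcases T.right_sign j with h' | h' | h' <;>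
      rw [h, h'] at hw <;> norm_num at hw
    exact ⟨h, h'⟩
  set L : Fin r → ℚ := fun a => if v a = 1 ∧ w a = -1 then 1 else 0 with hL
  have hLs : IsSignVector L := fun a => by
    by_cases h : v a = 1 ∧ w a = -1 <;> simp [hL, h]
  have hedge : ∀ β, IsEdge Φ A p β → v ⬝ᵥ β = 0 → w ⬝ᵥ β = 0 → L ⬝ᵥ β = 0 := by
    intro β hβ h1 h2
    rcases E.shape β hβ.1 with ⟨a, k, hk, rfl⟩ | ⟨a, b, σ, τ, hab, hσ, hτ, rfl⟩
    · simp only [dotProduct_single] at h1 ⊢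
      have : v a = 0 := (mul_eq_zero.1 h1).resolve_right hk
      simp [hL, this]
    · have h3 := mul_eq_of_dotProduct_eq_zero hσ hτ h1
      have h4 := mul_eq_of_dotProduct_eq_zero hσ hτ h2
      rcases eq_or_ne τ σ with rfl | hne
      · have hττ : τ * τ = 1 := by rcases hτ with rfl | rfl <;> norm_num
        rw [hττ] at h3 h4
        by_cases ho : v a ≠ 0 ∧ w a = -v a
        · refine (false_of_edge_add hσ hab hp hβ h1 h2 (fun q hq => hK q hq a ho.1 ho.2)
            fun q hq => hK q hq b ?_ ?_).elim
          · rw [h3]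
            simpa using ho.1
          · rw [h3, h4, ho.2]
            ring
        · have hLa : L a = 0 := by
            simp only [hL, ite_eq_right_iff]
            rintro ⟨h5, h6⟩
            exact absurd ⟨by simp [h5], by rw [h5, h6]⟩ ho
          have hLb : L b = 0 := by
            simp only [hL, ite_eq_right_iff]
            rintro ⟨h5, h6⟩
            refine absurd ⟨fun h7 => ?_, ?_⟩ ho
            · rw [h7, h5] at h3
              norm_num at h3
            · linarith
          simp [dotProduct_add, hLa, hLb]
      · have hτσ : τ = -σ := by
          rcases hσ with rfl | rfl <;> rcases hτ with rfl | rfl <;> simp at hne ⊢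
        have hσσ : σ * σ = 1 := by rcases hσ with rfl | rfl <;> norm_num
        rw [hτσ, show -(σ * -σ) = σ * σ by ring, hσσ, one_mul] at h3 h4
        have : L b = L a := by simp only [hL, h3, h4]
        simp [dotProduct_add, this, hτσ]
  have h := T.dotProduct_eq E hp hedge
  obtain ⟨m, hm⟩ := hLs.exists_int_dotProduct (hA p hp.1)
  have hLi : L i = 1 := by simp [hL, hvi, hwi]
  have hLj : L j = 0 := by
    simp only [hL, hvi.2]
    norm_num
  rw [hm, hα, dotProduct_sub, dotProduct_single, dotProduct_single, hLi, hLj] at h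
  have h' : ((2 * m : ℤ) : ℚ) = ((2 * n + 1 : ℤ) : ℚ) := by
    push_cast
    linarith
  have h'' : 2 * m = 2 * (n : ℤ) + 1 := by exact_mod_cast h'
  omega

/-- If the coordinates on which both facet normals vanish are nonnegative on the common face, then
the half integral point cannot occur for a lattice of vectors with even coordinate sum. -/
theorem false_of_zero_nonneg (E : IsClassicalVertexSet Φ pos A)
    (T : IsTightPair A mu α n v w) (hA : ∀ p ∈ A, ∀ a, ∃ m : ℤ, (p - mu) a = m)
    (heven : ∀ p ∈ A, ∃ m : ℤ, ∑ a, (p - mu) a = 2 * m)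
    (hα : ∀ a, α a ≠ 0 → v a ≠ 0)
    (hZ : ∀ p, IsTight A v w (mu + (n + 1 / 2 : ℚ) • α) p → ∀ a, v a = 0 → w a = 0 →
      0 ≤ p a) : False := by
  obtain ⟨p, hp⟩ := T.exists_isTight
  set L : Fin r → ℚ := fun a => if v a = 0 ∧ w a = 0 then 1 else 0 with hL
  set η : Fin r → ℚ := fun a => if v a = 0 then w a else v a with hη
  have hedgeL : ∀ β, IsEdge Φ A p β → v ⬝ᵥ β = 0 → w ⬝ᵥ β = 0 → L ⬝ᵥ β = 0 := by
    intro β hβ h1 h2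
    rcases E.shape β hβ.1 with ⟨a, k, hk, rfl⟩ | ⟨a, b, σ, τ, hab, hσ, hτ, rfl⟩
    · have h3 := h1
      have h4 := h2
      simp only [dotProduct_single] at h3 h4
      exact (false_of_edge_single hk hp hβ h1 h2 fun q hq => hZ q hq a
        ((mul_eq_zero.1 h3).resolve_right hk) ((mul_eq_zero.1 h4).resolve_right hk)).elim
    · have h3 := mul_eq_of_dotProduct_eq_zero hσ hτ h1
      have h4 := mul_eq_of_dotProduct_eq_zero hσ hτ h2
      have hστ : σ * τ ≠ 0 := by
        rcases hσ with rfl | rfl <;> rcases hτ with rfl | rfl <;> norm_num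
      have hLb : L b = L a := by simp [hL, h3, h4, hστ, -mul_eq_zero, mul_eq_zero_iff_left]
      rcases eq_or_ne τ σ with rfl | hne
      · by_cases hz : v a = 0 ∧ w a = 0
        · exact (false_of_edge_add hσ hab hp hβ h1 h2 (fun q hq => hZ q hq a hz.1 hz.2)
            fun q hq => hZ q hq b (by rw [h3, hz.1, mul_zero]) (by rw [h4, hz.2, mul_zero])).elim
        · have hLa : L a = 0 := by simp only [hL, if_neg hz]
          simp [dotProduct_add, hLb, hLa]
      · have hτσ : τ = -σ := by
          rcases hσ with rfl | rfl <;> rcases hτ with rfl | rfl <;> simp at hne ⊢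
        simp [dotProduct_add, hLb, hτσ]
  have hedgeη : ∀ β, IsEdge Φ A p β → v ⬝ᵥ β = 0 → w ⬝ᵥ β = 0 → η ⬝ᵥ β = 0 := by
    intro β hβ h1 h2
    rcases E.shape β hβ.1 with ⟨a, k, hk, rfl⟩ | ⟨a, b, σ, τ, hab, hσ, hτ, rfl⟩
    · simp only [dotProduct_single] at h1 h2 ⊢
      have h3 := (mul_eq_zero.1 h1).resolve_right hk
      have h4 := (mul_eq_zero.1 h2).resolve_right hk
      simp [hη, h3, h4]
    · have h3 := mul_eq_of_dotProduct_eq_zero hσ hτ h1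
      have h4 := mul_eq_of_dotProduct_eq_zero hσ hτ h2
      have hηb : η b = -(σ * τ) * η a := by
        by_cases h0 : v a = 0
        · have h0' : v b = 0 := by rw [h3, h0, mul_zero]
          simp only [hη, if_pos h0, if_pos h0', h4]
        · have h0' : v b ≠ 0 := by
            rw [h3]
            refine mul_ne_zero ?_ h0
            rcases hσ with rfl | rfl <;> rcases hτ with rfl | rfl <;> norm_num
          simp only [hη, if_neg h0, if_neg h0', h3]
      simp only [dotProduct_add, dotProduct_single, hηb]
      rcases hσ with rfl | rfl <;> rcases hτ with rfl | rfl <;> ring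
  have hLp := T.dotProduct_eq E hp hedgeL
  have hηp := T.dotProduct_eq E hp hedgeη
  have hLα : L ⬝ᵥ α = 0 := by
    refine Finset.sum_eq_zero fun a _ => ?_
    by_cases h0 : α a = 0
    · simp [h0]
    · simp [hL, hα a h0]
  have hηα : η ⬝ᵥ α = 2 := by
    rw [← T.left_eq]
    refine Finset.sum_congr rfl fun a _ => ?_
    by_cases h0 : α a = 0
    · simp [h0]
    · simp [hη, hα a h0]
  rw [hLα, mul_zero] at hLp
  rw [hηα] at hηp
  have hpar : ∀ a, ∃ m : ℤ, (p - mu) a - L a * (p - mu) a - η a * (p - mu) a = 2 * m := by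
    intro a
    obtain ⟨m, hm⟩ := hA p hp.1 a
    rw [hm]
    have hcase : (L a = 1 ∧ η a = 0) ∨ (L a = 0 ∧ (η a = 1 ∨ η a = -1)) := by
      rcases T.left_sign a with h | h | h <;> rcases T.right_sign a with h' | h' | h' <;>
        norm_num [hL, hη, h, h']
    rcases hcase with ⟨h1, h2⟩ | ⟨h1, h2 | h2⟩
    · exact ⟨0, by rw [h1, h2]; simp⟩
    · exact ⟨0, by rw [h1, h2]; simp⟩
    · exact ⟨m, by rw [h1, h2]; ring⟩
  choose f hf using hpar
  obtain ⟨m, hm⟩ := heven p hp.1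
  have hsum : ∑ a, (p - mu) a - L ⬝ᵥ (p - mu) - η ⬝ᵥ (p - mu) = 2 * ((∑ a, f a : ℤ) : ℚ) := by
    push_cast
    rw [Finset.mul_sum, dotProduct, dotProduct, ← Finset.sum_sub_distrib,
      ← Finset.sum_sub_distrib]
    exact Finset.sum_congr rfl fun a _ => hf a
  rw [hm, hLp, hηp] at hsum
  have h' : ((2 * m : ℤ) : ℚ) = ((2 * n + 1 + 2 * ∑ a, f a : ℤ) : ℚ) := by
    push_cast at hsum ⊢
    linarith
  have h'' : 2 * m = 2 * (n : ℤ) + 1 + 2 * ∑ a, f a := by exact_mod_cast h'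
  omega

/-- A coordinate is nonnegative on the common face if a later one separates it from zero. -/
theorem coord_nonneg (E : IsClassicalVertexSet Φ pos A) (T : IsTightPair A mu α n v w)
    {p : Fin r → ℚ} (hp : IsTight A v w (mu + (n + 1 / 2 : ℚ) • α) p) {a b : Fin r} (hab : a < b)
    (hadd : v a + v b < 0 ∨ w a + w b < 0) (hsub : v a - v b < 0 ∨ w a - w b < 0) : 0 ≤ p a := by
  have h1 := T.root_nonneg E hp (E.add_mem_pos a b hab)
    (by simpa only [dotProduct_add, dotProduct_single, mul_one] using hadd)
  have h2 := T.root_nonneg E hp (E.sub_mem_pos a b hab)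
    (by simpa only [dotProduct_sub, dotProduct_single, mul_one] using hsub)
  simp only [add_dotProduct, sub_dotProduct, single_dotProduct, one_mul] at h1 h2
  linarith

theorem neg_or_neg_of_opposite (T : IsTightPair A mu α n v w) {a : Fin r} (h0 : v a ≠ 0)
    (hw : w a = -v a) : (v a = 1 ∧ w a = -1) ∨ (v a = -1 ∧ w a = 1) := by
  rcases T.left_sign a with h | h | h
  · exact absurd h h0
  · exact Or.inl ⟨h, by rw [hw, h]⟩
  · exact Or.inr ⟨h, by rw [hw, h, neg_neg]⟩

/-- The parity argument applies if every common zero of the facet normals is followed by an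
index on which they are opposite. -/
theorem false_of_zero_lt_opposite (E : IsClassicalVertexSet Φ pos A)
    (T : IsTightPair A mu α n v w) (hA : ∀ p ∈ A, ∀ a, ∃ m : ℤ, (p - mu) a = m)
    (heven : ∀ p ∈ A, ∃ m : ℤ, ∑ a, (p - mu) a = 2 * m)
    (hα : ∀ a, α a ≠ 0 → v a ≠ 0)
    (hlt : ∀ z, v z = 0 → w z = 0 → ∃ a, z < a ∧ v a ≠ 0 ∧ w a = -v a) : False := by
  refine T.false_of_zero_nonneg E hA heven hα fun p hp z hv hw => ?_
  obtain ⟨a, hza, h0, hw'⟩ := hlt z hv hw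
  refine T.coord_nonneg E hp hza ?_ ?_ <;>
    rcases T.neg_or_neg_of_opposite h0 hw' with ⟨h1, h2⟩ | ⟨h1, h2⟩ <;>
    rw [hv, hw, h1, h2] <;> norm_num

end IsTightPair

/-- Strings of simple roots in a lattice of even coordinate sum. -/
theorem IsTightPair.false_of_even (E : IsClassicalVertexSet Φ pos A)
    (T : IsTightPair A mu α n v w) (hA : ∀ p ∈ A, ∀ a, ∃ m : ℤ, (p - mu) a = m)
    (heven : ∀ p ∈ A, ∃ m : ℤ, ∑ a, (p - mu) a = 2 * m) {i j : Fin r}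
    (hα : α = Pi.single i 1 - Pi.single j 1) : False := by
  have hv := T.left_eq
  have hw := T.right_eq
  simp only [hα, dotProduct_sub, dotProduct_single, mul_one] at hv hw
  have hvi : v i = 1 ∧ v j = -1 := by
    rcases T.left_sign i with h | h | h <;> rcases T.left_sign j with h' | h' | h' <;>
      rw [h, h'] at hv <;> norm_num at hv
    exact ⟨h, h'⟩
  by_cases hz : ∃ z, (v z = 0 ∧ w z = 0) ∧ ∀ a, v a ≠ 0 → w a = -v a → a < z
  · obtain ⟨z, ⟨hvz, hwz⟩, hz⟩ := hz
    refine T.false_of_opposite_nonneg E hA hα fun p hp a h0 hw' => ?_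
    refine T.coord_nonneg E hp (hz a h0 hw') ?_ ?_ <;>
      rcases T.neg_or_neg_of_opposite h0 hw' with ⟨h1, h2⟩ | ⟨h1, h2⟩ <;>
      rw [hvz, hwz, h1, h2] <;> norm_num
  · push Not at hz
    refine T.false_of_zero_lt_opposite E hA heven (fun a ha h0 => ha ?_) fun z hvz hwz => ?_
    · have hai : a ≠ i := by
        rintro rfl
        rw [hvi.1] at h0
        norm_num at h0
      have haj : a ≠ j := by
        rintro rfl
        rw [hvi.2] at h0
        norm_num at h0
      rw [hα, Pi.sub_apply, Pi.single_eq_of_ne hai, Pi.single_eq_of_ne haj, sub_zero]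
    · obtain ⟨a, h0, hw', hle⟩ := hz z ⟨hvz, hwz⟩
      refine ⟨a, lt_of_le_of_ne hle ?_, h0, hw'⟩
      rintro rfl
      exact h0 hvz

end TightPair

/-- The root system with roots `±e_a ± e_b` and, if `κ ≠ 0`, also `±κ e_a`. -/
noncomputable abbrev classicalData (r : ℕ) (κ : ℚ) : RootData where
  r := r
  V := Fin r → ℚ
  Φ := {v | (κ ≠ 0 ∧ ∃ a : Fin r, v = Pi.single a κ ∨ v = -Pi.single a κ) ∨
      ∃ a b : Fin r, a < b ∧ (v = Pi.single a 1 - Pi.single b 1 ∨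
        v = Pi.single a 1 + Pi.single b 1 ∨ v = -(Pi.single a 1 - Pi.single b 1) ∨
        v = -(Pi.single a 1 + Pi.single b 1))}
  pos := {v | (κ ≠ 0 ∧ ∃ a : Fin r, v = Pi.single a κ) ∨
      ∃ a b : Fin r, a < b ∧ (v = Pi.single a 1 - Pi.single b 1 ∨
        v = Pi.single a 1 + Pi.single b 1)}
  coroot := stdCoroot
  α := fun i => if h : (i : ℕ) + 1 < r then
      Pi.single i 1 - Pi.single (⟨(i : ℕ) + 1, h⟩ : Fin r) 1
    else if κ ≠ 0 then Pi.single i κ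
    else if h2 : 1 < r then
      Pi.single (⟨r - 2, by omega⟩ : Fin r) 1 + Pi.single (⟨r - 1, by omega⟩ : Fin r) 1
    else 0

theorem typeB_eq_classicalData (r : ℕ) : typeB r = classicalData r 1 := by
  simp [typeB, classicalData]

theorem typeC_eq_classicalData (r : ℕ) : typeC r = classicalData r 2 := by
  simp [typeC, classicalData]

theorem typeD_eq_classicalData (r : ℕ) : typeD r = classicalData r 0 := by
  simp [typeD, classicalData]

theorem dotL_apply {r : ℕ} (β v : Fin r → ℚ) : dotL β v = β ⬝ᵥ v := by
  simp [dotL, dotProduct]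

theorem stdCoroot_apply {r : ℕ} (β v : Fin r → ℚ) :
    stdCoroot β v = 2 * (β ⬝ᵥ v) / (β ⬝ᵥ β) := by
  rw [stdCoroot, LinearMap.smul_apply, smul_eq_mul, dotL_apply, dotL_apply]
  ring

namespace classicalData

variable {r : ℕ} {κ : ℚ}

theorem add_mem_roots {a b : Fin r} (hab : a ≠ b) {σ τ : ℚ} (hσ : σ = 1 ∨ σ = -1)
    (hτ : τ = 1 ∨ τ = -1) : Pi.single a σ + Pi.single b τ ∈ (classicalData r κ).Φ := by
  have key : ∀ (a b : Fin r), a < b → ∀ σ τ : ℚ, (σ = 1 ∨ σ = -1) → (τ = 1 ∨ τ = -1) →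
      Pi.single a σ + Pi.single b τ ∈ (classicalData r κ).Φ := by
    rintro a b hab σ τ (rfl | rfl) (rfl | rfl)
    · exact Or.inr ⟨a, b, hab, Or.inr (Or.inl rfl)⟩
    · exact Or.inr ⟨a, b, hab, Or.inl (by rw [Pi.single_neg, sub_eq_add_neg])⟩
    · exact Or.inr ⟨a, b, hab, Or.inr (Or.inr (Or.inl (by rw [Pi.single_neg]; abel)))⟩
    · exact Or.inr ⟨a, b, hab, Or.inr (Or.inr (Or.inr (by
        rw [Pi.single_neg, Pi.single_neg]; abel)))⟩
  rcases lt_or_gt_of_ne hab with h | h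
  · exact key a b h σ τ hσ hτ
  · rw [add_comm]
    exact key b a h τ σ hτ hσ

theorem mem_roots_iff {β : Fin r → ℚ} : β ∈ (classicalData r κ).Φ ↔
    (κ ≠ 0 ∧ ∃ a k, (k = κ ∨ k = -κ) ∧ β = Pi.single a k) ∨ ∃ a b, ∃ σ τ : ℚ, a ≠ b ∧
    (σ = 1 ∨ σ = -1) ∧ (τ = 1 ∨ τ = -1) ∧ β = Pi.single a σ + Pi.single b τ := by
  constructor
  · rintro (⟨hκ, a, rfl | rfl⟩ | ⟨a, b, hab, rfl | rfl | rfl | rfl⟩)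
    · exact Or.inl ⟨hκ, a, κ, Or.inl rfl, rfl⟩
    · exact Or.inl ⟨hκ, a, -κ, Or.inr rfl, by rw [Pi.single_neg]⟩
    · exact Or.inr ⟨a, b, 1, -1, hab.ne, by simp, by simp, by rw [Pi.single_neg, sub_eq_add_neg]⟩
    · exact Or.inr ⟨a, b, 1, 1, hab.ne, by simp, by simp, rfl⟩
    · exact Or.inr ⟨a, b, -1, 1, hab.ne, by simp, by simp, by rw [Pi.single_neg]; abel⟩
    · exact Or.inr ⟨a, b, -1, -1, hab.ne, by simp, by simp, by
        rw [Pi.single_neg, Pi.single_neg]; abel⟩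
  · rintro (⟨hκ, a, k, rfl | rfl, rfl⟩ | ⟨a, b, σ, τ, hab, hσ, hτ, rfl⟩)
    · exact Or.inl ⟨hκ, a, Or.inl rfl⟩
    · exact Or.inl ⟨hκ, a, Or.inr (by rw [Pi.single_neg])⟩
    · exact add_mem_roots hab hσ hτ

theorem shape {β : Fin r → ℚ} (hβ : β ∈ (classicalData r κ).Φ) :
    (∃ a k, k ≠ 0 ∧ β = Pi.single a k) ∨ ∃ a b, ∃ σ τ : ℚ, a ≠ b ∧
    (σ = 1 ∨ σ = -1) ∧ (τ = 1 ∨ τ = -1) ∧ β = Pi.single a σ + Pi.single b τ := by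
  rcases mem_roots_iff.1 hβ with ⟨hκ, a, k, hk, rfl⟩ | h
  · refine Or.inl ⟨a, k, ?_, rfl⟩
    rcases hk with rfl | rfl
    · exact hκ
    · exact neg_ne_zero.2 hκ
  · exact Or.inr h

theorem dotProduct_add_single_self {a b : Fin r} (hab : a ≠ b) {σ τ : ℚ} (hσ : σ = 1 ∨ σ = -1)
    (hτ : τ = 1 ∨ τ = -1) : (Pi.single a σ + Pi.single b τ : Fin r → ℚ) ⬝ᵥ
      (Pi.single a σ + Pi.single b τ) = 2 := by
  simp [dotProduct_add, hab, hab.symm]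
  rcases hσ with rfl | rfl <;> rcases hτ with rfl | rfl <;> norm_num

theorem refl_apply (β v : Fin r → ℚ) :
    (classicalData r κ).refl β v = v - (2 * (β ⬝ᵥ v) / (β ⬝ᵥ β)) • β := by
  rw [← stdCoroot_apply]
  rfl

/-- Reflections act by signed permutations of the coordinates. -/
theorem exists_signed_perm {β : Fin r → ℚ} (hβ : β ∈ (classicalData r κ).Φ) :
    ∃ (π : Equiv.Perm (Fin r)) (ε : Fin r → ℚ), (∀ c, ε c = 1 ∨ ε c = -1) ∧
      ∀ (v : Fin r → ℚ) c, (classicalData r κ).refl β v c = ε c * v (π c) := by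
  rcases shape hβ with ⟨a, k, hk, rfl⟩ | ⟨a, b, σ, τ, hab, hσ, hτ, rfl⟩
  · refine ⟨1, fun c => if c = a then -1 else 1, fun c => ?_, fun v c => ?_⟩
    · by_cases h : c = a <;> simp [h]
    · rw [refl_apply]
      by_cases h : c = a
      · subst h
        simp
        field_simp
        ring
      · simp [h]
  · refine ⟨Equiv.swap a b, fun c => if c = a ∨ c = b then -(σ * τ) else 1, fun c => ?_,
      fun v c => ?_⟩
    · by_cases h : c = a ∨ c = b
      · simp only [if_pos h]
        rcases hσ with rfl | rfl <;> rcases hτ with rfl | rfl <;> norm_num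
      · simp [h]
    · rw [refl_apply, dotProduct_add_single_self hab hσ hτ]
      rcases eq_or_ne c a with rfl | ha
      · simp [hab, add_dotProduct]
        rcases hσ with rfl | rfl <;> rcases hτ with rfl | rfl <;> ring
      · rcases eq_or_ne c b with rfl | hb
        · simp [hab.symm, add_dotProduct]
          rcases hσ with rfl | rfl <;> rcases hτ with rfl | rfl <;> ring
        · rw [Equiv.swap_apply_of_ne_of_ne ha hb]
          simp [ha, hb]

theorem signed_perm_single (π : Equiv.Perm (Fin r)) (ε : Fin r → ℚ) (c : Fin r) (x : ℚ) :
    (fun i => ε i * (Pi.single c x : Fin r → ℚ) (π i)) =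
      Pi.single (π.symm c) (ε (π.symm c) * x) := by
  funext i
  rcases eq_or_ne i (π.symm c) with rfl | h
  · simp
  · have : π i ≠ c := fun h' => h (by rw [← h', Equiv.symm_apply_apply])
    simp [h, this]

theorem refl_mem_roots {β γ : Fin r → ℚ} (hβ : β ∈ (classicalData r κ).Φ)
    (hγ : γ ∈ (classicalData r κ).Φ) :
    (classicalData r κ).refl β γ ∈ (classicalData r κ).Φ := by
  obtain ⟨π, ε, hε, h⟩ := exists_signed_perm hβ
  have heq : (classicalData r κ).refl β γ = fun i => ε i * γ (π i) := funext (h γ)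
  have hmul : ∀ c (x y : ℚ), (x = y ∨ x = -y) → (ε c * x = y ∨ ε c * x = -y) := by
    rintro c x y (rfl | rfl) <;> rcases hε c with h | h <;> rw [h] <;> simp
  rw [heq]
  rcases mem_roots_iff.1 hγ with ⟨hκ, a, k, hk, rfl⟩ | ⟨a, b, σ, τ, hab, hσ, hτ, rfl⟩
  · rw [signed_perm_single]
    exact mem_roots_iff.2 (Or.inl ⟨hκ, _, _, hmul _ _ _ hk, rfl⟩)
  · have : (fun i => ε i * (Pi.single a σ + Pi.single b τ : Fin r → ℚ) (π i)) =
        Pi.single (π.symm a) (ε (π.symm a) * σ) + Pi.single (π.symm b) (ε (π.symm b) * τ) := by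
      rw [← signed_perm_single, ← signed_perm_single]
      funext i
      simp [mul_add]
    rw [this]
    exact add_mem_roots (by simpa using hab) (hmul _ _ _ hσ) (hmul _ _ _ hτ)

theorem exists_entry_of_orbit {lam v : (classicalData r κ).V}
    (hv : (classicalData r κ).Orbit lam v) : ∀ c, ∃ d, v c = lam d ∨ v c = -lam d := by
  induction hv with
  | base => exact fun c => ⟨c, Or.inl rfl⟩
  | @step p _ β hβ ih =>
    intro c
    obtain ⟨π, ε, hε, h⟩ := exists_signed_perm hβ
    obtain ⟨d, hd⟩ := ih (π c)
    refine ⟨d, ?_⟩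
    rw [h p c]
    rcases hε c with h1 | h1 <;> rcases hd with h2 | h2 <;> rw [h1, h2] <;> simp

theorem finite_orbit (lam : (classicalData r κ).V) :
    {v | (classicalData r κ).Orbit lam v}.Finite := by
  have hfin : (Set.pi Set.univ fun _ : Fin r => Set.range lam ∪ Set.range (-lam)).Finite :=
    Set.Finite.pi fun _ => (Set.finite_range _).union (Set.finite_range _)
  refine hfin.subset fun v hv c _ => ?_
  obtain ⟨d, hd | hd⟩ := exists_entry_of_orbit hv c
  · exact Or.inl ⟨d, hd.symm⟩
  · exact Or.inr ⟨d, hd.symm⟩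

theorem root_entry {β : Fin r → ℚ} (hβ : β ∈ (classicalData r κ).Φ) (c : Fin r) :
    β c = 0 ∨ (β c = 1 ∨ β c = -1) ∨ (β c = κ ∨ β c = -κ) := by
  rcases mem_roots_iff.1 hβ with ⟨hκ, a, k, hk, rfl⟩ | ⟨a, b, σ, τ, hab, hσ, hτ, rfl⟩
  · rcases eq_or_ne c a with rfl | h
    · simpa using Or.inr (Or.inr hk)
    · simp [h]
  · rcases eq_or_ne c a with rfl | h
    · simpa [hab] using Or.inr (Or.inl hσ)
    · rcases eq_or_ne c b with rfl | h'
      · simpa [h] using Or.inr (Or.inl hτ)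
      · simp [h, h']

theorem finite_roots : (classicalData r κ).Φ.Finite := by
  have hfin : (Set.pi Set.univ fun _ : Fin r => ({0, 1, -1, κ, -κ} : Set ℚ)).Finite :=
    Set.Finite.pi fun _ => Set.toFinite _
  refine hfin.subset fun v hv c _ => ?_
  have := root_entry hv c
  simp only [Set.mem_insert_iff, Set.mem_singleton_iff]
  tauto

theorem int_entry (hκ : κ = 0 ∨ κ = 1 ∨ κ = 2) {β : Fin r → ℚ}
    (hβ : β ∈ (classicalData r κ).Φ) (c : Fin r) : ∃ m : ℤ, β c = m := by
  have hκ' : ∃ k : ℤ, κ = k := by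
    rcases hκ with rfl | rfl | rfl
    · exact ⟨0, by simp⟩
    · exact ⟨1, by simp⟩
    · exact ⟨2, by simp⟩
  obtain ⟨k, rfl⟩ := hκ'
  rcases root_entry hβ c with h | (h | h) | (h | h)
  · exact ⟨0, by simp [h]⟩
  · exact ⟨1, by simp [h]⟩
  · exact ⟨-1, by simp [h]⟩
  · exact ⟨k, h⟩
  · exact ⟨-k, by simp [h]⟩

theorem coroot_int (hκ : κ = 0 ∨ κ = 1 ∨ κ = 2) {β γ : Fin r → ℚ}
    (hβ : β ∈ (classicalData r κ).Φ) (hγ : γ ∈ (classicalData r κ).Φ) :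
    ∃ m : ℤ, stdCoroot β γ = m := by
  rw [stdCoroot_apply]
  rcases mem_roots_iff.1 hβ with ⟨hκ0, a, k, hk, rfl⟩ | ⟨a, b, σ, τ, hab, hσ, hτ, rfl⟩
  · obtain ⟨m, hm⟩ := int_entry hκ hγ a
    simp only [single_dotProduct, Pi.single_eq_same]
    rcases hκ with rfl | rfl | rfl
    · exact absurd rfl hκ0
    · rcases hk with rfl | rfl
      · exact ⟨2 * m, by rw [hm]; push_cast; ring⟩
      · exact ⟨-(2 * m), by rw [hm]; push_cast; ring⟩
    · rcases hk with rfl | rfl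
      · exact ⟨m, by rw [hm]; ring⟩
      · exact ⟨-m, by rw [hm]; push_cast; ring⟩
  · obtain ⟨m, hm⟩ := int_entry hκ hγ a
    obtain ⟨m', hm'⟩ := int_entry hκ hγ b
    rw [dotProduct_add_single_self hab hσ hτ]
    simp only [add_dotProduct, single_dotProduct, hm, hm']
    rcases hσ with rfl | rfl <;> rcases hτ with rfl | rfl
    · exact ⟨m + m', by push_cast; ring⟩
    · exact ⟨m - m', by push_cast; ring⟩
    · exact ⟨-m + m', by push_cast; ring⟩
    · exact ⟨-m - m', by push_cast; ring⟩

theorem even_root_sum (hκ : κ = 0 ∨ κ = 2) {β : Fin r → ℚ} (hβ : β ∈ (classicalData r κ).Φ) :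
    ∃ m : ℤ, ∑ a, β a = 2 * m := by
  rcases mem_roots_iff.1 hβ with ⟨hκ0, a, k, hk, rfl⟩ | ⟨a, b, σ, τ, hab, hσ, hτ, rfl⟩
  · rw [Finset.sum_pi_single']
    rcases hκ with rfl | rfl
    · exact absurd rfl hκ0
    · rcases hk with rfl | rfl
      · exact ⟨1, by simp⟩
      · exact ⟨-1, by simp⟩
  · simp only [Pi.add_apply, Finset.sum_add_distrib, Finset.sum_pi_single']
    rcases hσ with rfl | rfl <;> rcases hτ with rfl | rfl
    · exact ⟨1, by norm_num⟩
    · exact ⟨0, by norm_num⟩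
    · exact ⟨0, by norm_num⟩
    · exact ⟨-1, by norm_num⟩

theorem int_entry_of_mem_rootLattice (hκ : κ = 0 ∨ κ = 1 ∨ κ = 2) {v : Fin r → ℚ}
    (hv : v ∈ (classicalData r κ).rootLattice) (c : Fin r) : ∃ m : ℤ, v c = m := by
  induction hv using AddSubgroup.closure_induction with
  | mem x hx => exact int_entry hκ hx c
  | zero => exact ⟨0, by simp⟩
  | add x y _ _ hx hy =>
    obtain ⟨a, ha⟩ := hx
    obtain ⟨b, hb⟩ := hy
    exact ⟨a + b, by simp [ha, hb]⟩
  | neg x _ hx =>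
    obtain ⟨a, ha⟩ := hx
    exact ⟨-a, by simp [ha]⟩

theorem even_sum_of_mem_rootLattice (hκ : κ = 0 ∨ κ = 2) {v : Fin r → ℚ}
    (hv : v ∈ (classicalData r κ).rootLattice) : ∃ m : ℤ, ∑ a, v a = 2 * m := by
  induction hv using AddSubgroup.closure_induction with
  | mem x hx => exact even_root_sum hκ hx
  | zero => exact ⟨0, by simp⟩
  | add x y _ _ hx hy =>
    obtain ⟨a, ha⟩ := hx
    obtain ⟨b, hb⟩ := hy
    exact ⟨a + b, by simp [Finset.sum_add_distrib, ha, hb, mul_add]⟩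
  | neg x _ hx =>
    obtain ⟨a, ha⟩ := hx
    exact ⟨-a, by simp [ha]⟩

end classicalData

namespace classicalData

variable {r : ℕ} {κ : ℚ}

theorem simple_of_lt {i : Fin r} (hi : (i : ℕ) + 1 < r) :
    (classicalData r κ).α i = Pi.single i 1 - Pi.single (⟨(i : ℕ) + 1, hi⟩ : Fin r) 1 :=
  dif_pos hi

theorem simple_of_not_lt (hκ : κ ≠ 0) {i : Fin r} (hi : ¬(i : ℕ) + 1 < r) :
    (classicalData r κ).α i = Pi.single i κ :=
  (dif_neg hi).trans (if_pos hκ)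

theorem simple_of_not_lt_zero (hr : 1 < r) {i : Fin r} (hi : ¬(i : ℕ) + 1 < r) :
    (classicalData r 0).α i =
      Pi.single (⟨r - 2, by omega⟩ : Fin r) 1 + Pi.single (⟨r - 1, by omega⟩ : Fin r) 1 :=
  (dif_neg hi).trans ((if_neg (by simp)).trans (dif_pos hr))

theorem simple_mem_pos (hr : 1 < r) (i : Fin r) :
    (classicalData r κ).α i ∈ (classicalData r κ).pos := by
  by_cases hi : (i : ℕ) + 1 < r
  · rw [simple_of_lt hi]
    exact Or.inr ⟨i, ⟨i + 1, hi⟩, Fin.lt_def.2 (Nat.lt_succ_self _), Or.inl rfl⟩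
  · by_cases hκ : κ = 0
    · subst hκ
      rw [simple_of_not_lt_zero hr hi]
      exact Or.inr ⟨_, _, Fin.lt_def.2 (show r - 2 < r - 1 by omega), Or.inr rfl⟩
    · rw [simple_of_not_lt hκ hi]
      exact Or.inl ⟨hκ, i, rfl⟩

theorem pos_subset : (classicalData r κ).pos ⊆ (classicalData r κ).Φ := by
  rintro β (⟨hκ, a, rfl⟩ | ⟨a, b, hab, rfl | rfl⟩)
  · exact Or.inl ⟨hκ, a, Or.inl rfl⟩
  · exact Or.inr ⟨a, b, hab, Or.inl rfl⟩
  · exact Or.inr ⟨a, b, hab, Or.inr (Or.inl rfl)⟩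

theorem pos_or {β : Fin r → ℚ} (hβ : β ∈ (classicalData r κ).Φ) :
    β ∈ (classicalData r κ).pos ∨ -β ∈ (classicalData r κ).pos := by
  rcases hβ with ⟨hκ, a, rfl | rfl⟩ | ⟨a, b, hab, rfl | rfl | rfl | rfl⟩
  · exact Or.inl (Or.inl ⟨hκ, a, rfl⟩)
  · exact Or.inr (Or.inl ⟨hκ, a, neg_neg _⟩)
  · exact Or.inl (Or.inr ⟨a, b, hab, Or.inl rfl⟩)
  · exact Or.inl (Or.inr ⟨a, b, hab, Or.inr rfl⟩)
  · exact Or.inr (Or.inr ⟨a, b, hab, Or.inl (neg_neg _)⟩)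
  · exact Or.inr (Or.inr ⟨a, b, hab, Or.inr (neg_neg _)⟩)

theorem dotProduct_self_pos {β : Fin r → ℚ} (hβ : β ∈ (classicalData r κ).Φ) : 0 < β ⬝ᵥ β := by
  rcases shape hβ with ⟨a, k, hk, rfl⟩ | ⟨a, b, σ, τ, hab, hσ, hτ, rfl⟩
  · simpa using mul_self_pos.2 hk
  · rw [dotProduct_add_single_self hab hσ hτ]
    norm_num

theorem stdCoroot_neg_iff {β : Fin r → ℚ} (hβ : β ∈ (classicalData r κ).Φ) (v : Fin r → ℚ) :
    stdCoroot β v < 0 ↔ β ⬝ᵥ v < 0 := by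
  have h := dotProduct_self_pos hβ
  rw [stdCoroot_apply, div_lt_iff₀ h, zero_mul]
  constructor <;> intro <;> linarith

/-- An integral weight which is positive on all positive roots but one, on which it vanishes,
shows that the reflection in this root permutes the remaining positive roots. -/
theorem refl_mem_pos_of_weight (hκ : 0 ≤ κ) {γ β : Fin r → ℚ} (hγ : γ ∈ (classicalData r κ).Φ)
    (N : Fin r → ℤ) (h0 : (fun a => (N a : ℚ)) ⬝ᵥ γ = 0)
    (hsingle : κ ≠ 0 → ∀ a, Pi.single a κ ≠ γ → 0 < N a)
    (hsub : ∀ a b, a < b → Pi.single a 1 - Pi.single b 1 ≠ γ → N b < N a)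
    (hadd : ∀ a b, a < b → Pi.single a 1 + Pi.single b 1 ≠ γ → 0 < N a + N b)
    (hβ : β ∈ (classicalData r κ).pos) (hne : β ≠ γ) :
    (classicalData r κ).refl γ β ∈ (classicalData r κ).pos := by
  have hN : ∀ δ ∈ (classicalData r κ).pos, δ ≠ γ → 0 < (fun a => (N a : ℚ)) ⬝ᵥ δ := by
    rintro δ (⟨hκ0, a, rfl⟩ | ⟨a, b, hab, rfl | rfl⟩) hδ
    · rw [dotProduct_single]
      exact mul_pos (Int.cast_pos.2 (hsingle hκ0 a hδ)) (lt_of_le_of_ne hκ hκ0.symm)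
    · rw [dotProduct_sub, dotProduct_single, dotProduct_single, mul_one, mul_one, sub_pos]
      exact Int.cast_lt.2 (hsub a b hab hδ)
    · rw [dotProduct_add, dotProduct_single, dotProduct_single, mul_one, mul_one, ← Int.cast_add]
      exact Int.cast_pos.2 (hadd a b hab hδ)
  refine (pos_or (refl_mem_roots hγ (pos_subset hβ))).resolve_right fun hn => ?_
  have h1 : (fun a => (N a : ℚ)) ⬝ᵥ (classicalData r κ).refl γ β =
      (fun a => (N a : ℚ)) ⬝ᵥ β := by
    rw [refl_apply, dotProduct_sub, dotProduct_smul, h0, smul_zero, sub_zero]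
  have h2 := hN β hβ hne
  have h3 : 0 ≤ (fun a => (N a : ℚ)) ⬝ᵥ (-(classicalData r κ).refl γ β) := by
    by_cases h : -(classicalData r κ).refl γ β = γ
    · rw [h, h0]
    · exact (hN _ hn h).le
  rw [dotProduct_neg, h1] at h3
  linarith

theorem simple_refl_mem_pos (hr : 1 < r) (hκ : 0 ≤ κ) (i : Fin r) {β : Fin r → ℚ}
    (hβ : β ∈ (classicalData r κ).pos) (hne : β ≠ (classicalData r κ).α i) :
    (classicalData r κ).refl ((classicalData r κ).α i) β ∈ (classicalData r κ).pos := by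
  have hα := pos_subset (simple_mem_pos (κ := κ) hr i)
  by_cases hi : (i : ℕ) + 1 < r
  · rw [simple_of_lt hi] at hα hne ⊢
    refine refl_mem_pos_of_weight hκ hα
      (fun a => if (a : ℕ) = i + 1 then (r : ℤ) - i else (r : ℤ) - a) (by simp [dotProduct_sub])
      (fun _ a _ => ?_) (fun a b hab hne' => ?_) (fun a b _ _ => ?_) hβ hne
    · split_ifs <;> omega
    · have h : ¬((a : ℕ) = i ∧ (b : ℕ) = i + 1) := by
        rintro ⟨h1, h2⟩
        rw [Fin.ext h1, show b = ⟨i + 1, hi⟩ from Fin.ext h2] at hne'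
        exact hne' rfl
      rw [Fin.lt_def] at hab
      split_ifs <;> omega
    · split_ifs <;> omega
  · by_cases hκ0 : κ = 0
    · subst hκ0
      rw [simple_of_not_lt_zero hr hi] at hα hne ⊢
      refine refl_mem_pos_of_weight hκ hα
        (fun a => if (a : ℕ) + 1 = r then -1 else (r : ℤ) - 1 - a) ?_
        (fun h => absurd rfl h) (fun a b hab _ => ?_) (fun a b hab hne' => ?_) hβ hne
      · rw [dotProduct_add, dotProduct_single, dotProduct_single, mul_one, mul_one, ← Int.cast_add,
          Int.cast_eq_zero]
        dsimp only
        split_ifs <;> omega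
      · rw [Fin.lt_def] at hab
        split_ifs <;> omega
      · have h : ¬((a : ℕ) = r - 2 ∧ (b : ℕ) = r - 1) := by
          rintro ⟨h1, h2⟩
          rw [show a = ⟨r - 2, by omega⟩ from Fin.ext h1,
            show b = ⟨r - 1, by omega⟩ from Fin.ext h2] at hne'
          exact hne' rfl
        rw [Fin.lt_def] at hab
        split_ifs <;> omega
    · rw [simple_of_not_lt hκ0 hi] at hα hne ⊢
      refine refl_mem_pos_of_weight hκ hα (fun a => (r : ℤ) - 1 - a) ?_
        (fun _ a hne' => ?_) (fun a b hab _ => ?_) (fun a b hab _ => ?_) hβ hne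
      · have : ((r : ℤ) - 1 - (i : ℕ)) = 0 := by omega
        simp only [dotProduct_single, this, Int.cast_zero, zero_mul]
      · have : (a : ℕ) ≠ i := fun h => hne' (by rw [Fin.ext h])
        omega
      · rw [Fin.lt_def] at hab
        omega
      · rw [Fin.lt_def] at hab
        omega

theorem dotProduct_nonneg_of_dominant (hr : 1 < r) (hκ : 0 ≤ κ) {v : Fin r → ℚ}
    (hv : (classicalData r κ).Dominant v) {β : Fin r → ℚ} (hβ : β ∈ (classicalData r κ).pos) :
    0 ≤ β ⬝ᵥ v := by
  have hs : ∀ i : Fin r, 0 ≤ (classicalData r κ).α i ⬝ᵥ v := fun i =>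
    not_lt.1 fun h => not_lt.2 (hv i)
      ((stdCoroot_neg_iff (pos_subset (simple_mem_pos hr i)) v).2 h)
  have hanti : ∀ (n : ℕ) (a b : Fin r), (a : ℕ) + n = b → v b ≤ v a := by
    intro n
    induction n with
    | zero => exact fun a b h => by rw [Fin.ext h]
    | succ n ih =>
      intro a b h
      have ha : (a : ℕ) + 1 < r := by have := b.2; omega
      have h1 := hs a
      rw [simple_of_lt ha, sub_dotProduct, single_dotProduct, single_dotProduct] at h1
      have h2 := ih ⟨a + 1, ha⟩ b (by simp only; omega)
      linarith
  have hle : ∀ a b : Fin r, (a : ℕ) ≤ b → v b ≤ v a := fun a b h =>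
    hanti (b - a) a b (by omega)
  have hlast : ¬((⟨r - 1, by omega⟩ : Fin r) : ℕ) + 1 < r := by simp only; omega
  have h1 := hs ⟨r - 1, by omega⟩
  by_cases hκ0 : κ = 0
  · subst hκ0
    rw [simple_of_not_lt_zero hr hlast, add_dotProduct, single_dotProduct, single_dotProduct] at h1
    rcases hβ with ⟨hκ0, -⟩ | ⟨a, b, hab, rfl | rfl⟩
    · exact absurd rfl hκ0
    · rw [sub_dotProduct, single_dotProduct, single_dotProduct]
      have := hle a b (Fin.lt_def.1 hab).le
      linarith
    · rw [add_dotProduct, single_dotProduct, single_dotProduct]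
      rw [Fin.lt_def] at hab
      have h2 := hle a ⟨r - 2, by omega⟩ (by simp only; omega)
      have h3 := hle b ⟨r - 1, by omega⟩ (by simp only; omega)
      linarith
  · have hκ' := lt_of_le_of_ne hκ (Ne.symm hκ0)
    rw [simple_of_not_lt hκ0 hlast, single_dotProduct] at h1
    have hnn : ∀ a, 0 ≤ v a := fun a => (nonneg_of_mul_nonneg_right h1 hκ').trans
      (hle a _ (by simp only; omega))
    rcases hβ with ⟨-, a, rfl⟩ | ⟨a, b, hab, rfl | rfl⟩
    · rw [single_dotProduct]
      exact mul_nonneg hκ (hnn a)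
    · rw [sub_dotProduct, single_dotProduct, single_dotProduct]
      have := hle a b (Fin.lt_def.1 hab).le
      linarith
    · rw [add_dotProduct, single_dotProduct, single_dotProduct]
      linarith [hnn a, hnn b]

theorem isCrystallographic (hr : 1 < r) (hκ : κ = 0 ∨ κ = 1 ∨ κ = 2) :
    (classicalData r κ).IsCrystallographic (dotProductBilin ℚ ℚ) := by
  have hκ0 : 0 ≤ κ := by rcases hκ with rfl | rfl | rfl <;> norm_num
  refine
    { symm := fun x y => dotProduct_comm x y
      form_pos := fun β hβ => dotProduct_self_pos hβ
      coroot_eq := fun β _ v => stdCoroot_apply β v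
      refl_mem := fun β hβ γ hγ => refl_mem_roots hβ hγ
      integral := fun β hβ γ hγ => coroot_int hκ hβ hγ
      finite_pos := finite_roots.subset pos_subset
      pos_subset := pos_subset
      pos_or := fun β hβ => pos_or hβ
      exists_height := ⟨dotProductBilin ℚ ℚ fun a => (r : ℚ) - (a : ℕ), ?_⟩
      simple_pos := simple_mem_pos hr
      simple_refl := fun i β hβ hne => simple_refl_mem_pos hr hκ0 i hβ hne
      dominant_pos := fun v hv β hβ => ?_ }
  · intro β hβ
    change 0 < (fun a : Fin r => (r : ℚ) - (a : ℕ)) ⬝ᵥ β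
    have hlt : ∀ a : Fin r, (0 : ℚ) < r - (a : ℕ) := fun a => sub_pos.2 (by exact_mod_cast a.2)
    rcases hβ with ⟨hne, a, rfl⟩ | ⟨a, b, hab, rfl | rfl⟩
    · rw [dotProduct_single]
      exact mul_pos (hlt a) (lt_of_le_of_ne hκ0 hne.symm)
    · rw [dotProduct_sub, dotProduct_single, dotProduct_single, mul_one, mul_one]
      have : ((a : ℕ) : ℚ) < (b : ℕ) := by exact_mod_cast hab
      linarith
    · rw [dotProduct_add, dotProduct_single, dotProduct_single, mul_one, mul_one]
      exact add_pos (hlt a) (hlt b)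
  · refine not_lt.1 fun h => not_lt.2 (dotProduct_nonneg_of_dominant hr hκ0 hv hβ) ?_
    exact (stdCoroot_neg_iff (pos_subset hβ) v).1 h

end classicalData

theorem RootData.IsCrystallographic.sub_mem_rootLattice {R : RootData}
    {B : R.V →ₗ[ℚ] R.V →ₗ[ℚ] ℚ} (h : R.IsCrystallographic B) {lam : R.V} (hwt : R.IsWeight lam)
    (l : List (Fin R.r)) : ∀ p ∈ R.subwordOrbit lam l, p - lam ∈ R.rootLattice := by
  induction l with
  | nil =>
    rintro p rfl
    rw [sub_self]
    exact zero_mem _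
  | cons i l ih =>
    rintro p (hp | ⟨p, hp, rfl⟩)
    · exact ih p hp
    · obtain ⟨m, hm⟩ := h.isWeight_of_sub_mem hwt (ih p hp) _ (h.simple_mem i)
      rw [RootData.refl, hm, sub_right_comm, Int.cast_smul_eq_zsmul]
      exact sub_mem (ih p hp)
        (AddSubgroup.zsmul_mem _ (AddSubgroup.subset_closure (h.simple_mem i)) m)

namespace classicalData

variable {r : ℕ} {κ : ℚ}

theorem isClassicalVertexSet (hr : 1 < r) (hκ : κ = 0 ∨ κ = 1 ∨ κ = 2)
    {lam : (classicalData r κ).V} (hlam : (classicalData r κ).Dominant lam) (l : List (Fin r)) :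
    IsClassicalVertexSet (classicalData r κ).Φ (classicalData r κ).pos
      ((classicalData r κ).subwordOrbit lam l) where
  finite := RootData.finite_subwordOrbit lam l
  nonempty := RootData.subwordOrbit_nonempty lam l
  shape := fun _ hβ => shape hβ
  pos_subset := pos_subset
  sub_mem_pos := fun a b hab => Or.inr ⟨a, b, hab, Or.inl rfl⟩
  add_mem_pos := fun a b hab => Or.inr ⟨a, b, hab, Or.inr rfl⟩
  edge := fun p hp q hq => by
    refine AddSubmonoid.closure_mono ?_
      ((isCrystallographic hr hκ).sub_mem_edgeCone hlam l p hp q hq)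
    rintro v ⟨c, hc, β, hβ, h1, h2, rfl⟩
    exact ⟨c, hc, β, ⟨hβ, (stdCoroot_neg_iff hβ p).1 h2, by rwa [refl_apply] at h1⟩, rfl⟩
  lower := fun p hp β hβ hn => by
    rw [← refl_apply]
    exact (isCrystallographic hr hκ).isLower_subwordOrbit hlam l p hp β hβ
      ((stdCoroot_neg_iff (pos_subset hβ) p).2 hn)

theorem abs_dotProduct_root_le (hκ : κ = 0 ∨ κ = 1 ∨ κ = 2) {v β : Fin r → ℚ}
    (hv : IsSignVector v) (hβ : β ∈ (classicalData r κ).Φ) : |v ⬝ᵥ β| ≤ 2 := by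
  have hv' : ∀ a, |v a| ≤ 1 := fun a => by rcases hv a with h | h | h <;> rw [h] <;> norm_num
  rcases mem_roots_iff.1 hβ with ⟨-, a, k, hk, rfl⟩ | ⟨a, b, σ, τ, -, hσ, hτ, rfl⟩
  · have hk' : |k| ≤ 2 := by
      rcases hk with rfl | rfl <;> rcases hκ with rfl | rfl | rfl <;> norm_num
    rw [dotProduct_single, abs_mul]
    nlinarith [hv' a, abs_nonneg k, abs_nonneg (v a)]
  · have hσ' : |σ| = 1 := by rcases hσ with rfl | rfl <;> simp
    have hτ' : |τ| = 1 := by rcases hτ with rfl | rfl <;> simp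
    rw [dotProduct_add, dotProduct_single, dotProduct_single]
    refine (abs_add_le _ _).trans ?_
    rw [abs_mul, abs_mul, hσ', hτ']
    linarith [hv' a, hv' b]

theorem hasIntegralStrings (hr : 1 < r) (hκ : κ = 0 ∨ κ = 1 ∨ κ = 2)
    {lam : (classicalData r κ).V} (hwt : (classicalData r κ).IsWeight lam)
    (hlam : (classicalData r κ).Dominant lam) : (classicalData r κ).HasIntegralStrings lam := by
  intro l i mu t ht hmu hmem
  by_contra! hn
  have hcrys := isCrystallographic hr hκ
  have E := isClassicalVertexSet hr hκ hlam l
  have hα := hcrys.simple_mem i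
  have hsub : ∀ p ∈ (classicalData r κ).subwordOrbit lam l,
      p - mu ∈ (classicalData r κ).rootLattice := fun p hp => by
    rw [← sub_sub_sub_cancel_right p mu lam]
    exact sub_mem (hcrys.sub_mem_rootLattice hwt l p hp) hmu
  have hA : ∀ p ∈ (classicalData r κ).subwordOrbit lam l, ∀ a, ∃ m : ℤ, (p - mu) a = m :=
    fun p hp => int_entry_of_mem_rootLattice hκ (hsub p hp)
  have heven : κ = 0 ∨ κ = 2 → ∀ p ∈ (classicalData r κ).subwordOrbit lam l,
      ∃ m : ℤ, ∑ a, (p - mu) a = 2 * m :=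
    fun h p hp => even_sum_of_mem_rootLattice h (hsub p hp)
  obtain ⟨n, v, w, T⟩ := E.exists_isTightPair (int_entry hκ hα)
    (fun v hv => abs_dotProduct_root_le hκ hv hα) hA ht hmem hn
  by_cases hi : (i : ℕ) + 1 < r
  · have hαi := simple_of_lt (κ := κ) hi
    by_cases h1 : κ = 1
    · subst h1
      refine T.false_of_opposite_nonneg E hA hαi fun p hp a h0 hw => ?_
      have := T.root_nonneg E hp (β := Pi.single a 1) (Or.inl ⟨one_ne_zero, a, rfl⟩) (by
        rw [dotProduct_single, dotProduct_single]
        rcases T.neg_or_neg_of_opposite h0 hw with ⟨h1, h2⟩ | ⟨h1, h2⟩ <;> rw [h1, h2] <;>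
          norm_num)
      simpa using this
    · exact T.false_of_even E hA (heven (by tauto)) hαi
  · have hv := T.left_eq
    have hw := T.right_eq
    rcases hκ with rfl | rfl | rfl
    · have hαi := simple_of_not_lt_zero hr hi
      rw [hαi, dotProduct_add, dotProduct_single, dotProduct_single, mul_one, mul_one] at hv hw
      set a : Fin r := ⟨r - 2, by omega⟩
      set b : Fin r := ⟨r - 1, by omega⟩ with hb
      have hv' : v a = 1 ∧ v b = 1 := by
        rcases T.left_sign a with h | h | h <;> rcases T.left_sign b with h' | h' | h' <;>
          rw [h, h'] at hv <;> norm_num at hv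
        exact ⟨h, h'⟩
      have hw' : w b = -1 := by
        rcases T.right_sign a with h | h | h <;> rcases T.right_sign b with h' | h' | h' <;>
          rw [h, h'] at hw <;> norm_num at hw
        exact h'
      refine T.false_of_zero_lt_opposite E hA (heven (Or.inl rfl)) (fun c hc hvc => hc ?_)
        fun z hz _ => ⟨b, ?_, by simp [hv'.2], by rw [hw', hv'.2]⟩
      · have ha : c ≠ a := by
          rintro rfl
          simp [hv'.1] at hvc
        have hb : c ≠ b := by
          rintro rfl
          simp [hv'.2] at hvc
        rw [hαi, Pi.add_apply, Pi.single_eq_of_ne ha, Pi.single_eq_of_ne hb, add_zero]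
      · have : z ≠ b := by
          rintro rfl
          simp [hv'.2] at hz
        rw [Fin.lt_def]
        rw [Ne, Fin.ext_iff] at this
        simp only [hb] at this ⊢
        omega
    · rw [simple_of_not_lt one_ne_zero hi, dotProduct_single, mul_one] at hv
      rcases T.left_sign i with h | h | h <;> rw [h] at hv <;> norm_num at hv
    · have hαi := simple_of_not_lt (κ := 2) two_ne_zero hi
      rw [hαi, dotProduct_single] at hv hw
      have hv' : v i = 1 := by linarith
      have hw' : w i = -1 := by linarith
      refine T.false_of_zero_lt_opposite E hA (heven (Or.inr rfl)) (fun c hc hvc => hc ?_)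
        fun z hz _ => ⟨i, ?_, by simp [hv'], by rw [hw', hv']⟩
      · have ha : c ≠ i := by
          rintro rfl
          simp [hv'] at hvc
        rw [hαi, Pi.single_eq_of_ne ha]
      · have : z ≠ i := by
          rintro rfl
          simp [hv'] at hz
        rw [Fin.lt_def]
        rw [Ne, Fin.ext_iff] at this
        omega

/-- Demazure characters of the classical root systems are saturated. -/
theorem demChar_pos (hr : 1 < r) (hκ : κ = 0 ∨ κ = 1 ∨ κ = 2) {R : RootData}
    (hR : R = classicalData r κ) {lam : R.V} (hwt : R.IsWeight lam) (hlam : R.Dominant lam)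
    (l : List (Fin R.r)) {mu : R.V} (hQ : lam - mu ∈ R.rootLattice)
    (hmu : mu ∈ R.demPolytope lam (R.wordProd l)) : 0 < R.demChar l lam mu := by
  subst hR
  exact (isCrystallographic hr hκ).demChar_pos hwt hlam (finite_orbit lam)
    (hasIntegralStrings hr hκ hwt hlam) l hQ hmu

end classicalData

theorem statement2 (R : RootData)
    (hR : (∃ r, 2 ≤ r ∧ R = typeB r) ∨ (∃ r, 3 ≤ r ∧ R = typeC r) ∨
      ∃ r, 4 ≤ r ∧ R = typeD r)
    (lam : R.V) (hwt : R.IsWeight lam) (hdom : R.Dominant lam)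
    (l : List (Fin R.r)) (hl : R.Reduced l)
    (mu : R.V) (hmuwt : R.IsWeight mu) (hQ : lam - mu ∈ R.rootLattice)
    (hconv : mu ∈ R.demPolytope lam (R.wordProd l)) :
    0 < R.demChar l lam mu := by
  rcases hR with ⟨r, hr, hR⟩ | ⟨r, hr, hR⟩ | ⟨r, hr, hR⟩
  · exact classicalData.demChar_pos (by omega) (by norm_num)
      (hR.trans (typeB_eq_classicalData r)) hwt hdom l hQ hconv
  · exact classicalData.demChar_pos (by omega) (by norm_num)
      (hR.trans (typeC_eq_classicalData r)) hwt hdom l hQ hconv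
  · exact classicalData.demChar_pos (by omega) (by norm_num)
      (hR.trans (typeD_eq_classicalData r)) hwt hdom l hQ hconv
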